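/- Let k'/k be a finite extension of fields of degree n, X a quasi-projective scheme over k, and π : L' → X_{k'} a line bundle on the base change X_{k'}. Then: (i) the Weil restriction R_{k'/k}(π) : R_{k'/k}(L') → R_{k'/k}(X_{k'}) is a vector bundle of rank n; (ii) the norm N(L') is isomorphic as a line bundle on X to j_X^*(det R_{k'/k}(L')), where j_X : X → R_{k'/k}(X_{k'}) is the adjunction closed immersion; (iii) if X is equipped with an action of an algebraic group G over k and L' is G_{k'}-linearized, then N(L') is G-linearized. -/

import Mathlib

open AlgebraicGeometry CategoryTheory CategoryTheory.Limits Opposite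

universe u

noncomputable section

/-- The spectrum of the field `k`, the base of all schemes considered. -/
abbrev Spk (k : Type u) [Field k] : Scheme.{u} := Spec (CommRingCat.of k)

/-- A scheme over the field `k`: a scheme together with a structure morphism to `Spec k`. -/
structure SchemeOver (k : Type u) [Field k] : Type (u + 1) where
  carrier : Scheme.{u}
  str : carrier ⟶ Spk k

variable (k : Type u) [Field k]

/-- A group scheme over `k`, presented via its functor of points: for every scheme `T`
and every pair of `T`-points lying over the same `T`-point of `Spec k`, a product point,
together with unit and inverse, satisfying the group axioms functorially. -/
structure GroupSchemeOver extends SchemeOver k where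
  mul : ∀ {T : Scheme.{u}} (a b : T ⟶ carrier), a ≫ str = b ≫ str → (T ⟶ carrier)
  one : Spk k ⟶ carrier
  inv : ∀ {T : Scheme.{u}}, (T ⟶ carrier) → (T ⟶ carrier)
  mul_str : ∀ {T : Scheme.{u}} (a b : T ⟶ carrier) (h), mul a b h ≫ str = a ≫ str
  one_str : one ≫ str = 𝟙 (Spk k)
  inv_str : ∀ {T : Scheme.{u}} (a : T ⟶ carrier), inv a ≫ str = a ≫ str
  mul_natural : ∀ {T' T : Scheme.{u}} (g : T' ⟶ T) (a b : T ⟶ carrier) (h h'),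
    g ≫ mul a b h = mul (g ≫ a) (g ≫ b) h'
  inv_natural : ∀ {T' T : Scheme.{u}} (g : T' ⟶ T) (a : T ⟶ carrier),
    g ≫ inv a = inv (g ≫ a)
  mul_assoc : ∀ {T : Scheme.{u}} (a b c : T ⟶ carrier) (h₁ h₂ h₃ h₄),
    mul (mul a b h₁) c h₂ = mul a (mul b c h₃) h₄
  one_mul : ∀ {T : Scheme.{u}} (a : T ⟶ carrier) (h), mul (a ≫ str ≫ one) a h = a
  mul_one : ∀ {T : Scheme.{u}} (a : T ⟶ carrier) (h), mul a (a ≫ str ≫ one) h = a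
  inv_mul : ∀ {T : Scheme.{u}} (a : T ⟶ carrier) (h), mul (inv a) a h = a ≫ str ≫ one

variable {k}

theorem GroupSchemeOver.mul_congr (G : GroupSchemeOver k) {T : Scheme.{u}}
    {a a' b b' : T ⟶ G.carrier} (ha : a = a') (hb : b = b') (h h') :
    G.mul a b h = G.mul a' b' h' := by subst ha; subst hb; rfl

/-- A homomorphism of group schemes over `k`. -/
structure GroupHom (G H : GroupSchemeOver k) where
  hom : G.carrier ⟶ H.carrier
  hom_str : hom ≫ H.str = G.str
  hom_one : G.one ≫ hom = H.one
  hom_mul : ∀ {T : Scheme.{u}} (a b : T ⟶ G.carrier) (h h'),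
    G.mul a b h ≫ hom = H.mul (a ≫ hom) (b ≫ hom) h'

/-- An action of a group scheme `G` over `k` on a scheme `X` over `k`, presented via
its functor of points. -/
structure ActionOver (G : GroupSchemeOver k) (X : SchemeOver k) where
  act : ∀ {T : Scheme.{u}} (g : T ⟶ G.carrier) (x : T ⟶ X.carrier),
    g ≫ G.str = x ≫ X.str → (T ⟶ X.carrier)
  act_str : ∀ {T : Scheme.{u}} (g : T ⟶ G.carrier) (x : T ⟶ X.carrier) (h),
    act g x h ≫ X.str = x ≫ X.str
  act_natural : ∀ {T' T : Scheme.{u}} (f : T' ⟶ T) (g : T ⟶ G.carrier)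
    (x : T ⟶ X.carrier) (h h'), f ≫ act g x h = act (f ≫ g) (f ≫ x) h'
  one_act : ∀ {T : Scheme.{u}} (x : T ⟶ X.carrier) (h), act (x ≫ X.str ≫ G.one) x h = x
  mul_act : ∀ {T : Scheme.{u}} (g g' : T ⟶ G.carrier) (x : T ⟶ X.carrier) (h₁ h₂ h₃ h₄),
    act (G.mul g g' h₁) x h₂ = act g (act g' x h₃) h₄

theorem ActionOver.act_congr {G : GroupSchemeOver k} {X : SchemeOver k}
    (α : ActionOver G X) {T : Scheme.{u}} {g g' : T ⟶ G.carrier} {x x' : T ⟶ X.carrier}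
    (hg : g = g') (hx : x = x') (h h') : α.act g x h = α.act g' x' h' := by
  subst hg; subst hx; rfl

/-- The action of a group scheme on itself by left translations. -/
def GroupSchemeOver.selfAction (G : GroupSchemeOver k) : ActionOver G G.toSchemeOver where
  act g x h := G.mul g x h
  act_str g x h := (G.mul_str g x h).trans h
  act_natural f g x h h' := G.mul_natural f g x h h'
  one_act x h := G.one_mul x h
  mul_act g g' x h₁ h₂ h₃ h₄ := G.mul_assoc g g' x h₁ h₂ h₃ h₄

/-- Restriction of an action along a homomorphism of group schemes. -/
def ActionOver.res {G H : GroupSchemeOver k} {X : SchemeOver k} (φ : GroupHom H G)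
    (α : ActionOver G X) : ActionOver H X where
  act g x h := α.act (g ≫ φ.hom) x (by rw [Category.assoc, φ.hom_str, h])
  act_str g x h := α.act_str _ _ _
  act_natural f g x h h' := by
    refine (α.act_natural f (g ≫ φ.hom) x _ ?_).trans (α.act_congr ?_ rfl _ _)
    · simp only [Category.assoc, φ.hom_str, ← h']
    · simp only [Category.assoc]
  one_act x h := by
    refine (α.act_congr ?_ rfl _ ?_).trans (α.one_act x ?_)
    · simp only [Category.assoc, φ.hom_one]
    · simp only [Category.assoc, G.one_str, Category.comp_id]
    · simp only [Category.assoc, G.one_str, Category.comp_id]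
  mul_act g g' x h₁ h₂ h₃ h₄ := by
    have hg : g ≫ H.str = x ≫ X.str := (H.mul_str g g' h₁).symm.trans h₂
    have hg' : g' ≫ H.str = x ≫ X.str := h₁.symm.trans hg
    have p1 : (g ≫ φ.hom) ≫ G.str = (g' ≫ φ.hom) ≫ G.str := by
      simp only [Category.assoc, φ.hom_str]; exact h₁
    have p3 : (g' ≫ φ.hom) ≫ G.str = x ≫ X.str := by
      simp only [Category.assoc, φ.hom_str]; exact hg'
    refine (α.act_congr (φ.hom_mul g g' h₁ p1) rfl _ ?_).trans
      (α.mul_act (g ≫ φ.hom) (g' ≫ φ.hom) x p1 ?_ p3 ?_)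
    · rw [G.mul_str]
      simp only [Category.assoc, φ.hom_str]; exact hg
    · rw [G.mul_str]
      simp only [Category.assoc, φ.hom_str]; exact hg
    · rw [α.act_str]
      simp only [Category.assoc, φ.hom_str]; exact hg
/-! ### Vector bundles and line bundles, geometrically -/

/-- The data underlying a (geometric) vector bundle on a scheme `X`: a total space `π : tot ⟶ X`
together with a fiberwise `Γ(T, ⊤)`-module structure on the `T`-points of `tot` over a fixed
`T`-point of `X`, functorially in `T`. -/
structure VecBundleData (X : Scheme.{u}) : Type (u + 1) where
  tot : Scheme.{u}
  π : tot ⟶ X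
  zero : X ⟶ tot
  zero_π : zero ≫ π = 𝟙 X
  add : ∀ {T : Scheme.{u}} (a b : T ⟶ tot), a ≫ π = b ≫ π → (T ⟶ tot)
  smul : ∀ {T : Scheme.{u}} (f : Γ(T, ⊤)) (a : T ⟶ tot), T ⟶ tot
  add_π : ∀ {T : Scheme.{u}} (a b : T ⟶ tot) (h), add a b h ≫ π = a ≫ π
  smul_π : ∀ {T : Scheme.{u}} (f : Γ(T, ⊤)) (a : T ⟶ tot), smul f a ≫ π = a ≫ π
  add_natural : ∀ {T' T : Scheme.{u}} (g : T' ⟶ T) (a b : T ⟶ tot) (h h'),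
    g ≫ add a b h = add (g ≫ a) (g ≫ b) h'
  smul_natural : ∀ {T' T : Scheme.{u}} (g : T' ⟶ T) (f : Γ(T, ⊤)) (a : T ⟶ tot),
    g ≫ smul f a = smul (g.appTop f) (g ≫ a)
  add_comm : ∀ {T : Scheme.{u}} (a b : T ⟶ tot) (h h'), add a b h = add b a h'
  add_assoc : ∀ {T : Scheme.{u}} (a b c : T ⟶ tot) (h₁ h₂ h₃ h₄),
    add (add a b h₁) c h₂ = add a (add b c h₃) h₄
  zero_add : ∀ {T : Scheme.{u}} (a : T ⟶ tot) (h), add ((a ≫ π) ≫ zero) a h = a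
  one_smul : ∀ {T : Scheme.{u}} (a : T ⟶ tot), smul 1 a = a
  mul_smul : ∀ {T : Scheme.{u}} (f g : Γ(T, ⊤)) (a : T ⟶ tot), smul (f * g) a = smul f (smul g a)
  smul_add : ∀ {T : Scheme.{u}} (f : Γ(T, ⊤)) (a b : T ⟶ tot) (h h'),
    smul f (add a b h) = add (smul f a) (smul f b) h'
  add_smul : ∀ {T : Scheme.{u}} (f g : Γ(T, ⊤)) (a : T ⟶ tot) (h),
    smul (f + g) a = add (smul f a) (smul g a) h
  zero_smul : ∀ {T : Scheme.{u}} (a : T ⟶ tot), smul 0 a = (a ≫ π) ≫ zero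
  smul_zero : ∀ {T : Scheme.{u}} (f : Γ(T, ⊤)) (x : T ⟶ X), smul f (x ≫ zero) = x ≫ zero

namespace VecBundleData

variable {X : Scheme.{u}} (E : VecBundleData X)

theorem add_congr {T : Scheme.{u}} {a a' b b' : T ⟶ E.tot} (ha : a = a') (hb : b = b')
    (h h') : E.add a b h = E.add a' b' h' := by subst ha; subst hb; rfl

/-- The fiber of a vector bundle over a `T`-point of the base. -/
abbrev Fiber {T : Scheme.{u}} (x : T ⟶ X) : Type u := { a : T ⟶ E.tot // a ≫ E.π = x }

instance fiberZero {T : Scheme.{u}} (x : T ⟶ X) : Zero (E.Fiber x) :=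
  ⟨⟨x ≫ E.zero, by rw [Category.assoc, E.zero_π, Category.comp_id]⟩⟩

instance fiberAdd {T : Scheme.{u}} (x : T ⟶ X) : Add (E.Fiber x) :=
  ⟨fun a b => ⟨E.add a.1 b.1 (a.2.trans b.2.symm), (E.add_π _ _ _).trans a.2⟩⟩

instance fiberSMul {T : Scheme.{u}} (x : T ⟶ X) : SMul Γ(T, ⊤) (E.Fiber x) :=
  ⟨fun f a => ⟨E.smul f a.1, (E.smul_π _ _).trans a.2⟩⟩

@[simp] theorem coe_fiber_zero {T : Scheme.{u}} (x : T ⟶ X) :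
    ((0 : E.Fiber x) : T ⟶ E.tot) = x ≫ E.zero := rfl

@[simp] theorem coe_fiber_add {T : Scheme.{u}} (x : T ⟶ X) (a b : E.Fiber x) :
    ((a + b : E.Fiber x) : T ⟶ E.tot) = E.add a.1 b.1 (a.2.trans b.2.symm) := rfl

@[simp] theorem coe_fiber_smul {T : Scheme.{u}} (x : T ⟶ X) (f : Γ(T, ⊤)) (a : E.Fiber x) :
    ((f • a : E.Fiber x) : T ⟶ E.tot) = E.smul f a.1 := rfl

instance {T : Scheme.{u}} (x : T ⟶ X) : AddCommMonoid (E.Fiber x) where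
  add_assoc a b c := Subtype.ext (E.add_assoc _ _ _ _ _ _ _)
  add_comm a b := Subtype.ext (E.add_comm _ _ _ _)
  zero_add a := Subtype.ext (by
    have hz : ((a.1 ≫ E.π) ≫ E.zero) ≫ E.π = a.1 ≫ E.π := by
      rw [Category.assoc, E.zero_π, Category.comp_id]
    show E.add (x ≫ E.zero) a.1 _ = a.1
    exact (E.add_congr (by rw [a.2]) rfl _ hz).trans (E.zero_add a.1 hz))
  add_zero a := Subtype.ext (by
    have hz : ((a.1 ≫ E.π) ≫ E.zero) ≫ E.π = a.1 ≫ E.π := by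
      rw [Category.assoc, E.zero_π, Category.comp_id]
    have hz' : (x ≫ E.zero) ≫ E.π = a.1 ≫ E.π := by
      rw [Category.assoc, E.zero_π, Category.comp_id, a.2]
    show E.add a.1 (x ≫ E.zero) _ = a.1
    exact (E.add_comm _ _ _ hz').trans
      ((E.add_congr (by rw [a.2]) rfl _ hz).trans (E.zero_add a.1 hz)))
  nsmul := nsmulRec
  nsmul_zero _ := rfl
  nsmul_succ _ _ := rfl

instance {T : Scheme.{u}} (x : T ⟶ X) : Module Γ(T, ⊤) (E.Fiber x) where
  one_smul a := Subtype.ext (E.one_smul a.1)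
  mul_smul f g a := Subtype.ext (E.mul_smul f g a.1)
  smul_zero f := Subtype.ext (E.smul_zero f x)
  smul_add f a b := Subtype.ext (E.smul_add f a.1 b.1 _ _)
  add_smul f g a := Subtype.ext (E.add_smul f g a.1 _)
  zero_smul a := Subtype.ext ((E.zero_smul a.1).trans (by rw [a.2]; rfl))

/-- A family of `n` local sections of `E` over an open subset `U` is a frame if every point
of the total space over `U` is, in a unique way, a linear combination of these sections. -/
def IsFrame {n : ℕ} (U : X.Opens) (s : Fin n → (U.toScheme ⟶ E.tot)) : Prop :=
  ∃ hs : ∀ i, s i ≫ E.π = U.ι,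
    ∀ {T : Scheme.{u}} (x : T ⟶ U.toScheme),
      Function.Bijective (fun f : Fin n → Γ(T, ⊤) =>
        (∑ i, f i • (⟨x ≫ s i, by rw [Category.assoc, hs i]⟩ : E.Fiber (x ≫ U.ι))))

/-- A family of `n` global sections of `E` is a global frame if every point of the total
space is, in a unique way, a linear combination of these sections. -/
def IsGlobalFrame {n : ℕ} (s : Fin n → (X ⟶ E.tot)) : Prop :=
  ∃ hs : ∀ i, s i ≫ E.π = 𝟙 X,
    ∀ {T : Scheme.{u}} (x : T ⟶ X),
      Function.Bijective (fun f : Fin n → Γ(T, ⊤) =>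
        (∑ i, f i • (⟨x ≫ s i, by rw [Category.assoc, hs i, Category.comp_id]⟩ : E.Fiber x)))

end VecBundleData

/-- A (geometric) vector bundle of rank `n` on `X`: bundle data which is locally trivial,
i.e. admits local frames around every point of `X`. -/
structure VecBundle (n : ℕ) (X : Scheme.{u}) extends VecBundleData X where
  locTriv : ∀ x : X, ∃ (U : X.Opens) (s : Fin n → (U.toScheme ⟶ tot)),
    x ∈ U ∧ toVecBundleData.IsFrame U s

/-- A (geometric) line bundle on a scheme. -/
abbrev LineBundle (X : Scheme.{u}) := VecBundle 1 X

/-- A morphism of total spaces of vector bundles over `X` is linear if it commutes with the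
projections, the fiberwise additions and the fiberwise scalar multiplications. -/
def IsLinearHom {X : Scheme.{u}} (E F : VecBundleData X) (φ : E.tot ⟶ F.tot) : Prop :=
  (φ ≫ F.π = E.π) ∧
  (∀ {T : Scheme.{u}} (a b : T ⟶ E.tot) (h h'), E.add a b h ≫ φ = F.add (a ≫ φ) (b ≫ φ) h') ∧
  (∀ {T : Scheme.{u}} (f : Γ(T, ⊤)) (a : T ⟶ E.tot), E.smul f a ≫ φ = F.smul f (a ≫ φ))

/-- Two vector bundles on `X` are isomorphic if there is a linear isomorphism between them. -/
def VBIso {X : Scheme.{u}} {n m : ℕ} (E : VecBundle n X) (F : VecBundle m X) : Prop :=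
  ∃ φ : E.tot ⟶ F.tot, IsLinearHom E.toVecBundleData F.toVecBundleData φ ∧ IsIso φ

/-- `F` is a pullback of the vector bundle `E` along `g : Y ⟶ X`. -/
def IsPullbackBundle {Y X : Scheme.{u}} (g : Y ⟶ X) {n : ℕ} (E : VecBundle n X)
    (F : VecBundle n Y) : Prop :=
  ∃ τ : F.tot ⟶ E.tot,
    (τ ≫ E.π = F.π ≫ g) ∧
    (∀ {T : Scheme.{u}} (a b : T ⟶ F.tot) (h h'), F.add a b h ≫ τ = E.add (a ≫ τ) (b ≫ τ) h') ∧
    (∀ {T : Scheme.{u}} (f : Γ(T, ⊤)) (a : T ⟶ F.tot), F.smul f a ≫ τ = E.smul f (a ≫ τ)) ∧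
    (∀ {T : Scheme.{u}} (y : T ⟶ Y) (a : T ⟶ E.tot), a ≫ E.π = y ≫ g →
      ∃! b : T ⟶ F.tot, b ≫ F.π = y ∧ b ≫ τ = a)

/-- A vector bundle is trivial if it admits a global frame. -/
def IsTrivialBundle {X : Scheme.{u}} {n : ℕ} (E : VecBundle n X) : Prop :=
  ∃ s : Fin n → (X ⟶ E.tot), E.toVecBundleData.IsGlobalFrame s

/-- `N` is a tensor product of the line bundles `L` and `M`: witnessed by a fiberwise
bilinear pairing taking local frames to local frames. -/
def IsTensor {X : Scheme.{u}} (L M N : LineBundle X) : Prop :=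
  ∃ β : ∀ {T : Scheme.{u}} (a : T ⟶ L.tot) (b : T ⟶ M.tot), a ≫ L.π = b ≫ M.π → (T ⟶ N.tot),
    (∀ {T : Scheme.{u}} (a : T ⟶ L.tot) (b : T ⟶ M.tot) (h), β a b h ≫ N.π = a ≫ L.π) ∧
    (∀ {T' T : Scheme.{u}} (g : T' ⟶ T) (a : T ⟶ L.tot) (b : T ⟶ M.tot) (h h'),
      g ≫ β a b h = β (g ≫ a) (g ≫ b) h') ∧
    (∀ {T : Scheme.{u}} (a a' : T ⟶ L.tot) (b : T ⟶ M.tot) (h₁ h₂ h₃ h₄ h₅),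
      β (L.add a a' h₁) b h₂ = N.add (β a b h₃) (β a' b h₄) h₅) ∧
    (∀ {T : Scheme.{u}} (a : T ⟶ L.tot) (b b' : T ⟶ M.tot) (h₁ h₂ h₃ h₄ h₅),
      β a (M.add b b' h₁) h₂ = N.add (β a b h₃) (β a b' h₄) h₅) ∧
    (∀ {T : Scheme.{u}} (f : Γ(T, ⊤)) (a : T ⟶ L.tot) (b : T ⟶ M.tot) (h₁ h₂),
      β (L.smul f a) b h₁ = N.smul f (β a b h₂)) ∧
    (∀ {T : Scheme.{u}} (f : Γ(T, ⊤)) (a : T ⟶ L.tot) (b : T ⟶ M.tot) (h₁ h₂),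
      β a (M.smul f b) h₁ = N.smul f (β a b h₂)) ∧
    (∀ (U : X.Opens) (sL : Fin 1 → (U.toScheme ⟶ L.tot)) (sM : Fin 1 → (U.toScheme ⟶ M.tot)),
      L.toVecBundleData.IsFrame U sL → M.toVecBundleData.IsFrame U sM →
      ∀ (h : sL 0 ≫ L.π = sM 0 ≫ M.π),
        N.toVecBundleData.IsFrame (n := 1) U (fun _ => β (sL 0) (sM 0) h))

/-- `N` is an `m`-th tensor power of the line bundle `L`. -/
def IsTensorPow {X : Scheme.{u}} (L : LineBundle X) : ℕ → LineBundle X → Prop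
  | 0, N => IsTrivialBundle N
  | m + 1, N => ∃ M : LineBundle X, IsTensorPow L m M ∧ IsTensor M L N

/-- A line bundle is ample if the base is quasi-compact and quasi-separated and the
non-vanishing loci of global sections of positive tensor powers give an affine open cover. -/
def IsAmple {X : Scheme.{u}} (L : LineBundle X) : Prop :=
  CompactSpace X ∧ QuasiSeparatedSpace X ∧
  ∀ x : X, ∃ (m : ℕ), 0 < m ∧ ∃ (N : LineBundle X), IsTensorPow L m N ∧
    ∃ (s : X ⟶ N.tot), s ≫ N.π = 𝟙 X ∧
      ∃ U : X.Opens, IsAffineOpen U ∧ x ∈ U ∧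
        (U : Set X) = {y : X | s.base y ≠ N.zero.base y}
/-! ### Properties of schemes and group schemes over `k` -/

/-- An algebraic group over `k` is a group scheme of finite type over `k`. -/
def GroupSchemeOver.IsAlgebraic {k : Type u} [Field k] (G : GroupSchemeOver k) : Prop :=
  LocallyOfFiniteType G.str ∧ QuasiCompact G.str

/-- A scheme of finite type over `k`. -/
def SchemeOver.IsFiniteType {k : Type u} [Field k] (X : SchemeOver k) : Prop :=
  LocallyOfFiniteType X.str ∧ QuasiCompact X.str

/-- A variety over `k`: an integral separated scheme of finite type over `k`. -/
def SchemeOver.IsVariety {k : Type u} [Field k] (X : SchemeOver k) : Prop :=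
  IsIntegral X.carrier ∧ AlgebraicGeometry.IsSeparated X.str ∧ X.IsFiniteType

/-- A scheme is normal if all its local rings are integrally closed domains. -/
def IsNormalScheme (X : Scheme.{u}) : Prop :=
  ∀ x : X, IsDomain (X.presheaf.stalk x) ∧ IsIntegrallyClosed (X.presheaf.stalk x)

/-- The base change of a scheme over `k` to the algebraic closure of `k`. -/
def SchemeOver.geomFiber {k : Type u} [Field k] (X : SchemeOver k) : Scheme.{u} :=
  pullback X.str (Spec.map (CommRingCat.ofHom (algebraMap k (AlgebraicClosure k))))

/-- A scheme over `k` is geometrically integral if its base change to an algebraic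
closure of `k` is integral. -/
def SchemeOver.IsGeomIntegral {k : Type u} [Field k] (X : SchemeOver k) : Prop :=
  IsIntegral X.geomFiber

/-- A scheme over `k` is geometrically connected if its base change to an algebraic
closure of `k` is connected. -/
def SchemeOver.IsGeomConnected {k : Type u} [Field k] (X : SchemeOver k) : Prop :=
  ConnectedSpace X.geomFiber

/-- A scheme over `k` is geometrically irreducible if its base change to an algebraic
closure of `k` is irreducible. -/
def SchemeOver.IsGeomIrreducible {k : Type u} [Field k] (X : SchemeOver k) : Prop :=
  IrreducibleSpace X.geomFiber

/-- An open subscheme of a scheme over `k`, as a scheme over `k`. -/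
def SchemeOver.ofOpens {k : Type u} [Field k] (X : SchemeOver k) (U : X.carrier.Opens) :
    SchemeOver k :=
  ⟨U.toScheme, U.ι ≫ X.str⟩

/-- A scheme over `k` is quasi-projective if it is separated, of finite type, and carries
an ample line bundle. -/
def SchemeOver.IsQuasiProjective {k : Type u} [Field k] (X : SchemeOver k) : Prop :=
  AlgebraicGeometry.IsSeparated X.str ∧ X.IsFiniteType ∧
    ∃ L : LineBundle X.carrier, IsAmple L

/-- An open subset of `X` is stable under an action of `G` if the action preserves its
`T`-points, for all `T`. -/
def ActionOver.Stable {k : Type u} [Field k] {G : GroupSchemeOver k} {X : SchemeOver k}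
    (α : ActionOver G X) (U : X.carrier.Opens) : Prop :=
  ∀ {T : Scheme.{u}} (g : T ⟶ G.carrier) (x : T ⟶ X.carrier) (h),
    Set.range x.base ⊆ (U : Set X.carrier) →
      Set.range (α.act g x h).base ⊆ (U : Set X.carrier)

/-- A `G`-linearization of a vector bundle `E` on a `G`-scheme `X`: an action of `G` on the
total space of `E`, lifting the action on `X` and acting linearly on the fibers (equivalently,
an action of `G × 𝔾ₘ` on `E` for which the projection is equivariant and `𝔾ₘ` acts by
multiplication on the fibers). -/
structure LinearizationData {k : Type u} [Field k] {G : GroupSchemeOver k} {X : SchemeOver k}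
    (α : ActionOver G X) {n : ℕ} (E : VecBundle n X.carrier) where
  lact : ∀ {T : Scheme.{u}} (g : T ⟶ G.carrier) (e : T ⟶ E.tot),
    g ≫ G.str = (e ≫ E.π) ≫ X.str → (T ⟶ E.tot)
  lact_π : ∀ {T : Scheme.{u}} (g : T ⟶ G.carrier) (e : T ⟶ E.tot) (h h'),
    lact g e h ≫ E.π = α.act g (e ≫ E.π) h'
  lact_natural : ∀ {T' T : Scheme.{u}} (f : T' ⟶ T) (g : T ⟶ G.carrier) (e : T ⟶ E.tot) (h h'),
    f ≫ lact g e h = lact (f ≫ g) (f ≫ e) h'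
  one_lact : ∀ {T : Scheme.{u}} (e : T ⟶ E.tot) (h), lact (((e ≫ E.π) ≫ X.str) ≫ G.one) e h = e
  mul_lact : ∀ {T : Scheme.{u}} (g g' : T ⟶ G.carrier) (e : T ⟶ E.tot) (h₁ h₂ h₃ h₄),
    lact (G.mul g g' h₁) e h₂ = lact g (lact g' e h₃) h₄
  lact_add : ∀ {T : Scheme.{u}} (g : T ⟶ G.carrier) (a b : T ⟶ E.tot) (h₁ h₂ h₃ h₄ h₅),
    lact g (E.add a b h₁) h₂ = E.add (lact g a h₃) (lact g b h₄) h₅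
  lact_smul : ∀ {T : Scheme.{u}} (g : T ⟶ G.carrier) (f : Γ(T, ⊤)) (a : T ⟶ E.tot) (h₁ h₂),
    lact g (E.smul f a) h₁ = E.smul f (lact g a h₂)

/-- A vector bundle is `G`-linearized (linearizable) if it admits a linearization. -/
def ActionOver.IsLinearized {k : Type u} [Field k] {G : GroupSchemeOver k} {X : SchemeOver k}
    (α : ActionOver G X) {n : ℕ} (E : VecBundle n X.carrier) : Prop :=
  Nonempty (LinearizationData α E)

/-- Equivariance of a morphism relative to a homomorphism of group schemes. -/
def IsEquivariantRel {k : Type u} [Field k] {G H : GroupSchemeOver k} {X Y : SchemeOver k}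
    (φ : GroupHom G H) (α : ActionOver G X) (β : ActionOver H Y)
    (f : X.carrier ⟶ Y.carrier) : Prop :=
  f ≫ Y.str = X.str ∧
  ∀ {T : Scheme.{u}} (g : T ⟶ G.carrier) (x : T ⟶ X.carrier) (h h'),
    α.act g x h ≫ f = β.act (g ≫ φ.hom) (x ≫ f) h'

/-- Equivariance of a morphism of `G`-schemes. -/
def IsEquivariant {k : Type u} [Field k] {G : GroupSchemeOver k} {X Y : SchemeOver k}
    (α : ActionOver G X) (β : ActionOver G Y) (f : X.carrier ⟶ Y.carrier) : Prop :=
  f ≫ Y.str = X.str ∧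
  ∀ {T : Scheme.{u}} (g : T ⟶ G.carrier) (x : T ⟶ X.carrier) (h h'),
    α.act g x h ≫ f = β.act g (x ≫ f) h'

/-- A `T`-point of `G` acts trivially if it acts trivially on all points of `X` over `T`. -/
def ActionOver.ActsTrivially {k : Type u} [Field k] {G : GroupSchemeOver k}
    {X : SchemeOver k} (α : ActionOver G X) {T : Scheme.{u}} (g : T ⟶ G.carrier) : Prop :=
  ∀ {T' : Scheme.{u}} (t : T' ⟶ T) (x : T' ⟶ X.carrier) (h), α.act (t ≫ g) x h = x

/-- An action is almost faithful if its kernel is finite, i.e. all trivially acting points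
factor through a fixed closed subscheme of `G` which is finite over `k`. -/
def ActionOver.IsAlmostFaithful {k : Type u} [Field k] {G : GroupSchemeOver k}
    {X : SchemeOver k} (α : ActionOver G X) : Prop :=
  ∃ (K : Scheme.{u}) (ι : K ⟶ G.carrier), IsClosedImmersion ι ∧ IsFinite (ι ≫ G.str) ∧
    ∀ {T : Scheme.{u}} (g : T ⟶ G.carrier), α.ActsTrivially g → ∃ g' : T ⟶ K, g' ≫ ι = g

/-- An abelian variety over `k` is a smooth connected proper algebraic group over `k`. -/
def GroupSchemeOver.IsAbelianVariety {k : Type u} [Field k] (G : GroupSchemeOver k) : Prop :=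
  G.IsAlgebraic ∧ IsSmooth G.str ∧ ConnectedSpace G.carrier ∧ IsProper G.str

/-- Pullback of fiber elements along a morphism of test schemes. -/
def VecBundleData.fiberMap {X : Scheme.{u}} (E : VecBundleData X) {T' T : Scheme.{u}}
    (g : T' ⟶ T) {x : T ⟶ X} (a : E.Fiber x) : E.Fiber (g ≫ x) :=
  ⟨g ≫ a.1, by rw [Category.assoc, a.2]⟩

/-- `E` is the pushforward `f_* L` of the line bundle `L` along `f : Y ⟶ X` (a finite
locally free morphism): it comes with a linear evaluation map (the counit `f^* E ⟶ L`),
which identifies the fiber of `E` at a `T`-point `x` of `X` with the sections of `L` over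
`T ×_X Y`. -/
def IsPushforwardBundle {Y X : Scheme.{u}} (f : Y ⟶ X) {n : ℕ} (L : LineBundle Y)
    (E : VecBundle n X) : Prop :=
  ∃ (lam : ∀ {T : Scheme.{u}} (e : T ⟶ E.tot) (y : T ⟶ Y), e ≫ E.π = y ≫ f → (T ⟶ L.tot))
    (hover : ∀ {T : Scheme.{u}} (e : T ⟶ E.tot) (y : T ⟶ Y) (h), lam e y h ≫ L.π = y),
    (∀ {T' T : Scheme.{u}} (g : T' ⟶ T) (e : T ⟶ E.tot) (y : T ⟶ Y) (h h'),
      g ≫ lam e y h = lam (g ≫ e) (g ≫ y) h') ∧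
    (∀ {T : Scheme.{u}} (e e' : T ⟶ E.tot) (y : T ⟶ Y) (h₁ h₂ h₃ h₄),
      lam (E.add e e' h₁) y h₂ = L.add (lam e y h₃) (lam e' y h₄)
        (by rw [hover, hover])) ∧
    (∀ {T : Scheme.{u}} (c : Γ(T, ⊤)) (e : T ⟶ E.tot) (y : T ⟶ Y) (h₁ h₂),
      lam (E.smul c e) y h₁ = L.smul c (lam e y h₂)) ∧
    (∀ {T : Scheme.{u}} (x : T ⟶ X),
      Function.Bijective (fun e : E.toVecBundleData.Fiber x =>
        (⟨lam (pullback.fst x f ≫ e.1) (pullback.snd x f)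
            (by rw [Category.assoc, e.2]; exact pullback.condition),
          hover _ _ _⟩ : L.toVecBundleData.Fiber (pullback.snd x f))))

/-- `D` is a determinant line bundle of the rank `n` vector bundle `E`: it carries a natural
family of alternating `n`-multilinear maps on the fibers of `E`, carrying local frames of
`E` to local frames of `D`. -/
def IsDetBundle {X : Scheme.{u}} {n : ℕ} (E : VecBundle n X) (D : LineBundle X) : Prop :=
  ∃ δ : ∀ {T : Scheme.{u}} (x : T ⟶ X),
      AlternatingMap Γ(T, ⊤) (E.toVecBundleData.Fiber x) (D.toVecBundleData.Fiber x) (Fin n),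
    (∀ {T' T : Scheme.{u}} (g : T' ⟶ T) (x : T ⟶ X) (v : Fin n → E.toVecBundleData.Fiber x),
      δ (g ≫ x) (fun i => E.toVecBundleData.fiberMap g (v i)) =
        D.toVecBundleData.fiberMap g (δ x v)) ∧
    (∀ (U : X.Opens) (s : Fin n → (U.toScheme ⟶ E.tot))
      (hover : ∀ i, s i ≫ E.π = U.ι), E.toVecBundleData.IsFrame U s →
        D.toVecBundleData.IsFrame (n := 1) U
          (fun _ => (δ U.ι (fun i => ⟨s i, hover i⟩)).1))

/-- `N` is the norm of the line bundle `L'` along the finite locally free morphism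
`f : Y ⟶ X` of rank `n`: `N ⊗ det (f_* 𝒪_Y) ≅ det (f_* L')`. -/
def IsNormBundle {Y X : Scheme.{u}} (f : Y ⟶ X) (n : ℕ) (L' : LineBundle Y)
    (N : LineBundle X) : Prop :=
  ∃ triv : LineBundle Y, IsTrivialBundle triv ∧
  ∃ E1 E0 : VecBundle n X, IsPushforwardBundle f L' E1 ∧ IsPushforwardBundle f triv E0 ∧
  ∃ D1 D0 : LineBundle X, IsDetBundle E1 D1 ∧ IsDetBundle E0 D0 ∧
  ∃ Tn : LineBundle X, IsTensor N D0 Tn ∧ VBIso Tn D1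

/-- The Weil restriction `R_{k'/k}(Y)` of a quasi-projective scheme `Y` over `k'`: a scheme
`W` over `k` together with a `k'`-morphism `ε : W ×_k k' ⟶ Y` inducing, for every scheme `T`
over `k`, a bijection `Hom_k(T, W) ≅ Hom_{k'}(T ×_k k', Y)`. -/
structure WeilRestrictionData (k : Type u) [Field k] (k' : Type u) [Field k'] [Algebra k k']
    (Y : SchemeOver k') where
  W : SchemeOver k
  WK : Scheme.{u}
  q1 : WK ⟶ W.carrier
  q2 : WK ⟶ Spk k'
  is_pb : IsPullback q1 q2 W.str (Spec.map (CommRingCat.ofHom (algebraMap k k')))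
  counit : WK ⟶ Y.carrier
  counit_str : counit ≫ Y.str = q2
  universal : ∀ (T : Scheme.{u}) (t : T ⟶ Spk k) (TK : Scheme.{u}) (r1 : TK ⟶ T)
    (r2 : TK ⟶ Spk k'),
    IsPullback r1 r2 t (Spec.map (CommRingCat.ofHom (algebraMap k k'))) →
    ∀ u : TK ⟶ Y.carrier, u ≫ Y.str = r2 →
      ∃! v : T ⟶ W.carrier, v ≫ W.str = t ∧
        ∃ w : TK ⟶ WK, w ≫ q1 = r1 ≫ v ∧ w ≫ q2 = r2 ∧ w ≫ counit = u

namespace WRN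

/-- Gluing morphisms over a pointwise open cover. -/
theorem glue_hom {T Y : Scheme.{u}} {ι : Type u} (V : ι → T.Opens) (hV : ∀ p : T, ∃ i, p ∈ V i)
    (f : ∀ i, (V i).toScheme ⟶ Y)
    (hf : ∀ (i j : ι) {S : Scheme.{u}} (a : S ⟶ (V i).toScheme) (b : S ⟶ (V j).toScheme),
      a ≫ (V i).ι = b ≫ (V j).ι → a ≫ f i = b ≫ f j) :
    ∃ F : T ⟶ Y, ∀ i, (V i).ι ≫ F = f i := by
  have hc : TopologicalSpace.IsOpenCover V := by
    refine TopologicalSpace.IsOpenCover.mk ?_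
    rw [eq_top_iff]
    intro p _
    obtain ⟨i, hi⟩ := hV p
    exact TopologicalSpace.Opens.mem_iSup.mpr ⟨i, hi⟩
  let 𝒰 := T.openCoverOfIsOpenCover V hc
  exact ⟨𝒰.glueMorphisms f (fun i j => hf i j _ _ pullback.condition),
    fun i => 𝒰.ι_glueMorphisms f (fun i j => hf i j _ _ pullback.condition) i⟩

theorem appTop_comp_apply {A B C : Scheme.{u}} (f : A ⟶ B) (g : B ⟶ C) (c : Γ(C, ⊤)) :
    (f ≫ g).appTop c = f.appTop (g.appTop c) := by
  rw [Scheme.Hom.comp_appTop]; rfl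

/-- A vector of functions as a morphism to integral affine space. -/
def vecHom {T : Scheme.{u}} {n : ℕ} (c : Fin n → Γ(T, ⊤)) :
    T ⟶ Spec (CommRingCat.of (MvPolynomial (ULift.{u} (Fin n)) (ULift.{u} ℤ))) :=
  (AffineSpace.toSpecMvPolyIntEquiv (ULift.{u} (Fin n))).symm (fun i => c i.down)

/-- The coordinates of a morphism to integral affine space. -/
def homVec {T : Scheme.{u}} {n : ℕ}
    (c : T ⟶ Spec (CommRingCat.of (MvPolynomial (ULift.{u} (Fin n)) (ULift.{u} ℤ)))) :
    Fin n → Γ(T, ⊤) :=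
  fun i => (AffineSpace.toSpecMvPolyIntEquiv (ULift.{u} (Fin n))) c ⟨i⟩

theorem homVec_vecHom {T : Scheme.{u}} {n : ℕ} (c : Fin n → Γ(T, ⊤)) : homVec (vecHom c) = c := by
  funext i
  simp [homVec, vecHom]

theorem vecHom_homVec {T : Scheme.{u}} {n : ℕ}
    (c : T ⟶ Spec (CommRingCat.of (MvPolynomial (ULift.{u} (Fin n)) (ULift.{u} ℤ)))) :
    vecHom (homVec c) = c :=
  (AffineSpace.toSpecMvPolyIntEquiv _).symm_apply_apply c

theorem homVec_comp {T' T : Scheme.{u}} {n : ℕ} (g : T' ⟶ T)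
    (c : T ⟶ Spec (CommRingCat.of (MvPolynomial (ULift.{u} (Fin n)) (ULift.{u} ℤ)))) :
    homVec (g ≫ c) = fun i => g.appTop (homVec c i) := by
  funext i
  exact AffineSpace.toSpecMvPolyIntEquiv_comp _ _ _ _

theorem comp_vecHom {T' T : Scheme.{u}} {n : ℕ} (g : T' ⟶ T) (c : Fin n → Γ(T, ⊤)) :
    g ≫ vecHom c = vecHom (fun i => g.appTop (c i)) := by
  rw [← vecHom_homVec (g ≫ vecHom c), homVec_comp, homVec_vecHom]

theorem vec_ext {T : Scheme.{u}} {n : ℕ} (c d : Fin n → Γ(T, ⊤))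
    (h : ∀ p : T, ∃ V : T.Opens, p ∈ V ∧ ∀ i, V.ι.appTop (c i) = V.ι.appTop (d i)) : c = d := by
  rw [← homVec_vecHom c, ← homVec_vecHom d]
  congr 1
  apply Scheme.hom_ext_of_forall
  intro p
  obtain ⟨V, hp, hV⟩ := h p
  refine ⟨V, hp, ?_⟩
  rw [comp_vecHom, comp_vecHom]
  congr 1
  funext i
  exact hV i

theorem glue_vec {T : Scheme.{u}} {n : ℕ} {ι : Type u} (V : ι → T.Opens)
    (hV : ∀ p : T, ∃ i, p ∈ V i) (c : ∀ i, Fin n → Γ((V i).toScheme, ⊤))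
    (hc : ∀ (i j : ι) {S : Scheme.{u}} (a : S ⟶ (V i).toScheme) (b : S ⟶ (V j).toScheme),
      a ≫ (V i).ι = b ≫ (V j).ι → ∀ l, a.appTop (c i l) = b.appTop (c j l)) :
    ∃ C : Fin n → Γ(T, ⊤), ∀ i l, (V i).ι.appTop (C l) = c i l := by
  obtain ⟨F, hF⟩ := glue_hom V hV (fun i => vecHom (c i)) (by
    intro i j S a b h
    rw [comp_vecHom, comp_vecHom]
    congr 1
    funext l
    exact hc i j a b h l)
  refine ⟨homVec F, fun i l => ?_⟩
  have := congrArg homVec (hF i)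
  rw [homVec_comp, homVec_vecHom] at this
  exact congrFun this l

section Fibers

variable {X : Scheme.{u}} (E : VecBundleData X)

/-- Restriction of fiber elements along a morphism of test schemes. -/
def res {T' T : Scheme.{u}} (g : T' ⟶ T) {x : T ⟶ X} {y : T' ⟶ X} (h : g ≫ x = y)
    (a : E.Fiber x) : E.Fiber y :=
  ⟨g ≫ a.1, by rw [Category.assoc, a.2, h]⟩

variable {E}

theorem res_val {T' T : Scheme.{u}} (g : T' ⟶ T) {x : T ⟶ X} {y : T' ⟶ X} (h : g ≫ x = y)
    (a : E.Fiber x) : (res E g h a).1 = g ≫ a.1 := rfl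

theorem res_add {T' T : Scheme.{u}} (g : T' ⟶ T) {x : T ⟶ X} {y : T' ⟶ X} (h : g ≫ x = y)
    (a b : E.Fiber x) : res E g h (a + b) = res E g h a + res E g h b :=
  Subtype.ext (E.add_natural _ _ _ _ _)

theorem res_smul {T' T : Scheme.{u}} (g : T' ⟶ T) {x : T ⟶ X} {y : T' ⟶ X} (h : g ≫ x = y)
    (f : Γ(T, ⊤)) (a : E.Fiber x) : res E g h (f • a) = g.appTop f • res E g h a :=
  Subtype.ext (E.smul_natural _ _ _)

theorem res_zero {T' T : Scheme.{u}} (g : T' ⟶ T) {x : T ⟶ X} {y : T' ⟶ X} (h : g ≫ x = y) :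
    res E g h 0 = 0 :=
  Subtype.ext (by subst h; simp [res_val])

theorem res_sum {T' T : Scheme.{u}} (g : T' ⟶ T) {x : T ⟶ X} {y : T' ⟶ X} (h : g ≫ x = y)
    {ι : Type*} (s : Finset ι) (a : ι → E.Fiber x) :
    res E g h (∑ i ∈ s, a i) = ∑ i ∈ s, res E g h (a i) := by
  classical
  induction s using Finset.induction_on with
  | empty => simp [res_zero]
  | insert i s hi ih => rw [Finset.sum_insert hi, Finset.sum_insert hi, res_add, ih]

theorem res_res {T'' T' T : Scheme.{u}} (t : T'' ⟶ T') (g : T' ⟶ T) {x : T ⟶ X} {y : T' ⟶ X}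
    {z : T'' ⟶ X} (h : g ≫ x = y) (h' : t ≫ y = z) (a : E.Fiber x) :
    res E t h' (res E g h a) = res E (t ≫ g) (by rw [Category.assoc, h, h']) a :=
  Subtype.ext (by simp [res_val])

theorem res_congr {T' T : Scheme.{u}} {g g' : T' ⟶ T} (hg : g = g') {x : T ⟶ X} {y : T' ⟶ X}
    (h : g ≫ x = y) (a : E.Fiber x) : res E g h a = res E g' (hg ▸ h) a := by
  subst hg; rfl

theorem res_id {T : Scheme.{u}} {x : T ⟶ X} (h : 𝟙 T ≫ x = x) (a : E.Fiber x) :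
    res E (𝟙 T) h a = a := Subtype.ext (by simp [res_val])

theorem fib_ext {T : Scheme.{u}} {x : T ⟶ X} (a b : E.Fiber x)
    (h : ∀ p : T, ∃ V : T.Opens, p ∈ V ∧ res E V.ι rfl a = res E V.ι rfl b) : a = b := by
  apply Subtype.ext
  apply Scheme.hom_ext_of_forall
  intro p
  obtain ⟨V, hp, hV⟩ := h p
  exact ⟨V, hp, congrArg Subtype.val hV⟩

theorem fib_glue {T : Scheme.{u}} (x : T ⟶ X) {ι : Type u} (V : ι → T.Opens)
    (hV : ∀ p : T, ∃ i, p ∈ V i) (a : ∀ i, E.Fiber ((V i).ι ≫ x))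
    (ha : ∀ (i j : ι) {S : Scheme.{u}} (f : S ⟶ (V i).toScheme) (g : S ⟶ (V j).toScheme)
      (h : f ≫ (V i).ι = g ≫ (V j).ι),
      res E f (y := f ≫ (V i).ι ≫ x) rfl (a i) =
        res E g (by rw [← Category.assoc, ← h, Category.assoc]) (a j)) :
    ∃ A : E.Fiber x, ∀ i, res E (V i).ι rfl A = a i := by
  obtain ⟨F, hF⟩ := glue_hom V hV (fun i => (a i).1)
    (fun i j S f g h => congrArg Subtype.val (ha i j f g h))
  refine ⟨⟨F, ?_⟩, fun i => Subtype.ext (hF i)⟩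
  apply Scheme.hom_ext_of_forall
  intro p
  obtain ⟨i, hi⟩ := hV p
  refine ⟨V i, hi, ?_⟩
  rw [← Category.assoc, hF]
  exact (a i).2

/-- The linear combination map attached to a family of fiber elements. -/
def comb {T : Scheme.{u}} {x : T ⟶ X} {n : ℕ} (v : Fin n → E.Fiber x) (f : Fin n → Γ(T, ⊤)) :
    E.Fiber x := ∑ i, f i • v i

theorem res_comb {T' T : Scheme.{u}} (g : T' ⟶ T) {x : T ⟶ X} {y : T' ⟶ X} (h : g ≫ x = y)
    {n : ℕ} (v : Fin n → E.Fiber x) (f : Fin n → Γ(T, ⊤)) :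
    res E g h (comb v f) = comb (fun i => res E g h (v i)) (fun i => g.appTop (f i)) := by
  simp only [comb, res_sum, res_smul]

/-- A universal basis of the fiber: a basis after every base change. -/
def IsBas {T : Scheme.{u}} {x : T ⟶ X} {n : ℕ} (v : Fin n → E.Fiber x) : Prop :=
  ∀ ⦃T' : Scheme.{u}⦄ (g : T' ⟶ T),
    Function.Bijective (comb (fun i => res E g (y := g ≫ x) rfl (v i)))

theorem IsBas.bij {T : Scheme.{u}} {x : T ⟶ X} {n : ℕ} {v : Fin n → E.Fiber x} (hv : IsBas v)
    {T' : Scheme.{u}} (g : T' ⟶ T) {y : T' ⟶ X} (h : g ≫ x = y) :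
    Function.Bijective (comb (fun i => res E g h (v i))) := by
  subst h; exact hv g

theorem IsBas.bij_self {T : Scheme.{u}} {x : T ⟶ X} {n : ℕ} {v : Fin n → E.Fiber x}
    (hv : IsBas v) : Function.Bijective (comb v) := by
  have := hv.bij (𝟙 T) (Category.id_comp x)
  simpa only [res_id] using this

theorem IsBas.res {T' T : Scheme.{u}} {x : T ⟶ X} {n : ℕ} {v : Fin n → E.Fiber x} (hv : IsBas v)
    (g : T' ⟶ T) {y : T' ⟶ X} (h : g ≫ x = y) : IsBas (fun i => res E g h (v i)) := by
  intro T'' t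
  simp only [res_res]
  exact hv.bij _ _

theorem comb_inj_local {T : Scheme.{u}} {x : T ⟶ X} {n : ℕ} (v : Fin n → E.Fiber x)
    (h : ∀ p : T, ∃ V : T.Opens, p ∈ V ∧
      Function.Injective (comb (fun i => res E V.ι (y := V.ι ≫ x) rfl (v i)))) :
    Function.Injective (comb v) := by
  intro c d hcd
  apply vec_ext
  intro p
  obtain ⟨V, hp, hV⟩ := h p
  refine ⟨V, hp, ?_⟩
  have := congrArg (res E V.ι (y := V.ι ≫ x) rfl) hcd
  rw [res_comb, res_comb] at this
  exact congrFun (hV this)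

theorem comb_surj_local {T : Scheme.{u}} {x : T ⟶ X} {n : ℕ} (v : Fin n → E.Fiber x)
    (hi : ∀ {T' : Scheme.{u}} (g : T' ⟶ T),
      Function.Injective (comb (fun i => res E g (y := g ≫ x) rfl (v i))))
    (h : ∀ p : T, ∃ V : T.Opens, p ∈ V ∧
      Function.Surjective (comb (fun i => res E V.ι (y := V.ι ≫ x) rfl (v i)))) :
    Function.Surjective (comb v) := by
  intro a
  choose V hp hV using h
  choose c hc using fun p => hV p (res E (V p).ι rfl a)
  obtain ⟨C, hC⟩ := glue_vec V (fun p => ⟨p, hp p⟩) c (by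
    intro p q S f g hfg
    have e1 := congrArg (res E f (y := (f ≫ (V p).ι) ≫ x) (by simp)) (hc p)
    have e2 := congrArg (res E g (y := (f ≫ (V p).ι) ≫ x) (by rw [hfg]; simp)) (hc q)
    rw [res_res, res_comb] at e1 e2
    simp only [res_res] at e1 e2
    have := e1.trans ((res_congr hfg _ _).trans e2.symm)
    simp only [← res_congr hfg] at this
    exact congrFun (hi _ this))
  refine ⟨C, fib_ext _ _ fun p => ⟨V p, hp p, ?_⟩⟩
  rw [res_comb, ← hc p]
  congr 1
  funext l
  exact hC p l

theorem isBas_of_local {T : Scheme.{u}} {x : T ⟶ X} {n : ℕ} (v : Fin n → E.Fiber x)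
    (h : ∀ p : T, ∃ V : T.Opens, p ∈ V ∧ IsBas (fun i => res E V.ι (y := V.ι ≫ x) rfl (v i))) :
    IsBas v := by
  have key : ∀ {T' : Scheme.{u}} (g : T' ⟶ T) (p : T'), ∃ W : T'.Opens, p ∈ W ∧
      Function.Bijective (comb (fun i => res E W.ι (y := W.ι ≫ g ≫ x) rfl
        (res E g (y := g ≫ x) rfl (v i)))) := by
    intro T' g p
    obtain ⟨V, hp, hV⟩ := h (g p)
    refine ⟨g ⁻¹ᵁ V, hp, ?_⟩
    have e : (g ∣_ V) ≫ V.ι = (g ⁻¹ᵁ V).ι ≫ g := morphismRestrict_ι g V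
    have := hV.bij (g ∣_ V) (y := (g ⁻¹ᵁ V).ι ≫ g ≫ x) (by rw [← Category.assoc, e, Category.assoc])
    simp only [res_res, res_congr e] at this ⊢
    exact this
  have hinj : ∀ {T' : Scheme.{u}} (g : T' ⟶ T),
      Function.Injective (comb (fun i => res E g (y := g ≫ x) rfl (v i))) := fun g =>
    comb_inj_local _ fun p => (key g p).imp fun W hW => ⟨hW.1, hW.2.1⟩
  intro T' g
  refine ⟨hinj g, comb_surj_local _ ?_ fun p => (key g p).imp fun W hW => ⟨hW.1, hW.2.2⟩⟩
  intro T'' t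
  have hfl : ∀ {y : T'' ⟶ X} (h : (t ≫ g) ≫ x = y),
      Function.Injective (comb (fun i => res E (t ≫ g) h (v i))) := by
    intro y h; subst h; exact hinj (t ≫ g)
  simp only [res_res]
  exact hfl _

theorem isBas_of_affine {T : Scheme.{u}} {x : T ⟶ X} {n : ℕ} (v : Fin n → E.Fiber x)
    (h : ∀ {T' : Scheme.{u}} [IsAffine T'] (g : T' ⟶ T),
      Function.Bijective (comb (fun i => res E g (y := g ≫ x) rfl (v i)))) :
    IsBas v := by
  have key : ∀ {T' : Scheme.{u}} (g : T' ⟶ T) (p : T'), ∃ W : T'.Opens, p ∈ W ∧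
      Function.Bijective (comb (fun i => res E W.ι (y := W.ι ≫ g ≫ x) rfl
        (res E g (y := g ≫ x) rfl (v i)))) := by
    intro T' g p
    obtain ⟨W, hW, hp, -⟩ := exists_isAffineOpen_mem_and_subset (x := p) (U := ⊤) trivial
    have : IsAffine W.toScheme := hW
    refine ⟨W, hp, ?_⟩
    have hfl : ∀ {y : W.toScheme ⟶ X} (hy : (W.ι ≫ g) ≫ x = y),
        Function.Bijective (comb (fun i => res E (W.ι ≫ g) hy (v i))) := by
      intro y hy; subst hy; exact h (W.ι ≫ g)
    simp only [res_res]
    exact hfl _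
  have hinj : ∀ {T' : Scheme.{u}} (g : T' ⟶ T),
      Function.Injective (comb (fun i => res E g (y := g ≫ x) rfl (v i))) := fun g =>
    comb_inj_local _ fun p => (key g p).imp fun W hW => ⟨hW.1, hW.2.1⟩
  intro T' g
  refine ⟨hinj g, comb_surj_local _ ?_ fun p => (key g p).imp fun W hW => ⟨hW.1, hW.2.2⟩⟩
  intro T'' t
  have hfl : ∀ {y : T'' ⟶ X} (h : (t ≫ g) ≫ x = y),
      Function.Injective (comb (fun i => res E (t ≫ g) h (v i))) := by
    intro y h; subst h; exact hinj (t ≫ g)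
  simp only [res_res]
  exact hfl _

theorem isFrame_iff {n : ℕ} (U : X.Opens) (s : Fin n → (U.toScheme ⟶ E.tot)) :
    E.IsFrame U s ↔ ∃ hs : ∀ i, s i ≫ E.π = U.ι, IsBas (fun i => (⟨s i, hs i⟩ : E.Fiber U.ι)) :=
  Iff.rfl

/-- Every `T`-point locally has a universal basis. -/
theorem exists_isBas {n : ℕ} (E : VecBundle n X) {T : Scheme.{u}} (x : T ⟶ X) (p : T) :
    ∃ (V : T.Opens) (v : Fin n → E.toVecBundleData.Fiber (V.ι ≫ x)), p ∈ V ∧ IsBas v := by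
  obtain ⟨U, s, hp, hs⟩ := E.locTriv (x p)
  obtain ⟨hs, hb⟩ := (isFrame_iff _ _).1 hs
  exact ⟨x ⁻¹ᵁ U, _, hp, hb.res (x ∣_ U) (morphismRestrict_ι x U)⟩

end Fibers

end WRN

namespace WRN

/-- Determinant formula for alternating maps on a family of linear combinations. -/
theorem alt_comb {R M N : Type*} [CommRing R] [AddCommMonoid M] [AddCommMonoid N] [Module R M]
    [Module R N] {n : ℕ} (δ : AlternatingMap R M N (Fin n)) (s : Fin n → M)
    (A : Matrix (Fin n) (Fin n) R) :
    δ (fun i => ∑ j, A i j • s j) = A.det • δ s := by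
  let _ : AddCommGroup N := Module.addCommMonoidToAddCommGroup R
  let c : (Fin n → R) →ₗ[R] M := Fintype.linearCombination R s
  have key : δ.compLinearMap c =
      (LinearMap.toSpanSingleton R N (δ s)).compAlternatingMap Matrix.detRowAlternating := by
    refine Module.Basis.ext_alternating (Pi.basisFun R (Fin n)) fun v hv => ?_
    let σ : Equiv.Perm (Fin n) := Equiv.ofBijective v (Finite.injective_iff_bijective.1 hv)
    have h1 : (fun i => (Pi.basisFun R (Fin n)) (v i)) =
      fun i => (fun j => (Pi.basisFun R (Fin n)) j) (σ i) := rfl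
    have h0 : ∀ F : AlternatingMap R (Fin n → R) N (Fin n),
        F (fun i => (Pi.basisFun R (Fin n)) (v i)) = Equiv.Perm.sign σ •
          F (fun j => (Pi.basisFun R (Fin n)) j) := fun F => by
      rw [h1]
      exact F.map_perm (fun j => (Pi.basisFun R (Fin n)) j) σ
    rw [h0, h0]
    congr 1
    have e1 : (fun j => c ((Pi.basisFun R (Fin n)) j)) = s := by
      funext j
      simp [c, Fintype.linearCombination_apply, Pi.single_apply]
    have e2 : Matrix.detRowAlternating (fun j => (Pi.basisFun R (Fin n)) j) = (1 : R) := by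
      have : (fun j => (Pi.basisFun R (Fin n)) j) = (1 : Matrix (Fin n) (Fin n) R) := by
        funext i j
        simp [Matrix.one_apply, Pi.single_apply, eq_comm]
      rw [this]
      exact Matrix.det_one
    rw [AlternatingMap.compLinearMap_apply, LinearMap.compAlternatingMap_apply, e2]
    simp only [LinearMap.toSpanSingleton_apply, one_smul]
    exact congrArg δ e1
  have := congrArg (fun F => F (fun i => A i)) key
  rw [AlternatingMap.compLinearMap_apply, LinearMap.compAlternatingMap_apply] at this
  exact this

section

variable {X : Scheme.{u}} {E : VecBundleData X}

/-- Coordinates with respect to a universal basis. -/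
def IsBas.equiv {T : Scheme.{u}} {x : T ⟶ X} {n : ℕ} {v : Fin n → E.Fiber x} (hv : IsBas v) :
    (Fin n → Γ(T, ⊤)) ≃ₗ[Γ(T, ⊤)] E.Fiber x :=
  LinearEquiv.ofBijective (Fintype.linearCombination Γ(T, ⊤) v) (by
    have := hv.bij_self
    exact this)

theorem IsBas.equiv_apply {T : Scheme.{u}} {x : T ⟶ X} {n : ℕ} {v : Fin n → E.Fiber x}
    (hv : IsBas v) (c : Fin n → Γ(T, ⊤)) : hv.equiv c = comb v c := rfl

theorem IsBas.comb_symm {T : Scheme.{u}} {x : T ⟶ X} {n : ℕ} {v : Fin n → E.Fiber x}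
    (hv : IsBas v) (a : E.Fiber x) : comb v (hv.equiv.symm a) = a :=
  hv.equiv.apply_symm_apply a

theorem comb_one {T : Scheme.{u}} {x : T ⟶ X} (e : E.Fiber x) (c : Fin 1 → Γ(T, ⊤)) :
    comb (fun _ => e) c = c 0 • e := by simp [comb]

/-- Basis criterion for line bundles. -/
theorem isBas_one {T : Scheme.{u}} {x : T ⟶ X} {e : E.Fiber x}
    (h : ∀ {S : Scheme.{u}} (g : S ⟶ T),
      Function.Bijective (fun f : Γ(S, ⊤) => f • res E g (y := g ≫ x) rfl e)) :
    IsBas (fun _ : Fin 1 => e) := by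
  intro S g
  constructor
  · intro c d hcd
    rw [comb_one, comb_one] at hcd
    funext i
    rw [Subsingleton.elim i 0]
    exact (h g).1 hcd
  · intro a
    obtain ⟨f, hf⟩ := (h g).2 a
    exact ⟨fun _ => f, by rw [comb_one]; exact hf⟩

theorem IsBas.one_bij {T : Scheme.{u}} {x : T ⟶ X} {e : E.Fiber x}
    (h : IsBas (fun _ : Fin 1 => e)) : Function.Bijective (fun f : Γ(T, ⊤) => f • e) := by
  constructor
  · intro c d hcd
    have := h.bij_self.1 (a₁ := fun _ => c) (a₂ := fun _ => d)
      (by rw [comb_one, comb_one]; exact hcd)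
    exact congrFun this 0
  · intro a
    obtain ⟨f, hf⟩ := h.bij_self.2 a
    exact ⟨f 0, by rw [← hf, comb_one]⟩

theorem IsBas.one_smul_unit {T : Scheme.{u}} {x : T ⟶ X} {e : E.Fiber x}
    (h : IsBas (fun _ : Fin 1 => e)) {d : Γ(T, ⊤)} (hd : IsUnit d) :
    IsBas (fun _ : Fin 1 => d • e) := by
  apply isBas_one
  intro S g
  obtain ⟨u, hu⟩ := hd.map g.appTop.hom
  have hu' : (u : Γ(S, ⊤)) = g.appTop d := hu
  have h2 := (h.res g (y := g ≫ x) rfl).one_bij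
  simp only [res_smul, smul_smul, ← hu']
  constructor
  · intro a b hab
    exact (Units.mul_left_inj u).1 (h2.1 hab)
  · intro a
    obtain ⟨f, hf⟩ := h2.2 a
    exact ⟨f * ↑u⁻¹, by simpa using hf⟩

/-- The transition matrix between two universal bases. -/
theorem IsBas.trans {T : Scheme.{u}} {x : T ⟶ X} {n : ℕ} {v w : Fin n → E.Fiber x}
    (hv : IsBas v) (hw : IsBas w) : ∃ A : Matrix (Fin n) (Fin n) Γ(T, ⊤),
      IsUnit A.det ∧ w = fun i => ∑ j, A i j • v j := by
  let A : Matrix (Fin n) (Fin n) Γ(T, ⊤) := fun i => hv.equiv.symm (w i)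
  let B : Matrix (Fin n) (Fin n) Γ(T, ⊤) := fun i => hw.equiv.symm (v i)
  have hA : ∀ i, w i = ∑ j, A i j • v j := fun i => (hv.comb_symm (w i)).symm
  have hB : ∀ i, v i = ∑ j, B i j • w j := fun i => (hw.comb_symm (v i)).symm
  have hBA : B * A = 1 := by
    funext i
    apply hv.bij_self.1
    have e1 : comb v ((1 : Matrix (Fin n) (Fin n) Γ(T, ⊤)) i) = v i := by
      simp [comb, Matrix.one_apply]
    rw [e1]
    conv_rhs => rw [hB i]
    simp only [comb, Matrix.mul_apply, Finset.sum_smul]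
    rw [Finset.sum_comm]
    refine Finset.sum_congr rfl fun j _ => ?_
    rw [hA j, Finset.smul_sum]
    exact Finset.sum_congr rfl fun l _ => by rw [smul_smul]
  refine ⟨A, ?_, funext hA⟩
  have : B.det * A.det = 1 := by rw [← Matrix.det_mul, hBA, Matrix.det_one]
  exact IsUnit.of_mul_eq_one B.det (by rw [mul_comm]; exact this)

end

/-- Determinant data, in flexible form. -/
structure DetData {X : Scheme.{u}} {n : ℕ} (E : VecBundle n X) (D : LineBundle X) where
  δ : ∀ {T : Scheme.{u}} (x : T ⟶ X),
      AlternatingMap Γ(T, ⊤) (E.toVecBundleData.Fiber x) (D.toVecBundleData.Fiber x) (Fin n)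
  nat : ∀ {T' T : Scheme.{u}} (g : T' ⟶ T) {x : T ⟶ X} {y : T' ⟶ X} (h : g ≫ x = y)
    (v : Fin n → E.toVecBundleData.Fiber x),
    res D.toVecBundleData g h (δ x v) = δ y (fun i => res E.toVecBundleData g h (v i))
  bas : ∀ {T : Scheme.{u}} {x : T ⟶ X} {v : Fin n → E.toVecBundleData.Fiber x}, IsBas v →
    IsBas (fun _ : Fin 1 => δ x v)

theorem IsDetBundle.exists_detData {X : Scheme.{u}} {n : ℕ} {E : VecBundle n X} {D : LineBundle X}
    (h : IsDetBundle E D) : Nonempty (DetData E D) := by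
  obtain ⟨δ, hn, hf⟩ := h
  have hnat : ∀ {T' T : Scheme.{u}} (g : T' ⟶ T) {x : T ⟶ X} {y : T' ⟶ X} (h : g ≫ x = y)
    (v : Fin n → E.toVecBundleData.Fiber x),
    res D.toVecBundleData g h (δ x v) = δ y (fun i => res E.toVecBundleData g h (v i)) := by
    intro T' T g x y h v
    subst h
    exact (hn g x v).symm
  refine ⟨⟨δ, hnat, ?_⟩⟩
  intro T x v hv
  apply isBas_of_local
  intro p
  obtain ⟨U, s, hp, hs⟩ := E.locTriv (x p)
  obtain ⟨hs0, hb⟩ := (isFrame_iff _ _).1 hs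
  obtain ⟨_, hD⟩ := (isFrame_iff _ _).1 (hf U s hs0 hs)
  refine ⟨x ⁻¹ᵁ U, hp, ?_⟩
  have e := morphismRestrict_ι x U
  have b1 := hb.res (x ∣_ U) e
  have b2 := hv.res (x ⁻¹ᵁ U).ι (y := (x ⁻¹ᵁ U).ι ≫ x) rfl
  obtain ⟨A, hA, hw⟩ := b1.trans b2
  have hD' : IsBas (fun _ : Fin 1 => δ U.ι fun i => ⟨s i, hs0 i⟩) := hD
  have b3 : IsBas (fun _ : Fin 1 => res D.toVecBundleData (x ∣_ U) e
    (δ U.ι fun i => ⟨s i, hs0 i⟩)) := hD'.res (x ∣_ U) e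
  have := IsBas.one_smul_unit (e := res D.toVecBundleData (x ∣_ U) e
    (δ U.ι fun i => ⟨s i, hs0 i⟩)) b3 hA
  have e3 : res D.toVecBundleData (x ⁻¹ᵁ U).ι (y := (x ⁻¹ᵁ U).ι ≫ x) rfl (δ x v) =
      A.det • res D.toVecBundleData (x ∣_ U) e (δ U.ι fun i => ⟨s i, hs0 i⟩) := by
    rw [hnat, hnat, ← alt_comb, hw]
  have e4 : (fun _ : Fin 1 => res D.toVecBundleData (x ⁻¹ᵁ U).ι (y := (x ⁻¹ᵁ U).ι ≫ x) rfl
    (δ x v)) = fun _ => A.det • res D.toVecBundleData (x ∣_ U) e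
      (δ U.ι fun i => ⟨s i, hs0 i⟩) := funext fun _ => e3
  rw [e4]
  exact this

theorem DetData.isDetBundle {X : Scheme.{u}} {n : ℕ} {E : VecBundle n X} {D : LineBundle X}
    (d : DetData E D) : IsDetBundle E D := by
  refine ⟨d.δ, ?_, ?_⟩
  · intro T' T g x v
    exact (d.nat g rfl v).symm
  · intro U s hover hs
    obtain ⟨hs0, hb⟩ := (isFrame_iff _ _).1 hs
    rw [isFrame_iff]
    exact ⟨fun i => (d.δ U.ι fun i => ⟨s i, hover i⟩).2, d.bas hb⟩

end WRN


namespace WRN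

/-- A natural linear map between the fibers of two bundles over (the base changes of) two
points. -/
structure FibMap {X X' T : Scheme.{u}} (E : VecBundleData X) (E' : VecBundleData X')
    (x : T ⟶ X) (x' : T ⟶ X') where
  app : ∀ {S : Scheme.{u}} (g : S ⟶ T) {y : S ⟶ X} {y' : S ⟶ X'} (_ : g ≫ x = y)
    (_ : g ≫ x' = y'), E.Fiber y →ₗ[Γ(S, ⊤)] E'.Fiber y'
  nat : ∀ {S' S : Scheme.{u}} (t : S' ⟶ S) (g : S ⟶ T) {y : S ⟶ X} {y' : S ⟶ X'} {z : S' ⟶ X}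
    {z' : S' ⟶ X'} (h : g ≫ x = y) (h' : g ≫ x' = y') (k : t ≫ y = z) (k' : t ≫ y' = z')
    (a : E.Fiber y), res E' t k' (app g h h' a) =
      app (t ≫ g) (by rw [Category.assoc, h, k]) (by rw [Category.assoc, h', k']) (res E t k a)

/-- Relations between the fibers of two bundles which are stable under base change, local,
single valued and locally given by a linear map. -/
structure FibRel {X X' T : Scheme.{u}} (E : VecBundleData X) (E' : VecBundleData X')
    (x : T ⟶ X) (x' : T ⟶ X') where
  R : ∀ {S : Scheme.{u}} (g : S ⟶ T) {y : S ⟶ X} {y' : S ⟶ X'} (_ : g ≫ x = y)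
    (_ : g ≫ x' = y'), E.Fiber y → E'.Fiber y' → Prop
  stable : ∀ {S' S : Scheme.{u}} (t : S' ⟶ S) (g : S ⟶ T) {y : S ⟶ X} {y' : S ⟶ X'} {z : S' ⟶ X}
    {z' : S' ⟶ X'} (h : g ≫ x = y) (h' : g ≫ x' = y') (k : t ≫ y = z) (k' : t ≫ y' = z')
    (a : E.Fiber y) (b : E'.Fiber y'), R g h h' a b →
      R (t ≫ g) (by rw [Category.assoc, h, k]) (by rw [Category.assoc, h', k'])
        (res E t k a) (res E' t k' b)
  loc : ∀ {S : Scheme.{u}} (g : S ⟶ T) {y : S ⟶ X} {y' : S ⟶ X'} (h : g ≫ x = y)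
    (h' : g ≫ x' = y') (a : E.Fiber y) (b : E'.Fiber y'),
    (∀ p : S, ∃ V : S.Opens, p ∈ V ∧ R (V.ι ≫ g) (y := V.ι ≫ y) (y' := V.ι ≫ y')
      (by rw [Category.assoc, h]) (by rw [Category.assoc, h']) (res E V.ι rfl a)
        (res E' V.ι rfl b)) → R g h h' a b
  uniq : ∀ {S : Scheme.{u}} (g : S ⟶ T) {y : S ⟶ X} {y' : S ⟶ X'} (h : g ≫ x = y)
    (h' : g ≫ x' = y') (a : E.Fiber y) (b b' : E'.Fiber y'), R g h h' a b → R g h h' a b' → b = b'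
  lin : ∀ {S : Scheme.{u}} (g : S ⟶ T) {y : S ⟶ X} {y' : S ⟶ X'} (h : g ≫ x = y)
    (h' : g ≫ x' = y') (p : S), ∃ V : S.Opens, p ∈ V ∧
      ∃ l : E.Fiber (V.ι ≫ y) →ₗ[Γ(V.toScheme, ⊤)] E'.Fiber (V.ι ≫ y'),
        ∀ a, R (V.ι ≫ g) (by rw [Category.assoc, h]) (by rw [Category.assoc, h']) a (l a)

namespace FibRel

variable {X X' T : Scheme.{u}} {E : VecBundleData X} {E' : VecBundleData X'} {x : T ⟶ X}
  {x' : T ⟶ X'} (r : FibRel E E' x x')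

theorem R_congr {S : Scheme.{u}} {g g' : S ⟶ T} (hg : g = g') {y : S ⟶ X} {y' : S ⟶ X'}
    (h : g ≫ x = y) (h' : g ≫ x' = y') {a : E.Fiber y} {b : E'.Fiber y'} (hr : r.R g h h' a b) :
    r.R g' (hg ▸ h) (hg ▸ h') a b := by
  subst hg; exact hr

theorem ex {S : Scheme.{u}} (g : S ⟶ T) {y : S ⟶ X} {y' : S ⟶ X'} (h : g ≫ x = y)
    (h' : g ≫ x' = y') (a : E.Fiber y) : ∃ b, r.R g h h' a b := by
  choose V hp l hl using r.lin g h h'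
  obtain ⟨B, hB⟩ := fib_glue (E := E') y' V (fun p => ⟨p, hp p⟩)
    (fun p => l p (res E (V p).ι rfl a)) (by
      intro p q S' s t hst
      have e1 := r.stable s _ _ _ (z := s ≫ (V p).ι ≫ y) (z' := s ≫ (V p).ι ≫ y') rfl rfl _ _
        (hl p (res E (V p).ι rfl a))
      have e2 := r.stable t _ _ _ (z := s ≫ (V p).ι ≫ y) (z' := s ≫ (V p).ι ≫ y')
        (by rw [← Category.assoc, ← hst, Category.assoc])
        (by rw [← Category.assoc, ← hst, Category.assoc]) _ _ (hl q (res E (V q).ι rfl a))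
      rw [res_res] at e1 e2
      have e2' := r.R_congr (g' := s ≫ (V p).ι ≫ g)
        (by rw [← Category.assoc, ← hst, Category.assoc]) _ _ e2
      rw [← res_congr hst (by rw [Category.assoc])] at e2'
      exact r.uniq _ _ _ _ _ _ e1 e2')
  refine ⟨B, r.loc g h h' a B fun p => ⟨V p, hp p, ?_⟩⟩
  rw [hB p]
  exact hl p _

/-- The map defined by a relation. -/
def fn {S : Scheme.{u}} (g : S ⟶ T) {y : S ⟶ X} {y' : S ⟶ X'} (h : g ≫ x = y)
    (h' : g ≫ x' = y') (a : E.Fiber y) : E'.Fiber y' := (r.ex g h h' a).choose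

theorem fn_spec {S : Scheme.{u}} (g : S ⟶ T) {y : S ⟶ X} {y' : S ⟶ X'} (h : g ≫ x = y)
    (h' : g ≫ x' = y') (a : E.Fiber y) : r.R g h h' a (r.fn g h h' a) :=
  (r.ex g h h' a).choose_spec

theorem fn_eq {S : Scheme.{u}} (g : S ⟶ T) {y : S ⟶ X} {y' : S ⟶ X'} (h : g ≫ x = y)
    (h' : g ≫ x' = y') {a : E.Fiber y} {b : E'.Fiber y'} (hr : r.R g h h' a b) :
    r.fn g h h' a = b := r.uniq g h h' a _ _ (r.fn_spec g h h' a) hr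

theorem fn_nat {S' S : Scheme.{u}} (t : S' ⟶ S) (g : S ⟶ T) {y : S ⟶ X} {y' : S ⟶ X'} {z : S' ⟶ X}
    {z' : S' ⟶ X'} (h : g ≫ x = y) (h' : g ≫ x' = y') (k : t ≫ y = z) (k' : t ≫ y' = z')
    (a : E.Fiber y) : res E' t k' (r.fn g h h' a) =
      r.fn (t ≫ g) (by rw [Category.assoc, h, k]) (by rw [Category.assoc, h', k'])
        (res E t k a) :=
  (r.fn_eq _ _ _ (r.stable t g h h' k k' _ _ (r.fn_spec g h h' a))).symm

/-- The natural linear map defined by a relation. -/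
def toFibMap : FibMap E E' x x' where
  app g y y' h h' :=
    { toFun := r.fn g h h'
      map_add' := by
        intro a b
        apply fib_ext
        intro p
        obtain ⟨V, hp, l, hl⟩ := r.lin g h h' p
        refine ⟨V, hp, ?_⟩
        rw [res_add, r.fn_nat V.ι g h h' rfl rfl, r.fn_nat V.ι g h h' rfl rfl,
          r.fn_nat V.ι g h h' rfl rfl, res_add, r.fn_eq _ _ _ (hl _), r.fn_eq _ _ _ (hl _),
          r.fn_eq _ _ _ (hl _), map_add]
      map_smul' := by
        intro c a
        apply fib_ext
        intro p
        obtain ⟨V, hp, l, hl⟩ := r.lin g h h' p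
        refine ⟨V, hp, ?_⟩
        rw [RingHom.id_apply, res_smul, r.fn_nat V.ι g h h' rfl rfl,
          r.fn_nat V.ι g h h' rfl rfl, res_smul, r.fn_eq _ _ _ (hl _), r.fn_eq _ _ _ (hl _),
          map_smul] }
  nat t g _ _ _ _ h h' k k' a := r.fn_nat t g h h' k k' a

theorem toFibMap_spec {S : Scheme.{u}} (g : S ⟶ T) {y : S ⟶ X} {y' : S ⟶ X'} (h : g ≫ x = y)
    (h' : g ≫ x' = y') (a : E.Fiber y) : r.R g h h' a (r.toFibMap.app g h h' a) :=
  r.fn_spec g h h' a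

theorem toFibMap_eq {S : Scheme.{u}} (g : S ⟶ T) {y : S ⟶ X} {y' : S ⟶ X'} (h : g ≫ x = y)
    (h' : g ≫ x' = y') {a : E.Fiber y} {b : E'.Fiber y'} (hr : r.R g h h' a b) :
    r.toFibMap.app g h h' a = b := r.fn_eq g h h' hr

end FibRel

namespace FibMap

variable {X X' T : Scheme.{u}} {E : VecBundleData X} {E' : VecBundleData X'} {x : T ⟶ X}
  {x' : T ⟶ X'}

theorem app_congr (ψ : FibMap E E' x x') {S : Scheme.{u}} {g g' : S ⟶ T} (hg : g = g')
    {y : S ⟶ X} {y' : S ⟶ X'} (h : g ≫ x = y) (h' : g ≫ x' = y') (a : E.Fiber y) :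
    ψ.app g h h' a = ψ.app g' (hg ▸ h) (hg ▸ h') a := by
  subst hg; rfl

/-- Composition. -/
def comp {X'' : Scheme.{u}} {E'' : VecBundleData X''} {x'' : T ⟶ X''}
    (ψ : FibMap E E' x x') (φ : FibMap E' E'' x' x'') : FibMap E E'' x x'' where
  app g _ _ h h'' := (φ.app g rfl h'').comp (ψ.app g h rfl)
  nat t g y y' z z' h h' k k' a := by
    subst h h' k k'
    rw [LinearMap.comp_apply, LinearMap.comp_apply, φ.nat t g rfl rfl rfl rfl,
      ψ.nat t g rfl rfl rfl rfl]
    have : ∀ {w : _} (hw : (t ≫ g) ≫ x' = w),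
      φ.app (t ≫ g) (y := w) (y' := t ≫ g ≫ x'') hw (by simp) (ψ.app (t ≫ g) (y := t ≫ g ≫ x)
        (by simp) hw (res E t rfl a)) = φ.app (t ≫ g) (y' := t ≫ g ≫ x'') rfl (by simp)
          (ψ.app (t ≫ g) (y := t ≫ g ≫ x) (by simp) rfl (res E t rfl a)) := by
      intro w hw; subst hw; rfl
    exact this _

theorem comp_app {X'' : Scheme.{u}} {E'' : VecBundleData X''} {x'' : T ⟶ X''}
    (ψ : FibMap E E' x x') (φ : FibMap E' E'' x' x'') {S : Scheme.{u}} (g : S ⟶ T)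
    {y : S ⟶ X} {y' : S ⟶ X'} {y'' : S ⟶ X''} (h : g ≫ x = y) (h' : g ≫ x' = y')
    (h'' : g ≫ x'' = y'') (a : E.Fiber y) :
    (ψ.comp φ).app g h h'' a = φ.app g h' h'' (ψ.app g h h' a) := by
  subst h'; rfl

/-- Mutually inverse. -/
def Inv (ψ : FibMap E E' x x') (φ : FibMap E' E x' x) : Prop :=
  ∀ {S : Scheme.{u}} (g : S ⟶ T) {y : S ⟶ X} {y' : S ⟶ X'} (h : g ≫ x = y)
    (h' : g ≫ x' = y') (a : E.Fiber y), φ.app g h' h (ψ.app g h h' a) = a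

end FibMap

/-- An isomorphism of bundles from mutually inverse natural linear maps. -/
theorem vbiso_of_fibMap {X : Scheme.{u}} {n m : ℕ} (E : VecBundle n X) (F : VecBundle m X)
    (ψ : FibMap E.toVecBundleData F.toVecBundleData (𝟙 X) (𝟙 X))
    (φ : FibMap F.toVecBundleData E.toVecBundleData (𝟙 X) (𝟙 X))
    (h1 : ψ.Inv φ) (h2 : φ.Inv ψ) : VBIso E F := by
  let P := (ψ.app E.π (y := E.π) (y' := E.π) (by simp) (by simp) ⟨𝟙 _, by simp⟩)
  let Q := (φ.app F.π (y := F.π) (y' := F.π) (by simp) (by simp) ⟨𝟙 _, by simp⟩)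
  have hP : ∀ {S : Scheme.{u}} {y : S ⟶ X} (a : E.toVecBundleData.Fiber y), a.1 ≫ P.1 =
      (ψ.app y (y := y) (y' := y) (by simp) (by simp) a).1 := by
    intro S y a
    obtain ⟨a, rfl⟩ := a
    have := congrArg Subtype.val (ψ.nat a E.π (y := E.π) (y' := E.π) (by simp) (by simp) rfl rfl
      ⟨𝟙 _, by simp⟩)
    refine this.trans ?_
    have e : res E.toVecBundleData a (y := a ≫ E.π) rfl (⟨𝟙 _, by simp⟩ :
      E.toVecBundleData.Fiber E.π) = ⟨a, rfl⟩ := Subtype.ext (by simp [res_val])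
    rw [e]
  have hQ : ∀ {S : Scheme.{u}} {y : S ⟶ X} (a : F.toVecBundleData.Fiber y), a.1 ≫ Q.1 =
      (φ.app y (y := y) (y' := y) (by simp) (by simp) a).1 := by
    intro S y a
    obtain ⟨a, rfl⟩ := a
    have := congrArg Subtype.val (φ.nat a F.π (y := F.π) (y' := F.π) (by simp) (by simp) rfl rfl
      ⟨𝟙 _, by simp⟩)
    refine this.trans ?_
    have e : res F.toVecBundleData a (y := a ≫ F.π) rfl (⟨𝟙 _, by simp⟩ :
      F.toVecBundleData.Fiber F.π) = ⟨a, rfl⟩ := Subtype.ext (by simp [res_val])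
    rw [e]
  refine ⟨P.1, ⟨P.2, ?_, ?_⟩, ⟨Q.1, ?_, ?_⟩⟩
  · intro T a b h h'
    have e1 := hP (⟨E.add a b h, (E.add_π _ _ _).trans h⟩ : E.toVecBundleData.Fiber (b ≫ E.π))
    have e2 : (⟨E.add a b h, (E.add_π _ _ _).trans h⟩ : E.toVecBundleData.Fiber (b ≫ E.π)) =
      ⟨a, h⟩ + ⟨b, rfl⟩ := rfl
    rw [e2, map_add] at e1
    refine e1.trans (F.add_congr ?_ ?_ _ _)
    · exact (hP (⟨a, h⟩ : E.toVecBundleData.Fiber (b ≫ E.π))).symm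
    · exact (hP (⟨b, rfl⟩ : E.toVecBundleData.Fiber (b ≫ E.π))).symm
  · intro T f a
    have e1 := hP (⟨E.smul f a, (E.smul_π _ _)⟩ : E.toVecBundleData.Fiber (a ≫ E.π))
    have e2 : (⟨E.smul f a, (E.smul_π _ _)⟩ : E.toVecBundleData.Fiber (a ≫ E.π)) =
      f • ⟨a, rfl⟩ := rfl
    rw [e2, map_smul] at e1
    refine e1.trans ?_
    exact congrArg (F.smul f) (hP (⟨a, rfl⟩ : E.toVecBundleData.Fiber (a ≫ E.π))).symm
  · exact (hQ P).trans (congrArg Subtype.val (h1 E.π _ _ _))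
  · exact (hP Q).trans (congrArg Subtype.val (h2 F.π _ _ _))

/-- A linear isomorphism gives natural linear maps. -/
def fibMapOfHom {X : Scheme.{u}} {E F : VecBundleData X} (φ : E.tot ⟶ F.tot)
    (h : IsLinearHom E F φ) {T : Scheme.{u}} (x : T ⟶ X) : FibMap E F x x where
  app {S} g y y' hy hy' :=
    { toFun := fun a => ⟨a.1 ≫ φ, by rw [Category.assoc, h.1, a.2, ← hy, ← hy']⟩
      map_add' := fun a b => Subtype.ext (h.2.1 _ _ _ _)
      map_smul' := fun f a => Subtype.ext (h.2.2 _ _) }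
  nat t g _ _ _ _ h h' k k' a := Subtype.ext (by simp [res_val])

end WRN


namespace WRN

section Det

variable {X X' T : Scheme.{u}} {n : ℕ} {E : VecBundle n X} {D : LineBundle X}
  {E' : VecBundle n X'} {D' : LineBundle X'} (d : DetData E D) (d' : DetData E' D')
  {x : T ⟶ X} {x' : T ⟶ X'} (ψ : FibMap E.toVecBundleData E'.toVecBundleData x x')

/-- The relation defining the determinant of a natural linear map. -/
def detRel : FibRel D.toVecBundleData D'.toVecBundleData x x' where
  R {S} g {y y'} h h' a b := ∀ ⦃S' : Scheme.{u}⦄ (t : S' ⟶ S) ⦃z : S' ⟶ X⦄ ⦃z' : S' ⟶ X'⦄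
    (k : t ≫ y = z) (k' : t ≫ y' = z') (v : Fin n → E.toVecBundleData.Fiber z), IsBas v →
    ∀ f : Γ(S', ⊤), res D.toVecBundleData t k a = f • d.δ z v →
      res D'.toVecBundleData t k' b = f • d'.δ z' (fun i => ψ.app (t ≫ g)
        (by rw [Category.assoc, h, k]) (by rw [Category.assoc, h', k']) (v i))
  stable {S' S} t g {y y' z z'} h h' k k' a b hr := by
    intro S'' t' w w' m m' v hv f hf
    rw [res_res] at hf ⊢
    have := hr (t' ≫ t) (z := w) (z' := w') (by rw [Category.assoc, k, m])
      (by rw [Category.assoc, k', m']) v hv f hf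
    rw [this]
    congr 2
  loc {S} g {y y'} h h' a b hr := by
    intro S' t z z' k k' v hv f hf
    apply fib_ext
    intro p
    obtain ⟨V, hp, hV⟩ := hr (t p)
    have e := morphismRestrict_ι t V
    refine ⟨t ⁻¹ᵁ V, hp, ?_⟩
    have := hV (t ∣_ V) (z := (t ⁻¹ᵁ V).ι ≫ z) (z' := (t ⁻¹ᵁ V).ι ≫ z')
      (by rw [← Category.assoc, e, Category.assoc, k])
      (by rw [← Category.assoc, e, Category.assoc, k'])
      (fun i => res E.toVecBundleData (t ⁻¹ᵁ V).ι rfl (v i)) (hv.res _ _)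
      ((t ⁻¹ᵁ V).ι.appTop f) (by
        rw [res_res, res_congr e, ← d.nat, ← res_smul, ← hf, res_res])
    rw [res_res, res_congr e] at this
    rw [res_res, res_smul, this, d'.nat]
    congr 2
    funext i
    rw [ψ.nat (t ⁻¹ᵁ V).ι _ _ _ rfl rfl]
    exact ψ.app_congr (by rw [← Category.assoc, e, Category.assoc]) _ _ _
  uniq {S} g {y y'} h h' a b b' hb hb' := by
    apply fib_ext
    intro p
    obtain ⟨V, v, hp, hv⟩ := exists_isBas E y p
    refine ⟨V, hp, ?_⟩
    obtain ⟨f, hf⟩ := (d.bas hv).one_bij.2 (res D.toVecBundleData V.ι rfl a)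
    rw [hb V.ι rfl rfl v hv f hf.symm, hb' V.ι rfl rfl v hv f hf.symm]
  lin {S} g {y y'} h h' p := by
    obtain ⟨V, v, hp, hv⟩ := exists_isBas E y p
    refine ⟨V, hp, ?_⟩
    let w : D'.toVecBundleData.Fiber (V.ι ≫ y') := d'.δ (V.ι ≫ y') (fun i => ψ.app (V.ι ≫ g)
        (by rw [Category.assoc, h]) (by rw [Category.assoc, h']) (v i))
    refine ⟨(LinearMap.toSpanSingleton _ _ w).comp
      ((LinearMap.proj 0).comp (d.bas hv).equiv.symm.toLinearMap), ?_⟩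
    intro a S' t z z' k k' v' hv' f hf
    have ha : a = (d.bas hv).equiv.symm a 0 • d.δ _ v := by
      conv_lhs => rw [← (d.bas hv).comb_symm a]
      rw [comb_one]
    set c := (d.bas hv).equiv.symm a 0
    have hl : ((LinearMap.toSpanSingleton _ _ w).comp
      ((LinearMap.proj 0).comp (d.bas hv).equiv.symm.toLinearMap)) a = c • w := rfl
    rw [hl, res_smul]
    rw [ha, res_smul, d.nat] at hf
    have hb := hv.res t k
    obtain ⟨A, hA, hAv⟩ := hb.trans hv'
    subst hAv
    rw [alt_comb, smul_smul] at hf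
    have h2 := (d.bas hb).one_bij.1 hf
    simp only at h2
    rw [h2]
    have h3 : (fun i => ψ.app (t ≫ V.ι ≫ g) (y := z) (y' := z')
        (by rw [← k, Category.assoc, Category.assoc, h])
        (by rw [← k', Category.assoc, Category.assoc, h'])
          (∑ j, A i j • res E.toVecBundleData t k (v j))) =
        fun i => ∑ j, A i j • ψ.app (t ≫ V.ι ≫ g) (y := z) (y' := z')
        (by rw [← k, Category.assoc, Category.assoc, h])
        (by rw [← k', Category.assoc, Category.assoc, h'])
          (res E.toVecBundleData t k (v j)) := by
      funext i
      rw [map_sum]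
      exact Finset.sum_congr rfl fun j _ => by rw [map_smul]
    rw [h3, alt_comb, smul_smul, d'.nat]
    congr 2
    funext i
    exact ψ.nat t _ _ _ _ _ _

/-- The determinant of a natural linear map. -/
def detMap : FibMap D.toVecBundleData D'.toVecBundleData x x' := (detRel d d' ψ).toFibMap

theorem detMap_bas {S : Scheme.{u}} (g : S ⟶ T) {y : S ⟶ X} {y' : S ⟶ X'} (h : g ≫ x = y)
    (h' : g ≫ x' = y') (v : Fin n → E.toVecBundleData.Fiber y) (hv : IsBas v) :
    (detMap d d' ψ).app g h h' (d.δ y v) = d'.δ y' (fun i => ψ.app g h h' (v i)) := by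
  have := (detRel d d' ψ).toFibMap_spec g h h' (d.δ y v) (𝟙 S) (Category.id_comp _)
    (Category.id_comp _) v hv 1 (by rw [res_id, one_smul])
  rw [res_id, one_smul] at this
  refine this.trans ?_
  congr 1

/-- Locally, elements of the determinant bundle are multiples of determinants of bases. -/
theorem DetData.local_form {S : Scheme.{u}} (y : S ⟶ X) (a : D.toVecBundleData.Fiber y) (p : S) :
    ∃ (V : S.Opens) (v : Fin n → E.toVecBundleData.Fiber (V.ι ≫ y)) (f : Γ(V.toScheme, ⊤)),
      p ∈ V ∧ IsBas v ∧ res D.toVecBundleData V.ι rfl a = f • d.δ (V.ι ≫ y) v := by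
  obtain ⟨V, v, hp, hv⟩ := exists_isBas E y p
  obtain ⟨f, hf⟩ := (d.bas hv).one_bij.2 (res D.toVecBundleData V.ι rfl a)
  exact ⟨V, v, f, hp, hv, hf.symm⟩

/-- Two natural linear maps of line bundles agree if they agree on determinants of bases. -/
theorem detMap_ext {S : Scheme.{u}} {y : S ⟶ X} {y' : S ⟶ X'}
    (φ φ' : FibMap D.toVecBundleData D'.toVecBundleData y y')
    (H : ∀ {S' : Scheme.{u}} (t : S' ⟶ S) {z : S' ⟶ X} {z' : S' ⟶ X'} (k : t ≫ y = z)
      (k' : t ≫ y' = z') (v : Fin n → E.toVecBundleData.Fiber z), IsBas v →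
      φ.app t k k' (d.δ z v) = φ'.app t k k' (d.δ z v))
    {S' : Scheme.{u}} (t : S' ⟶ S) {z : S' ⟶ X} {z' : S' ⟶ X'} (k : t ≫ y = z)
      (k' : t ≫ y' = z') (a : D.toVecBundleData.Fiber z) : φ.app t k k' a = φ'.app t k k' a := by
  apply fib_ext
  intro p
  obtain ⟨V, v, f, hp, hv, hf⟩ := d.local_form z a p
  refine ⟨V, hp, ?_⟩
  rw [φ.nat V.ι t k k' rfl rfl, φ'.nat V.ι t k k' rfl rfl, hf, map_smul, map_smul, H _ _ _ v hv]

theorem detMap_inv (φ : FibMap E'.toVecBundleData E.toVecBundleData x' x) (h1 : ψ.Inv φ)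
    (h2 : φ.Inv ψ) : (detMap d d' ψ).Inv (detMap d' d φ) := by
  have hbas : ∀ {S : Scheme.{u}} (g : S ⟶ T) {y : S ⟶ X} {y' : S ⟶ X'} (h : g ≫ x = y)
    (h' : g ≫ x' = y') (v : Fin n → E.toVecBundleData.Fiber y), IsBas v →
      IsBas (fun i => ψ.app g h h' (v i)) := by
    intro S g y y' h h' v hv S' t
    have e : ∀ c : Fin n → Γ(S', ⊤), comb (fun i => res E'.toVecBundleData t (y := t ≫ y') rfl
        (ψ.app g h h' (v i))) c = ψ.app (t ≫ g) (y := t ≫ y) (by rw [Category.assoc, h])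
          (by rw [Category.assoc, h']) (comb (fun i => res E.toVecBundleData t rfl (v i)) c) := by
      intro c
      simp only [comb, map_sum, map_smul]
      exact Finset.sum_congr rfl fun i _ => by rw [ψ.nat t g h h' rfl rfl]
    rw [funext e]
    refine Function.Bijective.comp (g := fun a => ψ.app (t ≫ g) (y := t ≫ y)
      (by rw [Category.assoc, h]) (by rw [Category.assoc, h']) a)
      ⟨Function.LeftInverse.injective (g := fun a => φ.app (t ≫ g) (y' := t ≫ y)
        (by rw [Category.assoc, h']) (by rw [Category.assoc, h]) a) fun a => h1 _ _ _ a,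
       Function.RightInverse.surjective (g := fun a => φ.app (t ≫ g) (y' := t ≫ y)
        (by rw [Category.assoc, h']) (by rw [Category.assoc, h]) a) fun a => h2 _ _ _ a⟩ (hv t)
  intro S g y y' h h' a
  apply fib_ext
  intro p
  obtain ⟨V, v, f, hp, hv, hf⟩ := d.local_form y a p
  refine ⟨V, hp, ?_⟩
  rw [(detMap d' d φ).nat V.ι g h' h rfl rfl, (detMap d d' ψ).nat V.ι g h h' rfl rfl, hf,
    map_smul, map_smul, detMap_bas _ _ _ _ _ _ _ hv,
    detMap_bas _ _ _ _ _ _ _ (hbas _ _ _ _ hv)]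
  congr 2
  funext i
  exact h1 _ _ _ _

end Det

end WRN


namespace WRN
/-- Affine test schemes from algebras over the ring of functions of an affine scheme. -/
theorem exists_affine_test (V : Scheme.{u}) [IsAffine V] {B : Type u} [CommRing B]
    (φ : Γ(V, ⊤) →+* B) :
    ∃ (S : Scheme.{u}) (t : S ⟶ V) (e : B ≃+* Γ(S, ⊤)), (∀ c, t.appTop c = e (φ c)) ∧
      ∀ {S' : Scheme.{u}} (g : S' ⟶ V) (χ : B →+* Γ(S', ⊤)), (∀ c, χ (φ c) = g.appTop c) →
        ∃ s : S' ⟶ S, s ≫ t = g ∧ ∀ b, s.appTop (e b) = χ b := by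
  let S : Scheme.{u} := Spec (CommRingCat.of B)
  let e : B ≃+* Γ(S, ⊤) := (Scheme.ΓSpecIso (CommRingCat.of B)).symm.commRingCatIsoToRingEquiv
  let t : S ⟶ V := Spec.map (CommRingCat.ofHom φ) ≫ V.isoSpec.inv
  have ht : ∀ c, t.appTop c = e (φ c) := by
    intro c
    have h1 : V.isoSpec.inv.appTop = (Scheme.ΓSpecIso Γ(V, ⊤)).inv := by
      have h3 : V.isoSpec.inv.appTop ≫ V.isoSpec.hom.appTop = 𝟙 _ := by
        rw [← Scheme.Hom.comp_appTop, Iso.hom_inv_id, Scheme.Hom.id_appTop]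
      have h4 : V.isoSpec.hom.appTop = (Scheme.ΓSpecIso Γ(V, ⊤)).hom :=
        Scheme.toSpecΓ_appTop V
      rw [h4] at h3
      rw [← cancel_mono (Scheme.ΓSpecIso Γ(V, ⊤)).hom, h3, Iso.inv_hom_id]
    have h2 : t.appTop = CommRingCat.ofHom φ ≫ (Scheme.ΓSpecIso (CommRingCat.of B)).inv := by
      rw [Scheme.ΓSpecIso_inv_naturality, Scheme.Hom.comp_appTop, h1]
      rfl
    rw [h2]; rfl
  refine ⟨S, t, e, ht, ?_⟩
  intro S' g χ hχ
  let s : S' ⟶ S := S'.toSpecΓ ≫ Spec.map (CommRingCat.ofHom χ)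
  have hs : ∀ b, s.appTop (e b) = χ b := by
    intro b
    have h2 : (Scheme.ΓSpecIso (CommRingCat.of B)).inv ≫ s.appTop = CommRingCat.ofHom χ := by
      rw [Scheme.Hom.comp_appTop, ← Category.assoc, ← Scheme.ΓSpecIso_inv_naturality]
      simp
    exact congrArg (fun f => f.hom b) h2
  refine ⟨s, ?_, hs⟩
  apply ext_of_isAffine
  ext c
  rw [appTop_comp_apply]
  rw [ht, hs, hχ]

theorem eval_sq_zero {A B : Type*} [CommRing A] [CommRing B] (φ : A →+* B) {n : ℕ}
    (c : Fin n → B) (ε : B) (hε : ε * ε = 0) (F : MvPolynomial (Fin n) A) :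
    MvPolynomial.eval₂Hom φ (fun i => ε * c i) F = φ (MvPolynomial.constantCoeff F) +
      ε * ∑ i, c i * φ (MvPolynomial.coeff (Finsupp.single i 1) F) := by
  induction F using MvPolynomial.induction_on with
  | C a =>
    have h0 : ∀ i : Fin n, ¬ (0 : Fin n →₀ ℕ) = Finsupp.single i 1 := fun i h => by
      have := congrArg (fun f => f i) h
      simp at this
    simp [MvPolynomial.coeff_C, h0]
  | add p q hp hq =>
    rw [map_add, hp, hq]
    simp only [map_add, MvPolynomial.coeff_add, mul_add, Finset.sum_add_distrib]
    ring
  | mul_X p i hp =>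
    rw [map_mul, hp]
    have h1 : ∀ j, MvPolynomial.coeff (Finsupp.single j 1) (p * MvPolynomial.X i) =
        if j = i then MvPolynomial.constantCoeff p else 0 := by
      intro j
      rw [MvPolynomial.coeff_mul_X']
      by_cases hj : j = i
      · subst hj; simp [MvPolynomial.constantCoeff_eq]
      · have : i ∉ (Finsupp.single j 1 : Fin n →₀ ℕ).support := by
          simp [Ne.symm hj]
        rw [if_neg this, if_neg hj]
    simp only [h1]
    simp [apply_ite φ]
    linear_combination (c i * ∑ i, c i * φ (MvPolynomial.coeff (Finsupp.single i 1) p)) * hε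

theorem exists_isBas_affine {X X' : Scheme.{u}} {n m : ℕ} (E : VecBundle n X) (E' : VecBundle m X')
    {S : Scheme.{u}} (y : S ⟶ X) (y' : S ⟶ X') (p : S) :
    ∃ (V : S.Opens) (v : Fin n → E.toVecBundleData.Fiber (V.ι ≫ y))
      (w : Fin m → E'.toVecBundleData.Fiber (V.ι ≫ y')), p ∈ V ∧ IsAffine V.toScheme ∧
        IsBas v ∧ IsBas w := by
  obtain ⟨V₁, v, hp, hv⟩ := exists_isBas E y p
  obtain ⟨V₂, w, hp', hw⟩ := exists_isBas E' y' p
  obtain ⟨W, hW, hpW, hle⟩ := exists_isAffineOpen_mem_and_subset (x := p) (U := V₁ ⊓ V₂)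
    ⟨hp, hp'⟩
  have h1 : W ≤ V₁ := fun _ h => (hle h).1
  have h2 : W ≤ V₂ := fun _ h => (hle h).2
  exact ⟨W, _, _, hpW, hW, hv.res (S.homOfLE h1) (y := W.ι ≫ y)
    (by rw [← Category.assoc, Scheme.homOfLE_ι]), hw.res (S.homOfLE h2) (y := W.ι ≫ y')
    (by rw [← Category.assoc, Scheme.homOfLE_ι])⟩

/-- A natural (not necessarily linear) map between fibers. -/
structure NMap {X X' T : Scheme.{u}} (E : VecBundleData X) (E' : VecBundleData X')
    (x : T ⟶ X) (x' : T ⟶ X') where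
  app : ∀ {S : Scheme.{u}} (g : S ⟶ T) {y : S ⟶ X} {y' : S ⟶ X'} (_ : g ≫ x = y)
    (_ : g ≫ x' = y'), E.Fiber y → E'.Fiber y'
  nat : ∀ {S' S : Scheme.{u}} (t : S' ⟶ S) (g : S ⟶ T) {y : S ⟶ X} {y' : S ⟶ X'} {z : S' ⟶ X}
    {z' : S' ⟶ X'} (h : g ≫ x = y) (h' : g ≫ x' = y') (k : t ≫ y = z) (k' : t ≫ y' = z')
    (a : E.Fiber y), res E' t k' (app g h h' a) =
      app (t ≫ g) (by rw [Category.assoc, h, k]) (by rw [Category.assoc, h', k']) (res E t k a)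

/-- The zero section is preserved. -/
def NMap.Zero {X X' T : Scheme.{u}} {E : VecBundleData X} {E' : VecBundleData X'}
    {x : T ⟶ X} {x' : T ⟶ X'} (θ : NMap E E' x x') : Prop :=
  ∀ ⦃S : Scheme.{u}⦄ (g : S ⟶ T) ⦃y : S ⟶ X⦄ ⦃y' : S ⟶ X'⦄ (h : g ≫ x = y) (h' : g ≫ x' = y'),
    θ.app g h h' 0 = 0

theorem NMap.app_congr {X X' T : Scheme.{u}} {E : VecBundleData X} {E' : VecBundleData X'}
    {x : T ⟶ X} {x' : T ⟶ X'} (ψ : NMap E E' x x') {S : Scheme.{u}} {g g' : S ⟶ T} (hg : g = g')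
    {y : S ⟶ X} {y' : S ⟶ X'} (h : g ≫ x = y) (h' : g ≫ x' = y') (a : E.Fiber y) :
    ψ.app g h h' a = ψ.app g' (hg ▸ h) (hg ▸ h') a := by
  subst hg; rfl

/-- Local polynomial form of a natural map. -/
theorem NMap.poly {X X' T : Scheme.{u}} {E : VecBundleData X} {E' : VecBundleData X'}
    {x : T ⟶ X} {x' : T ⟶ X'} (θ : NMap E E' x x') {n m : ℕ} [IsAffine T]
    {v : Fin n → E.Fiber x} {w : Fin m → E'.Fiber x'} (hw : IsBas w) :
    ∃ F : Fin m → MvPolynomial (Fin n) Γ(T, ⊤), ∀ {S : Scheme.{u}} (g : S ⟶ T) {y : S ⟶ X}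
      {y' : S ⟶ X'} (h : g ≫ x = y) (h' : g ≫ x' = y') (c : Fin n → Γ(S, ⊤)),
      θ.app g h h' (comb (fun i => res E g h (v i)) c) =
        comb (fun j => res E' g h' (w j)) (fun j => MvPolynomial.eval₂Hom g.appTop.hom c (F j)) := by
  obtain ⟨A, t, e, ht, hu⟩ := exists_affine_test T
    (MvPolynomial.C : Γ(T, ⊤) →+* MvPolynomial (Fin n) Γ(T, ⊤))
  have hb := hw.res t (y := t ≫ x') rfl
  obtain ⟨F, hF⟩ := hb.bij_self.2 (θ.app t (y := t ≫ x) rfl rfl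
    (comb (fun i => res E t rfl (v i)) (fun i => e (MvPolynomial.X i))))
  refine ⟨fun j => e.symm (F j), ?_⟩
  intro S g y y' h h' c
  obtain ⟨s, hs, hs'⟩ := hu g (MvPolynomial.eval₂Hom g.appTop.hom c) (by intro a; simp)
  have key := congrArg (res E' s (y := y') (by rw [← h', ← hs, Category.assoc])) hF
  rw [θ.nat s t rfl rfl (z := y) (by rw [← h, ← hs, Category.assoc]), res_comb, res_comb] at key
  simp only [res_res, hs'] at key
  have e1 : ∀ j, s.appTop (F j) = MvPolynomial.eval₂Hom g.appTop.hom c (e.symm (F j)) := by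
    intro j
    rw [← hs', RingEquiv.apply_symm_apply]
  simp only [e1, MvPolynomial.eval₂Hom_X'] at key
  subst hs
  exact key.symm

/-- Restriction of a natural map. -/
def NMap.restr {X X' T : Scheme.{u}} {E : VecBundleData X} {E' : VecBundleData X'}
    {x : T ⟶ X} {x' : T ⟶ X'} (θ : NMap E E' x x') {S : Scheme.{u}} (g : S ⟶ T) {y : S ⟶ X}
    {y' : S ⟶ X'} (h : g ≫ x = y) (h' : g ≫ x' = y') : NMap E E' y y' where
  app {S'} t {z z'} k k' a := θ.app (t ≫ g) (by rw [Category.assoc, h, k])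
    (by rw [Category.assoc, h', k']) a
  nat {S'' S'} t s {y y' z z'} k k' l l' a := by
    rw [θ.nat t (s ≫ g) _ _ l l']
    exact θ.app_congr (by simp) _ _ _

theorem smul_comb {X T : Scheme.{u}} {E : VecBundleData X} {x : T ⟶ X} {n : ℕ}
    (v : Fin n → E.Fiber x) (f : Fin n → Γ(T, ⊤)) (c : Γ(T, ⊤)) :
    c • comb v f = comb v (fun i => c * f i) := by
  unfold comb
  rw [Finset.smul_sum]
  exact Finset.sum_congr rfl fun i _ => by rw [smul_smul]

/-- The relation defining the differential of a natural map. -/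
def diffRel {X X' T : Scheme.{u}} {n m : ℕ} {E : VecBundle n X} {E' : VecBundle m X'}
    {x : T ⟶ X} {x' : T ⟶ X'} (θ : NMap E.toVecBundleData E'.toVecBundleData x x')
    (h0 : θ.Zero) : FibRel E.toVecBundleData E'.toVecBundleData x x' where
  R {S} g {y y'} h h' a b := ∀ ⦃S' : Scheme.{u}⦄ (t : S' ⟶ S) ⦃z : S' ⟶ X⦄ ⦃z' : S' ⟶ X'⦄
    (k : t ≫ y = z) (k' : t ≫ y' = z') (ε : Γ(S', ⊤)), ε * ε = 0 →
      θ.app (t ≫ g) (by rw [Category.assoc, h, k]) (by rw [Category.assoc, h', k'])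
        (ε • res E.toVecBundleData t k a) = ε • res E'.toVecBundleData t k' b
  stable {S' S} t g {y y' z z'} h h' k k' a b hr := by
    intro S'' t' w w' m m' ε hε
    rw [res_res, res_res]
    have := hr (t' ≫ t) (z := w) (z' := w') (by rw [Category.assoc, k, m])
      (by rw [Category.assoc, k', m']) ε hε
    rw [← this]
    exact θ.app_congr (by simp) _ _ _
  loc {S} g {y y'} h h' a b hr := by
    intro S' t z z' k k' ε hε
    apply fib_ext
    intro p
    obtain ⟨V, hp, hV⟩ := hr (t p)
    have e := morphismRestrict_ι t V
    refine ⟨t ⁻¹ᵁ V, hp, ?_⟩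
    have := hV (t ∣_ V) (z := (t ⁻¹ᵁ V).ι ≫ z) (z' := (t ⁻¹ᵁ V).ι ≫ z')
      (by rw [← Category.assoc, e, Category.assoc, k])
      (by rw [← Category.assoc, e, Category.assoc, k'])
      ((t ⁻¹ᵁ V).ι.appTop ε) (by rw [← map_mul, hε, map_zero])
    rw [res_res, res_congr e, res_res, res_congr e] at this
    rw [θ.nat _ _ _ _ rfl rfl, res_smul, res_smul, res_res, res_res, ← this]
    exact θ.app_congr (by rw [← Category.assoc, ← e, Category.assoc]) _ _ _
  uniq {S} g {y y'} h h' a b b' hb hb' := by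
    apply fib_ext
    intro p
    obtain ⟨V, v, w, hp, hV, hv, hw⟩ := exists_isBas_affine E E' y y' p
    refine ⟨V, hp, ?_⟩
    obtain ⟨A, t, e, ht, -⟩ := exists_affine_test V.toScheme
      (TrivSqZeroExt.inlHom Γ(V.toScheme, ⊤) Γ(V.toScheme, ⊤))
    obtain ⟨c, hc⟩ := hw.bij_self.2 (res E'.toVecBundleData V.ι rfl b)
    obtain ⟨c', hc'⟩ := hw.bij_self.2 (res E'.toVecBundleData V.ι rfl b')
    rw [← hc, ← hc']
    congr 1
    have hε : e (TrivSqZeroExt.inr 1) * e (TrivSqZeroExt.inr 1) = 0 := by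
      rw [← map_mul, TrivSqZeroExt.inr_mul_inr, map_zero]
    have e1 := (hb (t ≫ V.ι) (z := (t ≫ V.ι) ≫ y) (z' := (t ≫ V.ι) ≫ y') rfl rfl _ hε).symm.trans
      (hb' (t ≫ V.ι) rfl rfl _ hε)
    rw [← res_res t V.ι (y := V.ι ≫ y') rfl (by simp), ← res_res t V.ι (y := V.ι ≫ y') rfl
      (by simp), ← hc, ← hc', res_comb, res_comb, smul_comb, smul_comb] at e1
    have e2 := (hw.res t (y := (t ≫ V.ι) ≫ y') (by simp)).bij_self.1 e1
    funext i
    have e3 := congrFun e2 i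
    simp only [ht] at e3
    rw [← map_mul, ← map_mul] at e3
    have e4 := e.injective e3
    simpa using congrArg TrivSqZeroExt.snd e4
  lin {S} g {y y'} h h' p := by
    obtain ⟨V, v, w, hp, hV, hv, hw⟩ := exists_isBas_affine E E' y y' p
    refine ⟨V, hp, ?_⟩
    obtain ⟨F, hF⟩ := NMap.poly (θ.restr (V.ι ≫ g) (y := V.ι ≫ y) (y' := V.ι ≫ y')
      (by rw [Category.assoc, h]) (by rw [Category.assoc, h'])) (v := v) hw
    have hF0 : ∀ j, MvPolynomial.constantCoeff (F j) = 0 := by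
      have h1 := hF (𝟙 _) (y := V.ι ≫ y) (y' := V.ι ≫ y') (by simp) (by simp) 0
      have h2 : comb (fun i => res E.toVecBundleData (𝟙 _) (by simp) (v i)) 0 =
          (0 : E.toVecBundleData.Fiber (V.ι ≫ y)) := by simp [comb]
      rw [h2] at h1
      have h3 := h0 (𝟙 V.toScheme ≫ V.ι ≫ g) (y := V.ι ≫ y) (y' := V.ι ≫ y') (by simp [h])
        (by simp [h'])
      have h4 := h3.symm.trans h1
      have h5 : comb (fun j => res E'.toVecBundleData (𝟙 _) (by simp) (w j)) 0 =
          (0 : E'.toVecBundleData.Fiber (V.ι ≫ y')) := by simp [comb]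
      rw [← h5] at h4
      have h6 := (hw.res (𝟙 _) (y := V.ι ≫ y') (by simp)).bij_self.1 h4
      intro j
      have h7 := (congrFun h6 j).symm
      simp only [Scheme.Hom.id_appTop, CommRingCat.hom_id, Pi.zero_apply] at h7
      have h8 := eval_sq_zero (RingHom.id Γ(V.toScheme, ⊤)) (n := n) 0 0 (mul_zero 0) (F j)
      rw [zero_mul, add_zero, RingHom.id_apply] at h8
      have h9 : (fun i => (0 : Γ(V.toScheme, ⊤)) * (0 : Fin n → Γ(V.toScheme, ⊤)) i) = 0 :=
        funext fun i => zero_mul _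
      rw [h9, h7] at h8
      exact h8.symm
    let M : (Fin n → Γ(V.toScheme, ⊤)) →ₗ[Γ(V.toScheme, ⊤)] (Fin m → Γ(V.toScheme, ⊤)) :=
      Matrix.toLin' (Matrix.of fun j i => MvPolynomial.coeff (Finsupp.single i 1) (F j))
    have hM : ∀ c j, M c j = ∑ i, c i * MvPolynomial.coeff (Finsupp.single i 1) (F j) := by
      intro c j
      simp [M, Matrix.mulVec, dotProduct, mul_comm]
    refine ⟨hw.equiv.toLinearMap ∘ₗ M ∘ₗ hv.equiv.symm.toLinearMap, ?_⟩
    intro a S' t z z' k k' ε hε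
    obtain ⟨c, rfl⟩ := hv.equiv.surjective a
    simp only [LinearMap.comp_apply, LinearEquiv.coe_coe, LinearEquiv.symm_apply_apply]
    rw [hv.equiv_apply, hw.equiv_apply, res_comb, res_comb, smul_comb, smul_comb]
    have h1 := hF t k k' (fun i => ε * t.appTop (c i))
    refine Eq.trans ?_ (h1.trans ?_)
    · rfl
    · congr 1
      funext j
      rw [eval_sq_zero _ (fun i => t.appTop (c i)) ε hε, hF0, map_zero, zero_add, hM, map_sum]
      congr 1
      exact Finset.sum_congr rfl fun i _ => (map_mul _ _ _).symm

section
variable {X X' T : Scheme.{u}} {E : VecBundleData X} {E' : VecBundleData X'}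
    {x : T ⟶ X} {x' : T ⟶ X'}

/-- `φ` is a left inverse of `ψ`. -/
def NMap.Inv (ψ : NMap E E' x x') (φ : NMap E' E x' x) : Prop :=
  ∀ {S : Scheme.{u}} (g : S ⟶ T) {y : S ⟶ X} {y' : S ⟶ X'} (h : g ≫ x = y)
    (h' : g ≫ x' = y') (a : E.Fiber y), φ.app g h' h (ψ.app g h h' a) = a

/-- Normalization of a natural map. -/
def NMap.norm (θ : NMap E E' x x') : NMap E E' x x' where
  app {S} g {y y'} h h' a := θ.app g h h' a + (-1 : Γ(S, ⊤)) • θ.app g h h' 0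
  nat {S'' S'} t s {y y' z z'} k k' l l' a := by
    rw [res_add, res_smul, θ.nat t s k k' l l', θ.nat t s k k' l l', res_zero, map_neg, map_one]

/-- Inverse of a normalized natural map. -/
def NMap.normInv (θ : NMap E E' x x') (θ' : NMap E' E x' x) : NMap E' E x' x where
  app {S} g {y y'} h h' a := θ'.app g h h' (a + θ.app g h' h 0)
  nat {S'' S'} t s {y y' z z'} k k' l l' a := by
    rw [θ'.nat t s k k' l l', res_add, θ.nat t s k' k l' l, res_zero]

theorem add_neg_smul {T : Scheme.{u}} {x : T ⟶ X} (a : E.Fiber x) :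
    a + (-1 : Γ(T, ⊤)) • a = 0 := by
  have h : ((1 : Γ(T, ⊤)) + (-1)) • a = 0 := by rw [add_neg_cancel, zero_smul]
  rwa [add_smul, one_smul] at h

theorem NMap.norm_zero (θ : NMap E E' x x') : θ.norm.Zero := by
  intro S g y y' h h'
  exact add_neg_smul _

theorem NMap.normInv_zero (θ : NMap E E' x x') (θ' : NMap E' E x' x) (h : θ.Inv θ') :
    (θ.normInv θ').Zero := by
  intro S g y y' k k'
  show θ'.app g k k' (0 + θ.app g k' k 0) = 0
  rw [zero_add, h]

theorem NMap.norm_inv (θ : NMap E E' x x') (θ' : NMap E' E x' x) (h : θ.Inv θ') :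
    θ.norm.Inv (θ.normInv θ') := by
  intro S g y y' k k' a
  show θ'.app g k' k (θ.app g k k' a + (-1 : Γ(S, ⊤)) • θ.app g k k' 0 + θ.app g k k' 0) = a
  rw [add_assoc, add_comm (_ • _), add_neg_smul, add_zero, h]

theorem NMap.normInv_inv (θ : NMap E E' x x') (θ' : NMap E' E x' x) (h : θ'.Inv θ) :
    (θ.normInv θ').Inv θ.norm := by
  intro S g y y' k k' a
  show θ.app g k' k (θ'.app g k k' (a + θ.app g k' k 0)) + (-1 : Γ(S, ⊤)) • θ.app g k' k 0 = a
  rw [h, add_assoc, add_neg_smul, add_zero]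

end

theorem diff_inv {X X' T : Scheme.{u}} {n m : ℕ} {E : VecBundle n X} {E' : VecBundle m X'}
    {x : T ⟶ X} {x' : T ⟶ X'} (θ : NMap E.toVecBundleData E'.toVecBundleData x x')
    (θ' : NMap E'.toVecBundleData E.toVecBundleData x' x) (h0 : θ.Zero) (h0' : θ'.Zero)
    (h : θ.Inv θ') : (diffRel θ h0).toFibMap.Inv (diffRel θ' h0').toFibMap := by
  intro S g y y' k k' a
  apply FibRel.toFibMap_eq
  intro S' t z z' l l' ε hε
  have := (diffRel θ h0).toFibMap_spec g k k' a t l' l ε hε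
  rw [← this, h]

/-- Naturally (nonlinearly) isomorphic vector bundles are linearly isomorphic. -/
theorem exists_fibMap_of_nmap {X X' T : Scheme.{u}} {n m : ℕ} {E : VecBundle n X}
    {E' : VecBundle m X'} {x : T ⟶ X} {x' : T ⟶ X'}
    (θ : NMap E.toVecBundleData E'.toVecBundleData x x')
    (θ' : NMap E'.toVecBundleData E.toVecBundleData x' x) (h : θ.Inv θ') (h' : θ'.Inv θ) :
    ∃ (ψ : FibMap E.toVecBundleData E'.toVecBundleData x x')
      (φ : FibMap E'.toVecBundleData E.toVecBundleData x' x), ψ.Inv φ ∧ φ.Inv ψ :=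
  ⟨_, _, diff_inv θ.norm (θ.normInv θ') θ.norm_zero (θ.normInv_zero θ' h) (θ.norm_inv θ' h),
    diff_inv (θ.normInv θ') θ.norm (θ.normInv_zero θ' h) θ.norm_zero (θ.normInv_inv θ' h')⟩

end WRN

namespace WRN

section relglue

universe v

variable {X : Scheme.{u}} (I : Set X.Opens)

theorem isOpenCover_of (hcov : ∀ p : X, ∃ U ∈ I, p ∈ U) :
    TopologicalSpace.IsOpenCover (fun U : I => U.1) := by
  refine TopologicalSpace.IsOpenCover.mk ?_
  rw [eq_top_iff]
  intro p _
  obtain ⟨U, hU, hp⟩ := hcov p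
  exact TopologicalSpace.Opens.mem_iSup.mpr ⟨⟨U, hU⟩, hp⟩

/-- The open cover given by a set of opens. -/
def setCover (hcov : ∀ p : X, ∃ U ∈ I, p ∈ U) : X.OpenCover :=
  X.openCoverOfIsOpenCover (fun U : I => U.1) (isOpenCover_of I hcov)

variable {I}

instance (hcov : ∀ p : X, ∃ U ∈ I, p ∈ U) : Preorder (setCover I hcov).I₀ :=
  inferInstanceAs (Preorder I)

instance (hcov : ∀ p : X, ∃ U ∈ I, p ∈ U) : Small.{u} (setCover I hcov).I₀ :=
  inferInstanceAs (Small.{u} I)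

/-- The cover is locally directed. -/
@[reducible] def setCoverLD (hI : ∀ U ∈ I, ∀ V ≤ U, V ∈ I) (hcov : ∀ p : X, ∃ U ∈ I, p ∈ U) :
    (setCover I hcov).LocallyDirected := by
    refine Scheme.Cover.LocallyDirected.ofIsBasisOpensRange ?_ ?_
    · intro U V
      show _ ↔ (U.1.ι).opensRange ≤ (V.1.ι).opensRange
      rw [Scheme.Opens.opensRange_ι, Scheme.Opens.opensRange_ι]
      rfl
    · rw [TopologicalSpace.Opens.isBasis_iff_nbhd]
      intro W p hp
      obtain ⟨U, hU, hpU⟩ := hcov p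
      refine ⟨U ⊓ W, ⟨⟨U ⊓ W, hI U hU _ inf_le_left⟩, ?_⟩, ⟨hpU, hp⟩, inf_le_right⟩
      exact Scheme.Opens.opensRange_ι _

theorem glued_spec {S : Scheme.{u}} {𝒰 : S.OpenCover} [Category.{v} 𝒰.I₀] [𝒰.LocallyDirected]
    [Small.{u} 𝒰.I₀] [Quiver.IsThin 𝒰.I₀] (d : Scheme.Cover.RelativeGluingData 𝒰) :
    ∃ (P : Scheme.{u}) (p : P ⟶ S) (ι : ∀ U, d.functor.obj U ⟶ P),
      (∀ {U V : 𝒰.I₀} (h : U ⟶ V), d.functor.map h ≫ ι V = ι U) ∧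
      ∀ U : 𝒰.I₀, IsPullback (d.natTrans.app U) (ι U) (𝒰.f U) p :=
  ⟨d.glued, d.toBase, fun U => colimit.ι d.functor U, fun h => colimit.w d.functor h,
    fun U => d.isPullback_natTrans_ι_toBase U⟩

theorem rel_glue (hI : ∀ U ∈ I, ∀ V ≤ U, V ∈ I)
    (hcov : ∀ p : X, ∃ U ∈ I, p ∈ U) (Y : I → Scheme.{u}) (π : ∀ U : I, Y U ⟶ U.1.toScheme)
    (tr : ∀ {U V : I}, U.1 ≤ V.1 → (Y U ⟶ Y V)) (tr_id : ∀ U : I, tr (le_refl U.1) = 𝟙 (Y U))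
    (tr_comp : ∀ {U V W : I} (h : U.1 ≤ V.1) (h' : V.1 ≤ W.1), tr h ≫ tr h' = tr (h.trans h'))
    (pb : ∀ {U V : I} (h : U.1 ≤ V.1), IsPullback (tr h) (π U) (π V) (X.homOfLE h)) :
    ∃ (P : Scheme.{u}) (p : P ⟶ X) (ι : ∀ U, Y U ⟶ P),
      (∀ {U V : I} (h : U.1 ≤ V.1), tr h ≫ ι V = ι U) ∧
      ∀ U : I, IsPullback (π U) (ι U) U.1.ι p := by
  letI := setCoverLD hI hcov
  have htr : ∀ {U V : (setCover I hcov).I₀} (h : U ⟶ V),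
      (setCover I hcov).trans h = X.homOfLE (leOfHom h : U.1 ≤ V.1) := by
    intro U V h
    have e1 : (setCover I hcov).trans h ≫ V.1.ι = U.1.ι := (setCover I hcov).trans_map h
    exact (cancel_mono V.1.ι).mp (e1.trans
      (Scheme.homOfLE_ι X (leOfHom h : U.1 ≤ V.1)).symm)
  let F : (setCover I hcov).I₀ ⥤ Scheme.{u} :=
    { obj := Y
      map := fun {U V} h => tr (leOfHom h : U.1 ≤ V.1)
      map_id := fun U => tr_id U
      map_comp := fun h h' => (tr_comp _ _).symm }
  let N : F ⟶ (setCover I hcov).functorOfLocallyDirected :=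
    { app := π
      naturality := fun U V h => by
        refine (pb (leOfHom h : U.1 ≤ V.1)).w.trans ?_
        exact congrArg (fun z => π U ≫ z) (htr h).symm }
  let d : Scheme.Cover.RelativeGluingData (setCover I hcov) :=
    { functor := F
      natTrans := N
      equifibered := fun U V h => by
        have := pb (leOfHom h : U.1 ≤ V.1)
        rw [← htr h] at this
        exact this }
  obtain ⟨P, p, ι, hι, hP⟩ := glued_spec d
  exact ⟨P, p, ι, fun {U V} h => hι (homOfLE h : (U : (setCover I hcov).I₀) ⟶ V), hP⟩

end relglue

end WRN

namespace WRN

theorem isPullback_of_unique {A B C D : Scheme.{u}} {f : A ⟶ B} {g : A ⟶ C} {h : B ⟶ D} {k : C ⟶ D}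
    (w : f ≫ h = g ≫ k)
    (ex : ∀ {T : Scheme.{u}} (b : T ⟶ B) (c : T ⟶ C), b ≫ h = c ≫ k →
      ∃ a : T ⟶ A, a ≫ f = b ∧ a ≫ g = c)
    (uniq : ∀ {T : Scheme.{u}} (a a' : T ⟶ A), a ≫ f = a' ≫ f → a ≫ g = a' ≫ g → a = a') :
    IsPullback f g h k := by
  refine ⟨⟨w⟩, ⟨PullbackCone.IsLimit.mk w (fun s => (ex s.fst s.snd s.condition).choose)
    (fun s => (ex s.fst s.snd s.condition).choose_spec.1)
    (fun s => (ex s.fst s.snd s.condition).choose_spec.2) ?_⟩⟩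
  intro s m h1 h2
  exact uniq _ _ (h1.trans (ex s.fst s.snd s.condition).choose_spec.1.symm)
    (h2.trans (ex s.fst s.snd s.condition).choose_spec.2.symm)

universe w

/-- A sheaf of sets on test schemes over `X`. -/
structure PF (X : Scheme.{u}) where
  F : ∀ {T : Scheme.{u}} (_ : T ⟶ X), Type w
  res : ∀ {T' T : Scheme.{u}} (g : T' ⟶ T) {x : T ⟶ X} {y : T' ⟶ X} (_ : g ≫ x = y), F x → F y
  res_id : ∀ {T : Scheme.{u}} {x : T ⟶ X} (h : 𝟙 T ≫ x = x) (a : F x), res (𝟙 T) h a = a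
  res_res : ∀ {T'' T' T : Scheme.{u}} (t : T'' ⟶ T') (g : T' ⟶ T) {x : T ⟶ X} {y : T' ⟶ X}
    {z : T'' ⟶ X} (h : g ≫ x = y) (h' : t ≫ y = z) (h'' : (t ≫ g) ≫ x = z) (a : F x),
    res t h' (res g h a) = res (t ≫ g) h'' a
  sep : ∀ {T : Scheme.{u}} {x : T ⟶ X} (a b : F x),
    (∀ p : T, ∃ V : T.Opens, p ∈ V ∧ res V.ι (y := V.ι ≫ x) rfl a = res V.ι rfl b) → a = b
  glue : ∀ {T : Scheme.{u}} (x : T ⟶ X) {ι : Type u} (V : ι → T.Opens)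
    (_ : ∀ p : T, ∃ i, p ∈ V i) (a : ∀ i, F ((V i).ι ≫ x))
    (_ : ∀ (i j : ι) {S : Scheme.{u}} (s : S ⟶ (V i).toScheme) (t : S ⟶ (V j).toScheme)
      (y : S ⟶ X) (h : s ≫ (V i).ι ≫ x = y) (h' : t ≫ (V j).ι ≫ x = y),
      s ≫ (V i).ι = t ≫ (V j).ι → res s h (a i) = res t h' (a j)),
    ∃ b : F x, ∀ i, res (V i).ι rfl b = a i

namespace PF

variable {X : Scheme.{u}} (M : PF.{u, w} X)

theorem res_congr {T' T : Scheme.{u}} {g g' : T' ⟶ T} (hg : g = g') {x : T ⟶ X} {y : T' ⟶ X}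
    (h : g ≫ x = y) (h' : g' ≫ x = y) (a : M.F x) : M.res g h a = M.res g' h' a := by
  subst hg; rfl

/-- Local representing data. -/
structure Rep (U : X.Opens) where
  Y : Scheme.{u}
  π : Y ⟶ U.toScheme
  m : M.F (π ≫ U.ι)
  ex : ∀ {T : Scheme.{u}} (t : T ⟶ U.toScheme) {x : T ⟶ X} (_ : t ≫ U.ι = x) (a : M.F x),
    ∃ s : T ⟶ Y, ∃ h : s ≫ π ≫ U.ι = x, M.res s h m = a
  uniq : ∀ {T : Scheme.{u}} {x : T ⟶ X} (s s' : T ⟶ Y) (h : s ≫ π ≫ U.ι = x)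
    (h' : s' ≫ π ≫ U.ι = x), M.res s h m = M.res s' h' m → s = s'

theorem Rep.mono {M : PF.{u, w} X} {U V : X.Opens} (r : M.Rep U) (hVU : V ≤ U) :
    Nonempty (M.Rep V) := by
  have hc : pullback.fst r.π (X.homOfLE hVU) ≫ r.π ≫ U.ι =
      pullback.snd r.π (X.homOfLE hVU) ≫ V.ι := by
    rw [pullback.condition_assoc, Scheme.homOfLE_ι]
  refine ⟨⟨pullback r.π (X.homOfLE hVU), pullback.snd _ _,
    M.res (pullback.fst r.π (X.homOfLE hVU)) hc r.m, ?_, ?_⟩⟩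
  · intro T t x hx a
    obtain ⟨s, hs, e⟩ := r.ex (t ≫ X.homOfLE hVU) (by rw [Category.assoc, Scheme.homOfLE_ι, hx]) a
    have hst : s ≫ r.π = t ≫ X.homOfLE hVU := by
      rw [← cancel_mono U.ι, Category.assoc, hs, Category.assoc, Scheme.homOfLE_ι, hx]
    refine ⟨pullback.lift s t hst, by rw [pullback.lift_snd_assoc, hx], ?_⟩
    rw [M.res_res _ _ _ _ (by rw [pullback.lift_fst, hs]), ← e]
    exact M.res_congr (pullback.lift_fst _ _ _) _ _ _
  · intro T x s s' h h' e
    rw [M.res_res _ _ _ _ (by rw [Category.assoc, hc, h]),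
      M.res_res _ _ _ _ (by rw [Category.assoc, hc, h'])] at e
    refine pullback.hom_ext (r.uniq _ _ _ _ e) ?_
    rw [← cancel_mono V.ι, Category.assoc, Category.assoc, h, h']

theorem factor {T : Scheme.{u}} (x : T ⟶ X) {U W : X.Opens} (t : T ⟶ U.toScheme)
    (s : T ⟶ W.toScheme) (ht : t ≫ U.ι = x) (hs : s ≫ W.ι = x) :
    ∃ z : T ⟶ (U ⊓ W).toScheme, z ≫ (U ⊓ W).ι = x := by
  have : Set.range x ⊆ Set.range (U ⊓ W).ι := by
    rw [Scheme.Opens.range_ι]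
    rintro _ ⟨p, rfl⟩
    refine ⟨?_, ?_⟩
    · rw [← ht]; exact (t p).2
    · rw [← hs]; exact (s p).2
  exact ⟨IsOpenImmersion.lift (U ⊓ W).ι x this, IsOpenImmersion.lift_fac _ _ _⟩

theorem representable (hloc : ∀ p : X, ∃ U : X.Opens, p ∈ U ∧ Nonempty (M.Rep U)) :
    ∃ (P : Scheme.{u}) (p : P ⟶ X) (m : M.F p),
      (∀ {T : Scheme.{u}} {x : T ⟶ X} (a : M.F x), ∃ s : T ⟶ P, ∃ h : s ≫ p = x, M.res s h m = a) ∧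
      (∀ {T : Scheme.{u}} {x : T ⟶ X} (s s' : T ⟶ P) (h : s ≫ p = x) (h' : s' ≫ p = x),
        M.res s h m = M.res s' h' m → s = s') := by
  let I : Set X.Opens := {U | Nonempty (M.Rep U)}
  have hI : ∀ U ∈ I, ∀ V ≤ U, V ∈ I := fun U hU V hV => hU.some.mono hV
  have hcov : ∀ p : X, ∃ U ∈ I, p ∈ U := fun p => by
    obtain ⟨U, h, h'⟩ := hloc p
    exact ⟨U, h', h⟩
  let r : ∀ U : I, M.Rep U.1 := fun U => U.2.some
  have htr : ∀ {U V : I} (h : U.1 ≤ V.1), ∃ s : (r U).Y ⟶ (r V).Y,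
      ∃ e : s ≫ (r V).π ≫ V.1.ι = (r U).π ≫ U.1.ι, M.res s e (r V).m = (r U).m := by
    intro U V h
    exact (r V).ex ((r U).π ≫ X.homOfLE h) (by rw [Category.assoc, Scheme.homOfLE_ι]) (r U).m
  choose tr tr_π tr_m using @htr
  have hpb : ∀ {U V : I} (h : U.1 ≤ V.1),
      IsPullback (tr h) (r U).π (r V).π (X.homOfLE h) := by
    intro U V h
    have w : tr h ≫ (r V).π = (r U).π ≫ X.homOfLE h := by
      rw [← cancel_mono V.1.ι, Category.assoc, tr_π, Category.assoc, Scheme.homOfLE_ι]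
    refine isPullback_of_unique w ?_ ?_
    · intro T b c hbc
      have hb : b ≫ (r V).π ≫ V.1.ι = c ≫ U.1.ι := by
        rw [← Category.assoc, hbc, Category.assoc, Scheme.homOfLE_ι]
      obtain ⟨a, ha, e⟩ := (r U).ex c rfl (M.res b hb (r V).m)
      refine ⟨a, ?_, ?_⟩
      · refine (r V).uniq _ _ (x := c ≫ U.1.ι) (by rw [Category.assoc, tr_π, ha]) hb ?_
        rw [← e, ← tr_m h, M.res_res]
      · rw [← cancel_mono U.1.ι, Category.assoc, ha]
    · intro T a a' h1 h2
      refine (r U).uniq a a' (x := a ≫ (r U).π ≫ U.1.ι) rfl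
        (by rw [← Category.assoc, ← h2, Category.assoc]) ?_
      rw [← tr_m h, M.res_res _ _ _ _ (by rw [Category.assoc, tr_π]),
        M.res_res _ _ _ _ (by rw [← h1, Category.assoc, tr_π])]
      exact M.res_congr h1 _ _ _
  have htr_id : ∀ U : I, tr (le_refl U.1) = 𝟙 (r U).Y := by
    intro U
    refine (r U).uniq _ _ (x := (r U).π ≫ U.1.ι) (tr_π _) (Category.id_comp _) ?_
    rw [tr_m, M.res_id]
  have htr_comp : ∀ {U V W : I} (h : U.1 ≤ V.1) (h' : V.1 ≤ W.1),
      tr h ≫ tr h' = tr (h.trans h') := by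
    intro U V W h h'
    refine (r W).uniq _ _ (x := (r U).π ≫ U.1.ι)
      (by rw [Category.assoc, tr_π, tr_π]) (tr_π _) ?_
    rw [tr_m, ← M.res_res _ _ (tr_π h') (tr_π h), tr_m, tr_m]
  obtain ⟨P, p, ι, hι, hP⟩ := rel_glue hI hcov (fun U => (r U).Y) (fun U => (r U).π)
    (fun h => tr h) htr_id htr_comp hpb
  have hw : ∀ U : I, ι U ≫ p = (r U).π ≫ U.1.ι := fun U => (hP U).w.symm
  -- lifting to the pieces
  have hlift : ∀ (U : I) {S : Scheme.{u}} (s : S ⟶ P) (t : S ⟶ U.1.toScheme),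
      s ≫ p = t ≫ U.1.ι → ∃ l : S ⟶ (r U).Y, l ≫ ι U = s := fun U S s t h =>
    ⟨(hP U).lift t s h.symm, (hP U).lift_snd _ _ _⟩
  have hmono : ∀ (U : I) {S : Scheme.{u}} (l l' : S ⟶ (r U).Y), l ≫ ι U = l' ≫ ι U → l = l' := by
    intro U S l l' h
    refine (hP U).hom_ext ?_ h
    rw [← cancel_mono U.1.ι, Category.assoc, Category.assoc, ← hw, reassoc_of% h]
  have hcompat : ∀ (U W : I) {S : Scheme.{u}} (s : S ⟶ (r U).Y) (t : S ⟶ (r W).Y) (y : S ⟶ X)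
      (h : s ≫ (r U).π ≫ U.1.ι = y) (h' : t ≫ (r W).π ≫ W.1.ι = y), s ≫ ι U = t ≫ ι W →
      M.res s h (r U).m = M.res t h' (r W).m := by
    intro U W S s t y h h' e
    obtain ⟨z, hz⟩ := factor y (s ≫ (r U).π) (t ≫ (r W).π) (by rw [Category.assoc, h])
      (by rw [Category.assoc, h'])
    let Z : I := ⟨U.1 ⊓ W.1, hI U.1 U.2 _ inf_le_left⟩
    have hZU : Z.1 ≤ U.1 := inf_le_left
    have hZW : Z.1 ≤ W.1 := inf_le_right
    obtain ⟨l, hl⟩ := hlift Z (s ≫ ι U) z (by rw [Category.assoc, hw, h, hz])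
    have h1 : l ≫ tr hZU = s := hmono U _ _ (by rw [Category.assoc, hι, hl])
    have h2 : l ≫ tr hZW = t := hmono W _ _ (by rw [Category.assoc, hι, hl, e])
    subst h1
    subst h2
    rw [← M.res_res _ _ (tr_π hZU) (by rw [← h, Category.assoc, tr_π]),
      ← M.res_res _ _ (tr_π hZW) (by rw [← h', Category.assoc, tr_π]), tr_m, tr_m]
  have hV : ∀ {T : Scheme.{u}} (x : T ⟶ X) (q : T), ∃ U : I, q ∈ x ⁻¹ᵁ U.1 := by
    intro T x q
    obtain ⟨U, hU, hq⟩ := hcov (x q)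
    exact ⟨⟨U, hU⟩, hq⟩
  have hVf : ∀ {T : Scheme.{u}} (x : T ⟶ X) (U : X.Opens),
      (x ∣_ U) ≫ U.ι = (x ⁻¹ᵁ U).ι ≫ x := fun x U => morphismRestrict_ι x U
  -- the universal element
  have hl0 : ∀ U : I, ∃ l : (p ⁻¹ᵁ U.1).toScheme ⟶ (r U).Y, l ≫ ι U = (p ⁻¹ᵁ U.1).ι := fun U =>
    hlift U _ (p ∣_ U.1) (hVf p U.1).symm
  choose l0 hl0 using hl0
  have hl0' : ∀ U : I, l0 U ≫ (r U).π ≫ U.1.ι = (p ⁻¹ᵁ U.1).ι ≫ p := fun U => by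
    rw [← hw, reassoc_of% hl0]
  obtain ⟨m, hm⟩ := M.glue p (fun U : I => p ⁻¹ᵁ U.1) (hV p)
    (fun U => M.res (l0 U) (hl0' U) (r U).m) (by
      intro U W S s t y h h' e
      rw [M.res_res _ _ _ _ (by rw [Category.assoc, hl0', h]),
        M.res_res _ _ _ _ (by rw [Category.assoc, hl0', h'])]
      refine hcompat U W _ _ y _ _ ?_
      rw [Category.assoc, hl0, Category.assoc, hl0, e])
  have hm' : ∀ U : I, M.res (ι U) (hw U) m = (r U).m := by
    intro U
    have hr : Set.range (ι U) ⊆ Set.range (p ⁻¹ᵁ U.1).ι := by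
      rw [Scheme.Opens.range_ι]
      rintro _ ⟨q, rfl⟩
      show p (ι U q) ∈ U.1
      rw [← Scheme.Hom.comp_apply, hw]
      exact ((r U).π q).2
    have hj : IsOpenImmersion.lift (p ⁻¹ᵁ U.1).ι (ι U) hr ≫ (p ⁻¹ᵁ U.1).ι = ι U :=
      IsOpenImmersion.lift_fac _ _ _
    generalize IsOpenImmersion.lift (p ⁻¹ᵁ U.1).ι (ι U) hr = j at hj
    have hjl : j ≫ l0 U = 𝟙 _ := hmono U _ _ (by rw [Category.assoc, hl0, hj, Category.id_comp])
    rw [M.res_congr hj.symm (hw U) (by rw [hj, hw]),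
      ← M.res_res j (p ⁻¹ᵁ U.1).ι rfl (by rw [← Category.assoc, hj, hw]), hm,
      M.res_res _ _ _ _ (by rw [hjl, Category.id_comp]), M.res_congr hjl _ (Category.id_comp _),
      M.res_id]
  refine ⟨P, p, m, ?_, ?_⟩
  · intro T x a
    have hs : ∀ U : I, ∃ s : (x ⁻¹ᵁ U.1).toScheme ⟶ (r U).Y,
        ∃ h : s ≫ (r U).π ≫ U.1.ι = (x ⁻¹ᵁ U.1).ι ≫ x,
          M.res s h (r U).m = M.res (x ⁻¹ᵁ U.1).ι rfl a := fun U =>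
      (r U).ex (x ∣_ U.1) (hVf x U.1) _
    choose s hs hsm using hs
    obtain ⟨F, hF⟩ := glue_hom (fun U : I => x ⁻¹ᵁ U.1) (hV x) (fun U => s U ≫ ι U) (by
      intro U W S c d e
      obtain ⟨z, hz⟩ := factor (c ≫ (x ⁻¹ᵁ U.1).ι ≫ x) (c ≫ (x ∣_ U.1)) (d ≫ (x ∣_ W.1))
        (by rw [Category.assoc, hVf]) (by rw [Category.assoc, hVf, reassoc_of% e])
      let Z : I := ⟨U.1 ⊓ W.1, hI U.1 U.2 _ inf_le_left⟩
      have hZU : Z.1 ≤ U.1 := inf_le_left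
      have hZW : Z.1 ≤ W.1 := inf_le_right
      obtain ⟨l, hl, hlm⟩ := (r Z).ex z hz (M.res (c ≫ (x ⁻¹ᵁ U.1).ι) (Category.assoc _ _ _) a)
      have h1 : l ≫ tr hZU = c ≫ s U := by
        refine (r U).uniq _ _ (x := c ≫ (x ⁻¹ᵁ U.1).ι ≫ x) (by rw [Category.assoc, tr_π, hl])
          (by rw [Category.assoc, hs]) ?_
        rw [← M.res_res _ _ (tr_π hZU) hl, tr_m, hlm,
          ← M.res_res _ _ (hs U) rfl, hsm, M.res_res]
      have h2 : l ≫ tr hZW = d ≫ s W := by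
        refine (r W).uniq _ _ (x := c ≫ (x ⁻¹ᵁ U.1).ι ≫ x) (by rw [Category.assoc, tr_π, hl])
          (by rw [Category.assoc, hs, reassoc_of% e]) ?_
        rw [← M.res_res _ _ (tr_π hZW) hl, tr_m, hlm,
          ← M.res_res _ _ (hs W) (by rw [reassoc_of% e]), hsm,
          M.res_res _ _ _ _ (by rw [Category.assoc, reassoc_of% e])]
        exact M.res_congr e _ _ _
      rw [← Category.assoc, ← h1, ← Category.assoc, ← h2, Category.assoc, Category.assoc, hι, hι])
    have hFx : F ≫ p = x := by
      apply Scheme.hom_ext_of_forall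
      intro q
      obtain ⟨U, hq⟩ := hV x q
      exact ⟨_, hq, by rw [← Category.assoc, hF, Category.assoc, hw, hs]⟩
    refine ⟨F, hFx, M.sep _ _ fun q => ?_⟩
    obtain ⟨U, hq⟩ := hV x q
    refine ⟨_, hq, ?_⟩
    rw [M.res_res _ _ _ _ (by rw [Category.assoc, hFx]),
      M.res_congr (hF U) _ (by rw [Category.assoc, hw, hs]),
      ← M.res_res _ _ (hw U) (hs U), hm', hsm]
  · intro T x s s' h h' e
    apply Scheme.hom_ext_of_forall
    intro q
    obtain ⟨U, hq⟩ := hV x q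
    refine ⟨_, hq, ?_⟩
    obtain ⟨l, hl⟩ := hlift U ((x ⁻¹ᵁ U.1).ι ≫ s) (x ∣_ U.1) (by rw [Category.assoc, h, hVf])
    obtain ⟨l', hl'⟩ := hlift U ((x ⁻¹ᵁ U.1).ι ≫ s') (x ∣_ U.1) (by rw [Category.assoc, h', hVf])
    have hll : l = l' := by
      refine (r U).uniq l l' (x := (x ⁻¹ᵁ U.1).ι ≫ x)
        (by rw [← hw, reassoc_of% hl, h]) (by rw [← hw, reassoc_of% hl', h']) ?_
      rw [← hm', M.res_res _ _ _ _ (by rw [hl, Category.assoc, h]),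
        M.res_res _ _ _ _ (by rw [hl', Category.assoc, h']),
        M.res_congr hl _ (by rw [Category.assoc, h]), M.res_congr hl' _ (by rw [Category.assoc, h']),
        ← M.res_res _ _ h rfl, e, M.res_res]
    rw [← hl, ← hl', hll]

end PF

end WRN

namespace WRN

universe w

/-- A sheaf of modules on test schemes over `X`. -/
structure MF (X : Scheme.{u}) extends PF.{u, w} X where
  acm : ∀ {T : Scheme.{u}} (x : T ⟶ X), AddCommMonoid (F x)
  mod : ∀ {T : Scheme.{u}} (x : T ⟶ X), Module Γ(T, ⊤) (F x)
  res_add : ∀ {T' T : Scheme.{u}} (g : T' ⟶ T) {x : T ⟶ X} {y : T' ⟶ X} (h : g ≫ x = y)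
    (a b : F x), res g h (a + b) = res g h a + res g h b
  res_smul : ∀ {T' T : Scheme.{u}} (g : T' ⟶ T) {x : T ⟶ X} {y : T' ⟶ X} (h : g ≫ x = y)
    (c : Γ(T, ⊤)) (a : F x), res g h (c • a) = g.appTop c • res g h a

attribute [instance] MF.acm MF.mod

namespace MF

variable {X : Scheme.{u}} (M : MF.{u, w} X)

theorem res_zero {T' T : Scheme.{u}} (g : T' ⟶ T) {x : T ⟶ X} {y : T' ⟶ X} (h : g ≫ x = y) :
    M.res g h 0 = 0 := by
  have := M.res_smul g h 0 (0 : M.F x)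
  rwa [zero_smul, map_zero, zero_smul] at this

theorem res_sum {T' T : Scheme.{u}} (g : T' ⟶ T) {x : T ⟶ X} {y : T' ⟶ X} (h : g ≫ x = y)
    {ι : Type*} (s : Finset ι) (a : ι → M.F x) :
    M.res g h (∑ i ∈ s, a i) = ∑ i ∈ s, M.res g h (a i) := by
  classical
  induction s using Finset.induction_on with
  | empty => simp [res_zero]
  | insert i s hi ih => rw [Finset.sum_insert hi, Finset.sum_insert hi, M.res_add, ih]

/-- A universal basis. -/
def Bas {T : Scheme.{u}} {x : T ⟶ X} {n : ℕ} (v : Fin n → M.F x) : Prop :=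
  ∀ ⦃T' : Scheme.{u}⦄ (g : T' ⟶ T) ⦃y : T' ⟶ X⦄ (h : g ≫ x = y),
    Function.Bijective (fun f : Fin n → Γ(T', ⊤) => ∑ i, f i • M.res g h (v i))

/-- Global representing data. -/
structure GRep where
  P : Scheme.{u}
  p : P ⟶ X
  m : M.F p
  cl : ∀ {T : Scheme.{u}} {x : T ⟶ X} (_ : M.F x), T ⟶ P
  cl_p : ∀ {T : Scheme.{u}} {x : T ⟶ X} (a : M.F x), cl a ≫ p = x
  res_cl : ∀ {T : Scheme.{u}} {x : T ⟶ X} (a : M.F x), M.res (cl a) (cl_p a) m = a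
  uniq : ∀ {T : Scheme.{u}} {x : T ⟶ X} (s s' : T ⟶ P) (h : s ≫ p = x) (h' : s' ≫ p = x),
    M.res s h m = M.res s' h' m → s = s'

theorem exists_gRep {n : ℕ} (hloc : ∀ p : X, ∃ U : X.Opens, p ∈ U ∧
    ∃ v : Fin n → M.F U.ι, M.Bas v) : Nonempty M.GRep := by
  have : ∀ p : X, ∃ U : X.Opens, p ∈ U ∧ Nonempty (M.toPF.Rep U) := by
    intro p
    obtain ⟨U, hp, v, hv⟩ := hloc p
    refine ⟨U, hp, ⟨?_⟩⟩
    let A : Scheme.{u} := Spec (CommRingCat.of (MvPolynomial (ULift.{u} (Fin n)) (ULift.{u} ℤ)))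
    have key : ∀ {T : Scheme.{u}} (s : T ⟶ U.toScheme ⨯ A) {x : T ⟶ X} (h : s ≫ prod.fst ≫ U.ι = x),
        M.res s h (∑ i, homVec (prod.snd : U.toScheme ⨯ A ⟶ A) i •
          M.res (prod.fst : U.toScheme ⨯ A ⟶ _) rfl (v i)) =
        ∑ i, homVec (s ≫ prod.snd) i • M.res (s ≫ prod.fst) (by rw [Category.assoc, h]) (v i) := by
      intro T s x h
      rw [M.res_sum]
      refine Finset.sum_congr rfl fun i _ => ?_
      rw [M.res_smul, homVec_comp, M.res_res _ _ _ _ (by rw [Category.assoc, h])]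
    refine ⟨U.toScheme ⨯ A, prod.fst, ∑ i, homVec (prod.snd : U.toScheme ⨯ A ⟶ A) i •
      M.res (prod.fst : U.toScheme ⨯ A ⟶ _) rfl (v i), ?_, ?_⟩
    · intro T t x hx a
      obtain ⟨f, hf⟩ := (hv t hx).2 a
      refine ⟨prod.lift t (vecHom f), by rw [prod.lift_fst_assoc, hx], ?_⟩
      rw [key, ← hf]
      refine Finset.sum_congr rfl fun i _ => ?_
      rw [prod.lift_snd, homVec_vecHom]
      congr 1
      exact M.res_congr (prod.lift_fst _ _) _ _ _
    · intro T x s s' h h' e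
      rw [key, key] at e
      have h1 : s ≫ prod.fst = s' ≫ prod.fst := by
        rw [← cancel_mono U.ι, Category.assoc, Category.assoc, h, h']
      refine Limits.prod.hom_ext h1 ?_
      rw [← vecHom_homVec (s ≫ prod.snd), ← vecHom_homVec (s' ≫ prod.snd)]
      congr 1
      refine (hv (s ≫ prod.fst) (by rw [Category.assoc, h])).1 ?_
      refine e.trans ?_
      refine Finset.sum_congr rfl fun i _ => ?_
      congr 1
      exact M.res_congr h1.symm _ _ _
  obtain ⟨P, p, m, ex, uniq⟩ := M.toPF.representable this
  choose cl cl_p res_cl using @ex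
  exact ⟨⟨P, p, m, cl, cl_p, res_cl, uniq⟩⟩

namespace GRep

variable {M} (R : M.GRep)

/-- The element attached to a map. -/
def ev {T : Scheme.{u}} (s : T ⟶ R.P) {x : T ⟶ X} (h : s ≫ R.p = x) : M.F x := M.res s h R.m

theorem ev_cl {T : Scheme.{u}} {x : T ⟶ X} (a : M.F x) (h : R.cl a ≫ R.p = x) :
    R.ev (R.cl a) h = a := R.res_cl a

theorem ev_inj {T : Scheme.{u}} {x : T ⟶ X} {s s' : T ⟶ R.P} (h : s ≫ R.p = x)
    (h' : s' ≫ R.p = x) (e : R.ev s h = R.ev s' h') : s = s' := R.uniq s s' h h' e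

theorem cl_ev {T : Scheme.{u}} {x : T ⟶ X} (s : T ⟶ R.P) (h : s ≫ R.p = x) :
    R.cl (R.ev s h) = s := R.ev_inj (R.cl_p _) h (R.ev_cl _ _)

theorem ev_comp {T' T : Scheme.{u}} (g : T' ⟶ T) {x : T ⟶ X} {y : T' ⟶ X} (s : T ⟶ R.P)
    (h : s ≫ R.p = x) (h1 : g ≫ x = y) (h2 : (g ≫ s) ≫ R.p = y) :
    R.ev (g ≫ s) h2 = M.res g h1 (R.ev s h) := (M.res_res _ _ _ _ _ _).symm

theorem ev_congr {T : Scheme.{u}} {x : T ⟶ X} {s s' : T ⟶ R.P} (hs : s = s') (h : s ≫ R.p = x)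
    (h' : s' ≫ R.p = x) : R.ev s h = R.ev s' h' := by subst hs; rfl

theorem comp_cl {T' T : Scheme.{u}} (g : T' ⟶ T) {x : T ⟶ X} {y : T' ⟶ X} (a : M.F x)
    (h1 : g ≫ x = y) : g ≫ R.cl a = R.cl (M.res g h1 a) := by
  refine R.ev_inj (x := y) (by rw [Category.assoc, R.cl_p, h1]) (R.cl_p _) ?_
  rw [R.ev_cl, R.ev_comp g _ (R.cl_p a) h1, R.ev_cl]

theorem cl_congr {T : Scheme.{u}} {x x' : T ⟶ X} (hx : x = x') (a : M.F x) (b : M.F x')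
    (h : M.res (𝟙 T) (by rw [hx, Category.id_comp]) a = b) : R.cl a = R.cl b := by
  rw [← h, ← R.comp_cl (𝟙 T), Category.id_comp]

theorem ev_cl' {T : Scheme.{u}} {x x' : T ⟶ X} (a : M.F x) (h : R.cl a ≫ R.p = x') (hx : x = x') :
    R.ev (R.cl a) h = M.res (𝟙 T) (by rw [hx, Category.id_comp]) a := by
  subst hx; rw [M.res_id, ev_cl]

/-- Addition of points. -/
def padd {T : Scheme.{u}} (a b : T ⟶ R.P) (h : a ≫ R.p = b ≫ R.p) : T ⟶ R.P :=
  R.cl (R.ev a rfl + R.ev b h.symm)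

/-- Scalar multiplication of points. -/
def psmul {T : Scheme.{u}} (f : Γ(T, ⊤)) (a : T ⟶ R.P) : T ⟶ R.P := R.cl (f • R.ev a rfl)

theorem padd_p {T : Scheme.{u}} (a b : T ⟶ R.P) (h : a ≫ R.p = b ≫ R.p) :
    R.padd a b h ≫ R.p = a ≫ R.p := R.cl_p _

theorem psmul_p {T : Scheme.{u}} (f : Γ(T, ⊤)) (a : T ⟶ R.P) :
    R.psmul f a ≫ R.p = a ≫ R.p := R.cl_p _

theorem ev_padd {T : Scheme.{u}} (a b : T ⟶ R.P) (h : a ≫ R.p = b ≫ R.p) {x : T ⟶ X}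
    (hx : R.padd a b h ≫ R.p = x) :
    R.ev (R.padd a b h) hx = R.ev a ((R.padd_p a b h).symm.trans hx) +
      R.ev b (h.symm.trans ((R.padd_p a b h).symm.trans hx)) := by
  have := (R.padd_p a b h).symm.trans hx
  subst this
  exact R.ev_cl _ _

theorem ev_psmul {T : Scheme.{u}} (f : Γ(T, ⊤)) (a : T ⟶ R.P) {x : T ⟶ X}
    (hx : R.psmul f a ≫ R.p = x) :
    R.ev (R.psmul f a) hx = f • R.ev a ((R.psmul_p f a).symm.trans hx) := by
  have := (R.psmul_p f a).symm.trans hx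
  subst this
  exact R.ev_cl _ _

theorem ev_zero {T : Scheme.{u}} (x y : T ⟶ X) (hx : (y ≫ R.cl (x := 𝟙 X) 0) ≫ R.p = x) :
    R.ev (y ≫ R.cl (x := 𝟙 X) 0) hx = 0 := by
  rw [R.ev_comp y _ (R.cl_p _) (by rw [← hx, Category.assoc, R.cl_p]), R.ev_cl, M.res_zero]

theorem zero_p : R.cl (x := 𝟙 X) 0 ≫ R.p = 𝟙 X := R.cl_p _

/-- The bundle of a represented sheaf of modules. -/
def bundle : VecBundleData X where
  tot := R.P
  π := R.p
  zero := R.cl (x := 𝟙 X) 0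
  zero_π := R.cl_p _
  add := R.padd
  smul := R.psmul
  add_π := R.padd_p
  smul_π := R.psmul_p
  add_natural g a b h h' := by
    refine R.ev_inj (x := (g ≫ a) ≫ R.p)
      (by rw [Category.assoc, R.padd_p, Category.assoc]) (R.padd_p _ _ _) ?_
    rw [R.ev_padd, R.ev_comp g (R.padd a b h) rfl (by rw [R.padd_p, Category.assoc]), R.ev_padd,
      M.res_add, ← R.ev_comp, ← R.ev_comp]
  smul_natural g f a := by
    refine R.ev_inj (x := (g ≫ a) ≫ R.p)
      (by rw [Category.assoc, R.psmul_p, Category.assoc]) (R.psmul_p _ _) ?_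
    rw [R.ev_psmul, R.ev_comp g (R.psmul f a) rfl (by rw [R.psmul_p, Category.assoc]), R.ev_psmul,
      M.res_smul, ← R.ev_comp]
  add_comm a b h h' := by
    refine R.ev_inj (R.padd_p _ _ _) ((R.padd_p _ _ _).trans h.symm) ?_
    rw [R.ev_padd, R.ev_padd, _root_.add_comm]
  add_assoc a b c h₁ h₂ h₃ h₄ := by
    refine R.ev_inj ((R.padd_p _ _ _).trans (R.padd_p _ _ _)) (R.padd_p _ _ _) ?_
    rw [R.ev_padd, R.ev_padd, R.ev_padd, R.ev_padd, _root_.add_assoc]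
  zero_add a h := by
    refine R.ev_inj ((R.padd_p _ _ _).trans h) rfl ?_
    rw [R.ev_padd, R.ev_zero, _root_.zero_add]
  one_smul a := by
    refine R.ev_inj (R.psmul_p _ _) rfl ?_
    rw [R.ev_psmul, _root_.one_smul]
  mul_smul f g a := by
    refine R.ev_inj (R.psmul_p _ _) ((R.psmul_p _ _).trans (R.psmul_p _ _)) ?_
    rw [R.ev_psmul, R.ev_psmul, R.ev_psmul, SemigroupAction.mul_smul]
  smul_add f a b h h' := by
    refine R.ev_inj ((R.psmul_p _ _).trans (R.padd_p _ _ _))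
      ((R.padd_p _ _ _).trans (R.psmul_p _ _)) ?_
    rw [R.ev_psmul, R.ev_padd, R.ev_padd, R.ev_psmul, R.ev_psmul, _root_.smul_add]
  add_smul f g a h := by
    refine R.ev_inj (R.psmul_p _ _) ((R.padd_p _ _ _).trans (R.psmul_p _ _)) ?_
    rw [R.ev_psmul, R.ev_padd, R.ev_psmul, R.ev_psmul, _root_.add_smul]
  zero_smul a := by
    refine R.ev_inj (R.psmul_p _ _) (by rw [Category.assoc, R.zero_p, Category.comp_id]) ?_
    rw [R.ev_psmul, R.ev_zero, _root_.zero_smul]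
  smul_zero f x := by
    refine R.ev_inj (R.psmul_p _ _) rfl ?_
    rw [R.ev_psmul, R.ev_zero, _root_.smul_zero]

/-- Fibers of the bundle are the values of the sheaf. -/
def fibEquiv {T : Scheme.{u}} (x : T ⟶ X) : R.bundle.Fiber x ≃ₗ[Γ(T, ⊤)] M.F x where
  toFun a := R.ev a.1 a.2
  invFun a := ⟨R.cl a, R.cl_p a⟩
  left_inv a := Subtype.ext (R.cl_ev a.1 a.2)
  right_inv a := R.ev_cl a _
  map_add' a b := R.ev_padd a.1 b.1 (a.2.trans b.2.symm) (a + b).2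
  map_smul' c a := R.ev_psmul c a.1 (c • a).2

theorem fibEquiv_res {T' T : Scheme.{u}} (g : T' ⟶ T) {x : T ⟶ X} {y : T' ⟶ X} (h : g ≫ x = y)
    (a : R.bundle.Fiber x) : R.fibEquiv y (WRN.res R.bundle g h a) = M.res g h (R.fibEquiv x a) :=
  R.ev_comp g a.1 a.2 h _

end GRep

/-- A sheaf of modules with local bases is the sheaf of sections of a vector bundle. -/
theorem exists_bundle {n : ℕ} (hloc : ∀ p : X, ∃ U : X.Opens, p ∈ U ∧
    ∃ v : Fin n → M.F U.ι, M.Bas v) :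
    ∃ (E : VecBundle n X) (Φ : ∀ {T : Scheme.{u}} (x : T ⟶ X),
        E.toVecBundleData.Fiber x ≃ₗ[Γ(T, ⊤)] M.F x),
      ∀ {T' T : Scheme.{u}} (g : T' ⟶ T) {x : T ⟶ X} {y : T' ⟶ X} (h : g ≫ x = y)
        (a : E.toVecBundleData.Fiber x),
        Φ y (WRN.res E.toVecBundleData g h a) = M.res g h (Φ x a) := by
  obtain ⟨R⟩ := M.exists_gRep hloc
  refine ⟨⟨R.bundle, ?_⟩, fun x => R.fibEquiv x, fun {_ _} g {_ _} h a => R.fibEquiv_res g h a⟩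
  intro p
  obtain ⟨U, hp, v, hv⟩ := hloc p
  refine ⟨U, fun i => ((R.fibEquiv U.ι).symm (v i)).1, hp, fun i => ((R.fibEquiv U.ι).symm (v i)).2,
    ?_⟩
  intro T x
  have h1 := hv x rfl
  rw [← Function.Bijective.of_comp_iff' (R.fibEquiv (x ≫ U.ι)).bijective]
  convert h1 using 2 with f
  simp only [Function.comp, map_sum, map_smul]
  refine Finset.sum_congr rfl fun i _ => ?_
  congr 1
  refine (R.fibEquiv_res x rfl ((R.fibEquiv U.ι).symm (v i))).trans ?_
  rw [LinearEquiv.apply_symm_apply]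

end MF

end WRN

namespace WRN

theorem res_congr2 {X : Scheme.{u}} {E : VecBundleData X} {T' T : Scheme.{u}} {g g' : T' ⟶ T}
    (hg : g = g') {x : T ⟶ X} {y : T' ⟶ X}
    (h : g ≫ x = y) (h' : g' ≫ x = y) (a : E.Fiber x) : res E g h a = res E g' h' a := by
  subst hg; rfl

/-- The free sheaf of modules of rank `n`. -/
def freeMF (n : ℕ) (X : Scheme.{u}) : MF.{u, u} X where
  F {T} _ := Fin n → Γ(T, ⊤)
  res {_ _} g {_ _} _ a := fun i => g.appTop (a i)
  res_id {_ _} h a := by funext i; simp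
  res_res {_ _ _} t g {_ _ _} h h' h'' a := by funext i; exact (appTop_comp_apply _ _ _).symm
  sep {_ _} a b h := vec_ext a b fun p => by
    obtain ⟨V, hp, e⟩ := h p
    exact ⟨V, hp, fun i => congrFun e i⟩
  glue {T} x {ι} V hV a ha := by
    obtain ⟨b, hb⟩ := glue_vec V hV a (fun i j {S} s t e l =>
      congrFun (ha i j s t (s ≫ (V i).ι ≫ x) rfl (by rw [← Category.assoc, ← e, Category.assoc]) e) l)
    exact ⟨b, fun i => by funext l; exact hb i l⟩
  acm _ := inferInstance
  mod _ := inferInstance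
  res_add {_ _} g {_ _} h a b := by funext i; exact map_add _ _ _
  res_smul {_ _} g {_ _} h c a := by funext i; exact map_mul _ _ _

section push

variable {Y Y0 X : Scheme.{u}} (f : Y ⟶ X) (c : Y ⟶ Y0) (L : VecBundleData Y0)

/-- Sections of `L` over `T ×_X Y`. -/
def PushF {T : Scheme.{u}} (x : T ⟶ X) : Type u := L.Fiber (pullback.snd x f ≫ c)

instance {T : Scheme.{u}} (x : T ⟶ X) : AddCommMonoid (PushF f c L x) :=
  inferInstanceAs (AddCommMonoid (L.Fiber (pullback.snd x f ≫ c)))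

instance {T : Scheme.{u}} (x : T ⟶ X) : Module Γ(T, ⊤) (PushF f c L x) :=
  Module.compHom (L.Fiber (pullback.snd x f ≫ c)) (pullback.fst x f).appTop.hom

variable {f c L}

/-- Evaluation of a section at a point of `Y`. -/
def PushF.ev {T : Scheme.{u}} {x : T ⟶ X} (a : PushF f c L x) {S : Scheme.{u}} (t : S ⟶ T) (y : S ⟶ Y)
    (h : t ≫ x = y ≫ f) {z : S ⟶ Y0} (hz : y ≫ c = z) : L.Fiber z :=
  res L (pullback.lift t y h) (by rw [pullback.lift_snd_assoc, hz]) a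

theorem PushF.ev_add {T : Scheme.{u}} {x : T ⟶ X} (a b : PushF f c L x) {S : Scheme.{u}} (t : S ⟶ T)
    (y : S ⟶ Y) (h : t ≫ x = y ≫ f) {z : S ⟶ Y0} (hz : y ≫ c = z) :
    (a + b).ev t y h hz = a.ev t y h hz + b.ev t y h hz := WRN.res_add _ _ _ _

theorem PushF.ev_smul {T : Scheme.{u}} {x : T ⟶ X} (r : Γ(T, ⊤)) (a : PushF f c L x) {S : Scheme.{u}}
    (t : S ⟶ T) (y : S ⟶ Y) (h : t ≫ x = y ≫ f) {z : S ⟶ Y0} (hz : y ≫ c = z) :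
    (r • a).ev t y h hz = t.appTop r • a.ev t y h hz := by
  refine (WRN.res_smul _ _ ((pullback.fst x f).appTop r) a).trans ?_
  rw [← appTop_comp_apply, pullback.lift_fst]
  rfl

theorem PushF.res_ev {T : Scheme.{u}} {x : T ⟶ X} (a : PushF f c L x) {S' S : Scheme.{u}} (g : S' ⟶ S)
    (t : S ⟶ T) (y : S ⟶ Y) (h : t ≫ x = y ≫ f) {z : S ⟶ Y0} (hz : y ≫ c = z)
    {z' : S' ⟶ Y0} (hz' : g ≫ z = z') (h' : (g ≫ t) ≫ x = (g ≫ y) ≫ f) :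
    WRN.res L g hz' (a.ev t y h hz) =
      a.ev (g ≫ t) (g ≫ y) h' (by rw [Category.assoc, hz, hz']) := by
  refine (WRN.res_res _ _ _ _ _).trans ?_
  refine WRN.res_congr2 (pullback.hom_ext ?_ ?_) _ _ _
  · rw [Category.assoc, pullback.lift_fst, pullback.lift_fst]
  · rw [Category.assoc, pullback.lift_snd, pullback.lift_snd]

theorem PushF.ev_congr {T : Scheme.{u}} {x : T ⟶ X} (a : PushF f c L x) {S : Scheme.{u}}
    {t t' : S ⟶ T} {y y' : S ⟶ Y} (ht : t = t') (hy : y = y') (h : t ≫ x = y ≫ f)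
    (h' : t' ≫ x = y' ≫ f) {z : S ⟶ Y0} (hz : y ≫ c = z) (hz' : y' ≫ c = z) :
    a.ev t y h hz = a.ev t' y' h' hz' := by
  subst ht; subst hy; rfl

theorem PushF.ev_univ {T : Scheme.{u}} {x : T ⟶ X} (a : PushF f c L x) :
    a.ev (pullback.fst x f) (pullback.snd x f) pullback.condition rfl = a := by
  have : pullback.lift (pullback.fst x f) (pullback.snd x f) pullback.condition = 𝟙 _ := by
    ext <;> simp
  refine (WRN.res_congr2 this _ (by rw [Category.id_comp]) _).trans ?_
  exact WRN.res_id _ _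

theorem PushF.ext {T : Scheme.{u}} {x : T ⟶ X} {a b : PushF f c L x}
    (hab : ∀ {S : Scheme.{u}} (t : S ⟶ T) (y : S ⟶ Y) (h : t ≫ x = y ≫ f),
      a.ev t y h rfl = b.ev t y h rfl) : a = b := by
  rw [← a.ev_univ, ← b.ev_univ, hab]

/-- Restriction of sections. -/
def PushF.rs {T' T : Scheme.{u}} (g : T' ⟶ T) {x : T ⟶ X} {y : T' ⟶ X} (h : g ≫ x = y)
    (a : PushF f c L x) : PushF f c L y :=
  a.ev (pullback.fst y f ≫ g) (pullback.snd y f) (by rw [Category.assoc, h, pullback.condition]) rfl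

theorem PushF.ev_rs {T' T : Scheme.{u}} (g : T' ⟶ T) {x : T ⟶ X} {y : T' ⟶ X} (h : g ≫ x = y)
    (a : PushF f c L x) {S : Scheme.{u}} (t : S ⟶ T') (s : S ⟶ Y)
    (h1 : t ≫ y = s ≫ f) {z : S ⟶ Y0} (hz : s ≫ c = z) (h2 : (t ≫ g) ≫ x = s ≫ f) :
    (PushF.rs g h a).ev t s h1 hz = a.ev (t ≫ g) s h2 hz := by
  refine (PushF.res_ev a _ _ _ _ rfl _ ?_).trans (PushF.ev_congr a ?_ ?_ _ _ _ _)
  · simp only [Category.assoc, pullback.condition, h]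
  · rw [pullback.lift_fst_assoc]
  · rw [pullback.lift_snd]

variable (f c L) in
/-- The pushforward sheaf of modules. -/
def pushMF : MF.{u, u} X where
  F x := PushF f c L x
  res {_ _} g {_ _} h a := PushF.rs g h a
  res_id {_ _} h a := PushF.ext fun {_} t y h' => by
    rw [PushF.ev_rs _ _ _ _ _ _ _ (by rw [Category.assoc, h, h'])]
    exact PushF.ev_congr _ (Category.comp_id _) rfl _ _ _ _
  res_res {_ _ _} t g {_ _ _} h h' h'' a := PushF.ext fun {_} s y e => by
    rw [PushF.ev_rs _ _ _ _ _ _ _ (by rw [Category.assoc, h', e]),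
      PushF.ev_rs _ _ _ _ _ _ _ (by rw [Category.assoc, h, Category.assoc, h', e]),
      PushF.ev_rs _ _ _ _ _ _ _ (by rw [Category.assoc, h'', e])]
    exact PushF.ev_congr _ (Category.assoc _ _ _) rfl _ _ _ _
  sep {T x} a b h := by
    refine fib_ext (E := L) a b fun q => ?_
    obtain ⟨V, hp, e⟩ := h (pullback.fst x f q)
    refine ⟨(pullback.fst x f) ⁻¹ᵁ V, hp, ?_⟩
    have h0 : ((pullback.fst x f) ∣_ V) ≫ V.ι ≫ x =
        ((pullback.fst x f ⁻¹ᵁ V).ι ≫ pullback.snd x f) ≫ f := by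
      rw [← Category.assoc, morphismRestrict_ι, Category.assoc, Category.assoc, pullback.condition]
    have := congrArg (fun z : PushF f c L (V.ι ≫ x) => z.ev ((pullback.fst x f) ∣_ V)
      ((pullback.fst x f ⁻¹ᵁ V).ι ≫ pullback.snd x f) h0 (Category.assoc _ _ _)) e
    have h3 : (((pullback.fst x f) ∣_ V) ≫ V.ι) ≫ x =
        ((pullback.fst x f ⁻¹ᵁ V).ι ≫ pullback.snd x f) ≫ f := by rw [Category.assoc, h0]
    simp only [PushF.ev_rs _ _ _ _ _ _ _ h3] at this
    have key : pullback.lift (((pullback.fst x f) ∣_ V) ≫ V.ι)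
        ((pullback.fst x f ⁻¹ᵁ V).ι ≫ pullback.snd x f) h3 = (pullback.fst x f ⁻¹ᵁ V).ι := by
      ext1
      · rw [pullback.lift_fst, morphismRestrict_ι]
      · rw [pullback.lift_snd]
    refine (WRN.res_congr2 key.symm _ (by rw [key]) a).trans
      (this.trans (WRN.res_congr2 key _ _ b))
  glue {T} x {ι} V hV a ha := by
    have h0 : ∀ i, ((pullback.fst x f) ∣_ V i) ≫ (V i).ι ≫ x =
        ((pullback.fst x f ⁻¹ᵁ V i).ι ≫ pullback.snd x f) ≫ f := by
      intro i
      rw [← Category.assoc, morphismRestrict_ι, Category.assoc, Category.assoc, pullback.condition]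
    obtain ⟨b, hb⟩ := fib_glue (E := L) (pullback.snd x f ≫ c)
      (fun i => (pullback.fst x f) ⁻¹ᵁ V i) (fun q => hV (pullback.fst x f q))
      (fun i => (a i).ev ((pullback.fst x f) ∣_ V i)
        ((pullback.fst x f ⁻¹ᵁ V i).ι ≫ pullback.snd x f) (h0 i) (Category.assoc _ _ _))
      (by
        intro i j S s t e
        have e1 : (s ≫ (pullback.fst x f ∣_ V i)) ≫ (V i).ι =
            (t ≫ (pullback.fst x f ∣_ V j)) ≫ (V j).ι := by
          rw [Category.assoc, Category.assoc, morphismRestrict_ι, morphismRestrict_ι, reassoc_of% e]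
        have hS : (s ≫ (pullback.fst x f ∣_ V i)) ≫ (V i).ι ≫ x =
            (s ≫ (pullback.fst x f ⁻¹ᵁ V i).ι ≫ pullback.snd x f) ≫ f := by
          simp only [Category.assoc, h0]
        have hS' : (t ≫ (pullback.fst x f ∣_ V j)) ≫ (V j).ι ≫ x =
            (s ≫ (pullback.fst x f ⁻¹ᵁ V i).ι ≫ pullback.snd x f) ≫ f := by
          rw [Category.assoc, h0]; simp only [Category.assoc, reassoc_of% e]
        have := ha i j (s ≫ (pullback.fst x f ∣_ V i)) (t ≫ (pullback.fst x f ∣_ V j))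
          _ hS hS' (e1)
        have := congrArg (fun z : PushF f c L _ => z.ev (𝟙 S)
          (s ≫ (pullback.fst x f ⁻¹ᵁ V i).ι ≫ pullback.snd x f) (Category.id_comp _)
          (z := s ≫ (pullback.fst x f ⁻¹ᵁ V i).ι ≫ pullback.snd x f ≫ c)
          (by simp only [Category.assoc])) this
        replace this := (PushF.ev_rs _ _ _ _ _ _ _
          (show (𝟙 S ≫ s ≫ (pullback.fst x f ∣_ V i)) ≫ (V i).ι ≫ x = _ by
            rw [Category.id_comp, hS])).symm.trans (this.trans (PushF.ev_rs _ _ _ _ _ _ _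
          (show (𝟙 S ≫ t ≫ (pullback.fst x f ∣_ V j)) ≫ (V j).ι ≫ x = _ by
            rw [Category.id_comp, hS'])))
        refine (PushF.res_ev (a i) s _ _ _ _ _ (by rw [hS])).trans ?_
        refine Eq.trans ?_ (this.trans (Eq.trans ?_ (PushF.res_ev (a j) t _ _ _ _ _
          (by rw [hS', ← Category.assoc, ← Category.assoc, e])).symm))
        · exact PushF.ev_congr _ (Category.id_comp _).symm rfl _ _ _ _
        · exact PushF.ev_congr _ (Category.id_comp _)
            (by rw [← Category.assoc, ← Category.assoc, e]) _ _ _ _)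
    refine ⟨b, fun i => ?_⟩
    refine PushF.ext fun {S} t y h => ?_
    refine (PushF.ev_rs _ _ _ _ _ _ _ (by rw [Category.assoc, h])).trans ?_
    have hr : Set.range (pullback.lift (t ≫ (V i).ι) y (by rw [Category.assoc, h]) : S ⟶ pullback x f)
        ⊆ Set.range (pullback.fst x f ⁻¹ᵁ V i).ι := by
      rw [Scheme.Opens.range_ι]
      rintro _ ⟨q, rfl⟩
      show pullback.fst x f (_) ∈ V i
      rw [← Scheme.Hom.comp_apply, pullback.lift_fst]
      exact (t q).2
    have hl := IsOpenImmersion.lift_fac (pullback.fst x f ⁻¹ᵁ V i).ι _ hr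
    generalize IsOpenImmersion.lift (pullback.fst x f ⁻¹ᵁ V i).ι _ hr = l at hl
    have h1 : l ≫ (pullback.fst x f ∣_ V i) = t := by
      rw [← cancel_mono (V i).ι, Category.assoc, morphismRestrict_ι, ← Category.assoc, hl,
        pullback.lift_fst]
    have h2 : l ≫ (pullback.fst x f ⁻¹ᵁ V i).ι ≫ pullback.snd x f = y := by
      rw [← Category.assoc, hl, pullback.lift_snd]
    have h3 := congrArg (WRN.res L l (y := y ≫ c) (by
      rw [← h2]; simp only [Category.assoc])) (hb i)
    rw [WRN.res_res, PushF.res_ev (a i) _ _ _ _ _ _ (by rw [h1, h2, h])] at h3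
    · refine (WRN.res_congr2 hl.symm _ (by rw [hl, pullback.lift_snd_assoc]) b).trans (h3.trans ?_)
      exact PushF.ev_congr _ h1 h2 _ _ _ _
  acm _ := inferInstance
  mod _ := inferInstance
  res_add {_ _} g {_ _} h a b := PushF.ev_add _ _ _ _ _ _
  res_smul {_ _} g {_ _} h r a := PushF.ext fun {_} t y h' => by
    rw [PushF.ev_rs _ _ _ _ _ _ _ (by rw [Category.assoc, h, h']), PushF.ev_smul, PushF.ev_smul,
      PushF.ev_rs _ _ _ _ _ _ _ (by rw [Category.assoc, h, h']), appTop_comp_apply]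

end push

end WRN

namespace WRN

theorem MF.inj_local {X : Scheme.{u}} (M : MF.{u, u} X) {T : Scheme.{u}} {x : T ⟶ X} {n : ℕ}
    (v : Fin n → M.F x)
    (h : ∀ p : T, ∃ V : T.Opens, p ∈ V ∧ Function.Injective
      (fun f : Fin n → Γ(V.toScheme, ⊤) => ∑ i, f i • M.res V.ι (y := V.ι ≫ x) rfl (v i))) :
    Function.Injective (fun f : Fin n → Γ(T, ⊤) => ∑ i, f i • v i) := by
  intro c d hcd
  apply vec_ext
  intro p
  obtain ⟨V, hp, hV⟩ := h p
  refine ⟨V, hp, ?_⟩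
  have := congrArg (M.res V.ι (y := V.ι ≫ x) rfl) hcd
  simp only [M.res_sum, M.res_smul] at this
  exact congrFun (hV this)

theorem MF.bas_of_affine {X : Scheme.{u}} (M : MF.{u, u} X) {T : Scheme.{u}} {x : T ⟶ X} {n : ℕ}
    (v : Fin n → M.F x)
    (h : ∀ {T' : Scheme.{u}} [IsAffine T'] (g : T' ⟶ T) (y : T' ⟶ X) (h : g ≫ x = y),
      Function.Bijective (fun f : Fin n → Γ(T', ⊤) => ∑ i, f i • M.res g h (v i))) :
    M.Bas v := by
  have key : ∀ {T' : Scheme.{u}} (g : T' ⟶ T) {y : T' ⟶ X} (hy : g ≫ x = y) (p : T'),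
      ∃ W : T'.Opens, p ∈ W ∧ Function.Bijective (fun f : Fin n → Γ(W.toScheme, ⊤) =>
        ∑ i, f i • M.res W.ι (y := W.ι ≫ y) rfl (M.res g hy (v i))) := by
    intro T' g y hy p
    obtain ⟨W, hW, hp, -⟩ := exists_isAffineOpen_mem_and_subset (x := p) (U := ⊤) trivial
    have : IsAffine W.toScheme := hW
    refine ⟨W, hp, ?_⟩
    have h0 : (W.ι ≫ g) ≫ x = W.ι ≫ y := by rw [Category.assoc, hy]
    simp only [M.res_res _ _ _ _ h0]
    exact h (W.ι ≫ g) _ h0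
  have hinj : ∀ {T' : Scheme.{u}} (g : T' ⟶ T) {y : T' ⟶ X} (hy : g ≫ x = y),
      Function.Injective (fun f : Fin n → Γ(T', ⊤) => ∑ i, f i • M.res g hy (v i)) :=
    fun {_} g {y} hy => M.inj_local _ fun p => (key g hy p).imp fun W hW => ⟨hW.1, hW.2.1⟩
  intro T' g y hy
  refine ⟨hinj g hy, fun a => ?_⟩
  choose V hp hV using key g hy
  choose c hc using fun p => (hV p).2 (M.res (V p).ι rfl a)
  obtain ⟨C, hC⟩ := glue_vec V (fun p => ⟨p, hp p⟩) c (by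
    intro p q S s t hst l
    have hs : s ≫ (V p).ι ≫ y = s ≫ (V p).ι ≫ y := rfl
    have ht : t ≫ (V q).ι ≫ y = s ≫ (V p).ι ≫ y := by
      rw [← Category.assoc, ← hst, Category.assoc]
    have e1 := congrArg (M.res s hs) (hc p)
    have e2 := congrArg (M.res t ht) (hc q)
    have h1 : (s ≫ (V p).ι) ≫ y = s ≫ (V p).ι ≫ y := Category.assoc _ _ _
    have h2 : (t ≫ (V q).ι) ≫ y = s ≫ (V p).ι ≫ y := by rw [Category.assoc, ht]
    have h3 : ((s ≫ (V p).ι) ≫ g) ≫ x = s ≫ (V p).ι ≫ y := by rw [Category.assoc, hy, h1]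
    have h4 : ((t ≫ (V q).ι) ≫ g) ≫ x = s ≫ (V p).ι ≫ y := by rw [Category.assoc, hy, h2]
    rw [M.res_res _ _ _ _ h1] at e1
    rw [M.res_res _ _ _ _ h2] at e2
    simp only [M.res_sum, M.res_smul, M.res_res _ _ _ _ h1, M.res_res _ _ _ _ h3] at e1
    simp only [M.res_sum, M.res_smul, M.res_res _ _ _ _ h2, M.res_res _ _ _ _ h4] at e2
    have e3 := e1.trans ((M.res_congr hst _ _ _).trans e2.symm)
    simp only [← M.res_congr (show (s ≫ (V p).ι) ≫ g = (t ≫ (V q).ι) ≫ g by rw [hst]) h3 h4] at e3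
    exact congrFun (hinj _ h3 e3) l)
  refine ⟨C, M.sep _ _ fun p => ⟨V p, hp p, ?_⟩⟩
  rw [← hc p]
  simp only [M.res_sum, M.res_smul]
  refine Finset.sum_congr rfl fun l _ => ?_
  rw [hC p l]

theorem pushout_basis {R A B P : CommRingCat.{u}} {f : R ⟶ A} {g : R ⟶ B} {inl : A ⟶ P}
    {inr : B ⟶ P} (h : IsPushout f g inl inr) {n : ℕ} (b : Fin n → B)
    (hb : Function.Bijective (fun c : Fin n → R => ∑ i, g (c i) * b i)) :
    Function.Bijective (fun c : Fin n → A => ∑ i, inl (c i) * inr (b i)) := by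
  algebraize [f.hom, g.hom, inl.hom, inr.hom, (f ≫ inl).hom]
  have ht : IsScalarTower R A P := IsScalarTower.of_algebraMap_eq' rfl
  have ht2 : IsScalarTower R B P := IsScalarTower.of_algebraMap_eq' (by
    show (f ≫ inl).hom = (g ≫ inr).hom
    rw [h.w])
  have hp : Algebra.IsPushout R A B P := by
    rw [← CommRingCat.isPushout_iff_isPushout]
    exact h
  let e : (Fin n → R) ≃ₗ[R] B := LinearEquiv.ofBijective
    { toFun := fun c => ∑ i, g (c i) * b i
      map_add' := fun c d => by
        simp only [Pi.add_apply, map_add, add_mul, Finset.sum_add_distrib]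
      map_smul' := fun r c => by
        simp only [Pi.smul_apply, smul_eq_mul, map_mul, mul_assoc, ← Finset.mul_sum]
        rfl } hb
  let bas : Module.Basis (Fin n) R B := Module.Basis.ofEquivFun e.symm
  have hbas : ∀ i, bas i = b i := by
    intro i
    rw [Module.Basis.coe_ofEquivFun]
    show (∑ j, g ((Pi.single i 1 : Fin n → R) j) * b j) = b i
    rw [Finset.sum_eq_single i]
    · simp
    · intro j _ hj; simp [hj]
    · simp
  let B' := hp.out.basis bas
  have := B'.equivFun.symm.bijective
  refine (congrArg Function.Bijective ?_).mp this
  funext c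
  rw [Module.Basis.equivFun_symm_apply]
  refine Finset.sum_congr rfl fun i _ => ?_
  rw [IsBaseChange.basis_apply, hbas, Algebra.smul_def]
  rfl

/-- The distinguished basis of global functions on `Spec k'`. -/
def bk (k k' : Type u) [Field k] [Field k'] [Algebra k k'] [FiniteDimensional k k']
    (i : Fin (Module.finrank k k')) : Γ(Spk k', ⊤) :=
  (Scheme.ΓSpecIso (CommRingCat.of k')).inv (Module.finBasis k k' i)

theorem bk_bij (k k' : Type u) [Field k] [Field k'] [Algebra k k'] [FiniteDimensional k k'] :
    Function.Bijective (fun c : Fin (Module.finrank k k') → Γ(Spk k, ⊤) =>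
      ∑ i, (Spec.map (CommRingCat.ofHom (algebraMap k k'))).appTop (c i) * bk k k' i) := by
  have h1 := (Module.finBasis k k').equivFun.symm.bijective
  let e1 := (Scheme.ΓSpecIso (CommRingCat.of k)).commRingCatIsoToRingEquiv
  let e2 := (Scheme.ΓSpecIso (CommRingCat.of k')).symm.commRingCatIsoToRingEquiv
  have h2 : Function.Bijective (fun (c : Fin (Module.finrank k k') → Γ(Spk k, ⊤)) i => e1 (c i)) :=
    ⟨fun c d h => funext fun i => e1.injective (congrFun h i),
      fun d => ⟨fun i => e1.symm (d i), funext fun i => e1.apply_symm_apply _⟩⟩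
  refine (congrArg Function.Bijective ?_).mp (e2.bijective.comp (h1.comp h2))
  funext c
  simp only [Function.comp_apply, Module.Basis.equivFun_symm_apply, map_sum, Algebra.smul_def,
    map_mul]
  refine Finset.sum_congr rfl fun i _ => ?_
  congr 1
  have := Scheme.ΓSpecIso_naturality (CommRingCat.ofHom (algebraMap k k'))
  have := congrArg (fun q => q (c i)) this
  change (Scheme.ΓSpecIso (CommRingCat.of k')).inv (algebraMap k k' ((Scheme.ΓSpecIso (CommRingCat.of k)).hom (c i))) = _
  refine (congrArg (Scheme.ΓSpecIso (CommRingCat.of k')).inv this.symm).trans ?_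
  exact (Scheme.ΓSpecIso (CommRingCat.of k')).commRingCatIsoToRingEquiv.symm_apply_apply _

theorem PushF.smul_def {Y Y0 X : Scheme.{u}} {f : Y ⟶ X} {c : Y ⟶ Y0} {L : VecBundleData Y0}
    {T : Scheme.{u}} {x : T ⟶ X} (r : Γ(T, ⊤)) (a : PushF f c L x) :
    r • a = ((pullback.fst x f).appTop r •
      (show L.Fiber (pullback.snd x f ≫ c) from a) : L.Fiber (pullback.snd x f ≫ c)) := rfl

theorem pushMF_bas {k k' : Type u} [Field k] [Field k'] [Algebra k k'] [FiniteDimensional k k']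
    {Y Y0 X : Scheme.{u}} (f : Y ⟶ X) (q : Y ⟶ Spk k') (s : X ⟶ Spk k)
    (hf : IsPullback f q s (Spec.map (CommRingCat.ofHom (algebraMap k k'))))
    (c : Y ⟶ Y0) (L : VecBundleData Y0) {T : Scheme.{u}} (x : T ⟶ X)
    (σ : Fin 1 → L.Fiber (pullback.snd x f ≫ c)) (hσ : IsBas σ) :
    (pushMF f c L).Bas (x := x)
      (fun i => ((pullback.snd x f ≫ q).appTop (bk k k' i) • σ 0 : L.Fiber (pullback.snd x f ≫ c))) := by
  refine MF.bas_of_affine _ _ ?_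
  intro T' _ g y hy
  have hp : IsPullback (pullback.fst y f) (pullback.snd y f ≫ q) (y ≫ s)
      (Spec.map (CommRingCat.ofHom (algebraMap k k'))) :=
    IsPullback.paste_vert (IsPullback.of_hasPullback y f) hf
  have h1 := pushout_basis (isPushout_appTop_of_isPullback hp) (bk k k') (bk_bij k k')
  have h2 : (pullback.fst y f ≫ g) ≫ x = pullback.snd y f ≫ f := by
    rw [Category.assoc, hy, pullback.condition]
  have h3 := hσ.bij (pullback.lift (pullback.fst y f ≫ g) (pullback.snd y f) h2)
    (y := pullback.snd y f ≫ c) (by rw [pullback.lift_snd_assoc])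
  have h4 : Function.Bijective (fun (a : Γ(pullback y f, ⊤)) (_ : Fin 1) => a) :=
    ⟨fun a b h => congrFun h 0, fun d => ⟨d 0, funext fun i => by rw [Subsingleton.elim i 0]⟩⟩
  refine (congrArg Function.Bijective ?_).mp (h3.comp (h4.comp h1))
  funext d
  simp only [Function.comp_apply, comb, Fin.sum_univ_one, Finset.sum_smul]
  refine Finset.sum_congr rfl fun i _ => ?_
  rw [mul_smul]
  refine congrArg (fun z : L.Fiber (pullback.snd y f ≫ c) => (pullback.fst y f).appTop (d i) • z) ?_
  refine Eq.symm ((WRN.res_smul (pullback.lift _ _ h2) (by rw [pullback.lift_snd_assoc]) _ _).trans ?_)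
  rw [← appTop_comp_apply, pullback.lift_snd_assoc]

end WRN

namespace WRN

theorem loc_inj {Z : Scheme.{u}} [IsAffine Z] (r : Γ(Z, ⊤)) (D : Z.Opens) (hD : D = Z.basicOpen r)
    (a b : Γ(Z, ⊤)) (h : D.ι.appTop a = D.ι.appTop b) : ∃ N : ℕ, r ^ N * a = r ^ N * b := by
  have key : ∀ (W : Z.Opens), W = Z.basicOpen r →
      Z.presheaf.map (homOfLE (x := W) le_top).op a = Z.presheaf.map (homOfLE (x := W) le_top).op b →
      ∃ N : ℕ, r ^ N * a = r ^ N * b := by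
    intro W hW h
    subst hW
    have := (isAffineOpen_top Z).isLocalization_basicOpen r
    obtain ⟨⟨_, N, rfl⟩, hN⟩ := (IsLocalization.eq_iff_exists (Submonoid.powers r)
      Γ(Z, Z.basicOpen r)).1 (show algebraMap Γ(Z, ⊤) Γ(Z, Z.basicOpen r) a = algebraMap _ _ b from h)
    exact ⟨N, hN⟩
  exact key (D.ι ''ᵁ ⊤) (by rw [D.ι_image_top, hD]) h

theorem loc_surj {Z : Scheme.{u}} [IsAffine Z] (r : Γ(Z, ⊤)) (D : Z.Opens) (hD : D = Z.basicOpen r)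
    (c : Γ(D.toScheme, ⊤)) : ∃ (N : ℕ) (d : Γ(Z, ⊤)), D.ι.appTop d = D.ι.appTop (r ^ N) * c := by
  have key : ∀ (W : Z.Opens), W = Z.basicOpen r → ∀ c : Γ(Z, W), ∃ (N : ℕ) (d : Γ(Z, ⊤)),
      Z.presheaf.map (homOfLE (x := W) le_top).op d =
        Z.presheaf.map (homOfLE (x := W) le_top).op (r ^ N) * c := by
    intro W hW c
    subst hW
    have := (isAffineOpen_top Z).isLocalization_basicOpen r
    obtain ⟨⟨d, ⟨_, N, rfl⟩⟩, hN⟩ := IsLocalization.surj (Submonoid.powers r) c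
    exact ⟨N, d, by rw [mul_comm]; exact hN.symm⟩
  exact key (D.ι ''ᵁ ⊤) (by rw [D.ι_image_top, hD]) c

theorem unit_basicOpen {Z : Scheme.{u}} (r : Γ(Z, ⊤)) (D : Z.Opens) (hD : D = Z.basicOpen r) :
    IsUnit (D.ι.appTop r) := by
  have key : ∀ (W : Z.Opens), W = Z.basicOpen r →
      IsUnit (Z.presheaf.map (homOfLE (x := W) le_top).op r) := by
    intro W hW
    subst hW
    exact RingedSpace.isUnit_res_basicOpen _ r
  exact key (D.ι ''ᵁ ⊤) (by rw [D.ι_image_top, hD])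

theorem specField_unit {K : Type u} [Field K] (a : Γ(Spec (CommRingCat.of K), ⊤)) (ha : a ≠ 0) :
    IsUnit a := by
  let e := (Scheme.ΓSpecIso (CommRingCat.of K)).commRingCatIsoToRingEquiv
  have h1 : e a ≠ 0 := fun h => ha (e.injective (by rw [h, map_zero]))
  have h2 : IsUnit (e a) := isUnit_iff_ne_zero.2 h1
  simpa using h2.map e.symm

theorem res_residue_ne {Z : Scheme.{u}} (P : Z) (a : Γ(Z, ⊤)) :
    (Z.fromSpecResidueField P).appTop a ≠ 0 ↔ P ∈ Z.basicOpen a := by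
  have h0 : ∀ s : Spec (Z.residueField P), Z.fromSpecResidueField P s = P := fun s =>
    Z.fromSpecResidueField_apply P s
  obtain ⟨s⟩ : Nonempty (Spec (Z.residueField P)) := inferInstance
  constructor
  · intro h
    have := specField_unit (K := Z.residueField P) _ h
    replace this := Scheme.basicOpen_of_isUnit _ this
    rw [← Scheme.preimage_basicOpen_top] at this
    have h1 : s ∈ (Z.fromSpecResidueField P) ⁻¹ᵁ Z.basicOpen a := by rw [this]; trivial
    have h2 : Z.fromSpecResidueField P s ∈ Z.basicOpen a := h1
    rwa [h0] at h2
  · intro h e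
    have h1 : s ∈ (Z.fromSpecResidueField P) ⁻¹ᵁ Z.basicOpen a := by
      show Z.fromSpecResidueField P s ∈ Z.basicOpen a
      rwa [h0]
    rw [Scheme.preimage_basicOpen_top, e] at h1
    simp at h1

section ext

variable {Y0 : Scheme.{u}} (L : LineBundle Y0)

theorem frame_one {T : Scheme.{u}} {x : T ⟶ Y0} (v : Fin 1 → L.toVecBundleData.Fiber x) :
    v = fun _ => v 0 := funext fun i => by rw [Subsingleton.elim i 0]

/-- Finite affine framed cover. -/
theorem exists_framed_cover {Z : Scheme.{u}} [CompactSpace Z] (z : Z ⟶ Y0) :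
    ∃ (S : Finset Z) (V : Z → Z.Opens), (∀ p, IsAffineOpen (V p)) ∧
      (∀ q : Z, ∃ p ∈ S, q ∈ V p) ∧
      ∀ p, ∃ v : L.toVecBundleData.Fiber ((V p).ι ≫ z), IsBas (fun _ : Fin 1 => v) := by
  have : ∀ p : Z, ∃ V : Z.Opens, IsAffineOpen V ∧ p ∈ V ∧
      ∃ v : L.toVecBundleData.Fiber (V.ι ≫ z), IsBas (fun _ : Fin 1 => v) := by
    intro p
    obtain ⟨V, v, hp, hv⟩ := exists_isBas L z p
    obtain ⟨W, hW, hpW, hWV⟩ := exists_isAffineOpen_mem_and_subset hp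
    have hWV' : W ≤ V := hWV
    have h := hv.res (Z.homOfLE hWV') (y := W.ι ≫ z) (by rw [Scheme.homOfLE_ι_assoc])
    rw [frame_one L (fun i => res _ _ _ (v i))] at h
    exact ⟨W, hW, hpW, _, h⟩
  choose V hV hp hv using this
  obtain ⟨S, hS⟩ := isCompact_univ.elim_finite_subcover (fun p : Z => (V p : Set Z))
    (fun p => (V p).isOpen) (fun q _ => Set.mem_iUnion.2 ⟨q, hp q⟩)
  refine ⟨S, V, hV, fun q => ?_, hv⟩
  obtain ⟨p, hpS, hq⟩ := Set.mem_iUnion₂.1 (hS (Set.mem_univ q))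
  exact ⟨p, hpS, hq⟩

theorem fib_loc_inj {Z : Scheme.{u}} [IsAffine Z] (z : Z ⟶ Y0) (r : Γ(Z, ⊤)) (D : Z.Opens)
    (hD : D = Z.basicOpen r) (a b : L.toVecBundleData.Fiber z)
    (h : res L.toVecBundleData D.ι (y := D.ι ≫ z) rfl a = res L.toVecBundleData D.ι rfl b) :
    ∃ N : ℕ, r ^ N • a = r ^ N • b := by
  obtain ⟨S, V, hV, hcov, hv⟩ := exists_framed_cover L z
  choose v hv using hv
  have : ∀ p, ∃ N : ℕ, (V p).ι.appTop r ^ N • res L.toVecBundleData (V p).ι (y := (V p).ι ≫ z) rfl a =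
      (V p).ι.appTop r ^ N • res L.toVecBundleData (V p).ι rfl b := by
    intro p
    have : IsAffine (V p).toScheme := hV p
    obtain ⟨c, hc⟩ := (hv p).one_bij.2 (res L.toVecBundleData (V p).ι rfl a)
    obtain ⟨d, hd⟩ := (hv p).one_bij.2 (res L.toVecBundleData (V p).ι rfl b)
    have e : ((V p).ι ⁻¹ᵁ D).ι ≫ (V p).ι = ((V p).ι ∣_ D) ≫ D.ι := (morphismRestrict_ι _ _).symm
    obtain ⟨N, hN⟩ := loc_inj ((V p).ι.appTop r) ((V p).ι ⁻¹ᵁ D)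
      (by rw [hD, Scheme.preimage_basicOpen_top]) c d (by
        refine ((hv p).res ((V p).ι ⁻¹ᵁ D).ι (y := ((V p).ι ⁻¹ᵁ D).ι ≫ (V p).ι ≫ z) rfl).one_bij.1 ?_
        simp only [← WRN.res_smul]
        simp only at hc hd
        rw [hc, hd, WRN.res_res, WRN.res_res]
        have h' := congrArg (res L.toVecBundleData ((V p).ι ∣_ D)
          (y := ((V p).ι ⁻¹ᵁ D).ι ≫ (V p).ι ≫ z)
          (by rw [← Category.assoc, ← e, Category.assoc])) h
        rw [WRN.res_res, WRN.res_res] at h'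
        rw [WRN.res_congr e, WRN.res_congr e]
        exact h')
    refine ⟨N, ?_⟩
    rw [← hc, ← hd, smul_smul, smul_smul, hN]
  choose N hN using this
  refine ⟨S.sup N, fib_ext (E := L.toVecBundleData) _ _ fun q => ?_⟩
  obtain ⟨p, hpS, hq⟩ := hcov q
  refine ⟨V p, hq, ?_⟩
  rw [WRN.res_smul, WRN.res_smul, map_pow, ← Nat.sub_add_cancel (Finset.le_sup (f := N) hpS), pow_add,
    mul_smul, mul_smul, hN]

theorem fib_loc_surj {Z : Scheme.{u}} [IsAffine Z] (z : Z ⟶ Y0) (r : Γ(Z, ⊤)) (D : Z.Opens)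
    (hD : D = Z.basicOpen r) (s : L.toVecBundleData.Fiber (D.ι ≫ z)) :
    ∃ (N : ℕ) (τ : L.toVecBundleData.Fiber z), res L.toVecBundleData D.ι rfl τ =
      D.ι.appTop (r ^ N) • s := by
  obtain ⟨S, V, hV, hcov, hv⟩ := exists_framed_cover L z
  choose v hv using hv
  have e : ∀ p, ((V p).ι ⁻¹ᵁ D).ι ≫ (V p).ι = ((V p).ι ∣_ D) ≫ D.ι :=
    fun p => (morphismRestrict_ι _ _).symm
  have e' : ∀ p, ((V p).ι ∣_ D) ≫ D.ι ≫ z = ((V p).ι ⁻¹ᵁ D).ι ≫ (V p).ι ≫ z :=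
    fun p => by rw [← Category.assoc, ← e, Category.assoc]
  have h1 : ∀ p, ∃ (N : ℕ), ∀ M, N ≤ M → ∃ (τ : L.toVecBundleData.Fiber ((V p).ι ≫ z)),
      res L.toVecBundleData ((V p).ι ⁻¹ᵁ D).ι rfl τ =
        ((V p).ι ∣_ D).appTop (D.ι.appTop (r ^ M)) •
          res L.toVecBundleData ((V p).ι ∣_ D) (e' p) s := by
    intro p
    have : IsAffine (V p).toScheme := hV p
    have hb := ((hv p).res ((V p).ι ⁻¹ᵁ D).ι (y := ((V p).ι ⁻¹ᵁ D).ι ≫ (V p).ι ≫ z) rfl)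
    obtain ⟨c, hc⟩ := hb.one_bij.2 (res L.toVecBundleData ((V p).ι ∣_ D) (e' p) s)
    obtain ⟨N, d, hd⟩ := loc_surj ((V p).ι.appTop r) ((V p).ι ⁻¹ᵁ D)
      (by rw [hD, Scheme.preimage_basicOpen_top]) c
    refine ⟨N, fun M hM => ⟨((V p).ι.appTop r ^ (M - N) * d) • v p, ?_⟩⟩
    rw [WRN.res_smul, map_mul, hd, ← mul_assoc, ← map_mul, ← pow_add, Nat.sub_add_cancel hM, mul_smul]
    simp only at hc
    rw [hc, ← map_pow, ← appTop_comp_apply, ← appTop_comp_apply, e]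
  choose N0 h1 using h1
  choose τ hτ using fun p : S => h1 p (S.sup N0) (Finset.le_sup p.2)
  have key : ∀ (p : S) {W : Scheme.{u}} (j : W ⟶ (V p).toScheme) (d : W ⟶ D.toScheme)
      (hj : j ≫ (V p).ι = d ≫ D.ι)
      {y : W ⟶ Y0} (hy : j ≫ (V p).ι ≫ z = y) (hy' : d ≫ D.ι ≫ z = y),
      res L.toVecBundleData j hy (τ p) = d.appTop (D.ι.appTop (r ^ S.sup N0)) •
        res L.toVecBundleData d hy' s := by
    intro p W j d hj y hy hy'
    obtain ⟨l, hl⟩ : ∃ l : W ⟶ ((V p).ι ⁻¹ᵁ D).toScheme,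
        l ≫ ((V p).ι ⁻¹ᵁ D).ι = j := by
      refine ⟨IsOpenImmersion.lift ((V p).ι ⁻¹ᵁ D).ι j ?_, IsOpenImmersion.lift_fac _ _ _⟩
      rintro _ ⟨t, rfl⟩
      simp only [Scheme.Opens.range_ι]
      show (V p).ι (j t) ∈ D
      rw [← Scheme.Hom.comp_apply, hj, Scheme.Hom.comp_apply]
      exact (d t).2
    have hl2 : l ≫ ((V p).ι ∣_ D) = d := by
      rw [← cancel_mono D.ι, Category.assoc, ← e, ← Category.assoc, hl, hj]
    have h5 := congrArg (res L.toVecBundleData l (y := y) (by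
      rw [← hy, ← hl, Category.assoc])) (hτ p)
    rw [WRN.res_smul, WRN.res_res, WRN.res_res, ← appTop_comp_apply] at h5
    rw [WRN.res_congr2 hl.symm hy (by rw [hl]; exact hy), h5,
      WRN.res_congr2 hl2 _ hy', hl2]
  have h2 : ∀ p q : S, ∃ M : ℕ, ∀ M', M ≤ M' →
      res L.toVecBundleData (pullback.fst (V p).ι (V q).ι) (y := pullback.fst (V p).ι (V q).ι ≫ (V p).ι ≫ z)
        rfl ((V p).ι.appTop (r ^ M') • τ p) =
      res L.toVecBundleData (pullback.snd (V p).ι (V q).ι) (by rw [pullback.condition_assoc])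
        ((V q).ι.appTop (r ^ M') • τ q) := by
    intro p q
    have : IsAffine (V p).toScheme := hV p
    have : IsAffine (V q).toScheme := hV q
    set w := pullback.fst (V p).ι (V q).ι with hw
    set w' := pullback.snd (V p).ι (V q).ι with hw'
    have hcond : w ≫ (V p).ι = w' ≫ (V q).ι := pullback.condition
    let i := w ≫ (V p).ι
    let DD := i ⁻¹ᵁ D
    have hcz : w' ≫ (V q).ι ≫ z = w ≫ (V p).ι ≫ z := by
      rw [← Category.assoc, ← hcond, Category.assoc]
    obtain ⟨M, hM⟩ := fib_loc_inj L (w ≫ (V p).ι ≫ z) (i.appTop r) DD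
      (by rw [← Scheme.preimage_basicOpen_top, ← hD])
      (res L.toVecBundleData w rfl (τ p)) (res L.toVecBundleData w' hcz (τ q)) (by
        have f1 : (DD.ι ≫ w) ≫ (V p).ι = (i ∣_ D) ≫ D.ι := by
          rw [morphismRestrict_ι, Category.assoc]
        have f2 : (DD.ι ≫ w') ≫ (V q).ι = (i ∣_ D) ≫ D.ι := by
          rw [Category.assoc, ← hcond, morphismRestrict_ι]
        rw [WRN.res_res, WRN.res_res]
        rw [key p _ (i ∣_ D) f1 _ (by rw [← Category.assoc, ← f1]; simp only [Category.assoc]),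
          key q _ (i ∣_ D) f2])
    refine ⟨M, fun M' hM' => ?_⟩
    rw [WRN.res_smul, WRN.res_smul, ← appTop_comp_apply, ← appTop_comp_apply, ← hcond,
      ← Nat.sub_add_cancel hM', pow_add, map_mul, mul_smul, mul_smul, map_pow _ r M]
    exact congrArg _ hM
  choose M hM using h2
  let MM : ℕ := Finset.univ.sup fun pq : S × S => M pq.1 pq.2
  have hMM : ∀ p q, M p q ≤ MM := fun p q =>
    Finset.le_sup (f := fun pq : S × S => M pq.1 pq.2) (Finset.mem_univ (p, q))
  obtain ⟨t, ht⟩ := fib_glue (E := L.toVecBundleData) z (fun p : S => V p)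
    (fun q => by
      obtain ⟨p, hp, hq⟩ := hcov q
      exact ⟨⟨p, hp⟩, hq⟩) (fun p => (V p).ι.appTop (r ^ MM) • τ p) (by
      intro p q W f g h
      have h7 := congrArg (res L.toVecBundleData (pullback.lift f g h)
        (y := f ≫ (V p).ι ≫ z) (by rw [pullback.lift_fst_assoc])) (hM p q MM (hMM p q))
      rw [WRN.res_res, WRN.res_res] at h7
      rw [WRN.res_congr2 (pullback.lift_fst f g h).symm, WRN.res_congr2 (pullback.lift_snd f g h).symm]
      exact h7)
  refine ⟨MM + S.sup N0, t, fib_ext (E := L.toVecBundleData) _ _ fun q => ?_⟩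
  obtain ⟨p, hpS, hq⟩ := hcov (D.ι q)
  have e3 : (D.ι ⁻¹ᵁ V p).ι ≫ D.ι = (D.ι ∣_ V p) ≫ (V p).ι := (morphismRestrict_ι _ _).symm
  refine ⟨D.ι ⁻¹ᵁ V p, hq, ?_⟩
  have h8 := congrArg (res L.toVecBundleData (D.ι ∣_ V p) (y := (D.ι ⁻¹ᵁ V p).ι ≫ D.ι ≫ z)
    (by rw [← Category.assoc, ← e3, Category.assoc])) (ht ⟨p, hpS⟩)
  rw [WRN.res_res, WRN.res_smul, key ⟨p, hpS⟩ (D.ι ∣_ V p) (D.ι ⁻¹ᵁ V p).ι e3.symm _ rfl,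
    WRN.res_congr2 e3.symm _ (by rw [Category.assoc])] at h8
  rw [WRN.res_res, h8, WRN.res_smul, smul_smul, pow_add, ← appTop_comp_apply,
    ← appTop_comp_apply, ← appTop_comp_apply, ← e3, map_mul]

end ext

end WRN

namespace WRN

section ext2

variable {Y0 : Scheme.{u}} (L : LineBundle Y0)

/-- Value of a section at a point. -/
def vpt {Z : Scheme.{u}} {z : Z ⟶ Y0} (P : Z) (a : L.toVecBundleData.Fiber z) :
    L.toVecBundleData.Fiber (Z.fromSpecResidueField P ≫ z) :=
  res L.toVecBundleData (Z.fromSpecResidueField P) rfl a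

theorem bas_ne_zero {T : Scheme.{u}} [Nonempty T] {x : T ⟶ Y0} {e : L.toVecBundleData.Fiber x}
    (h : IsBas (fun _ : Fin 1 => e)) : e ≠ 0 := by
  intro h0
  have : (1 : Γ(T, ⊤)) = 0 := h.one_bij.1 (by simp [h0])
  obtain ⟨t0⟩ := ‹Nonempty T›
  have : Nonempty (⊤ : T.Opens) := ⟨⟨t0, trivial⟩⟩
  have : Nontrivial Γ(T, ⊤) := AlgebraicGeometry.Scheme.component_nontrivial T ⊤
  exact one_ne_zero ‹(1 : Γ(T, ⊤)) = 0›

theorem lift_pt {Z : Scheme.{u}} (P : Z) (D : Z.Opens) (hP : P ∈ D) :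
    ∃ l : Spec (Z.residueField P) ⟶ D.toScheme, l ≫ D.ι = Z.fromSpecResidueField P := by
  refine ⟨IsOpenImmersion.lift D.ι (Z.fromSpecResidueField P) ?_, IsOpenImmersion.lift_fac _ _ _⟩
  rw [Z.range_fromSpecResidueField]
  simpa using hP

theorem unit_smul_ne {T : Scheme.{u}} {x : T ⟶ Y0} {c : Γ(T, ⊤)} (hc : IsUnit c)
    {e : L.toVecBundleData.Fiber x} (he : e ≠ 0) : c • e ≠ 0 := by
  obtain ⟨u, rfl⟩ := hc
  intro h
  apply he
  have := congrArg (fun t => (↑u⁻¹ : Γ(T, ⊤)) • t) h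
  simpa [smul_smul] using this

theorem exists_section_pt {Z : Scheme.{u}} [IsAffine Z] (z : Z ⟶ Y0) (P : Z) :
    ∃ τ : L.toVecBundleData.Fiber z, vpt L P τ ≠ 0 := by
  obtain ⟨V, v, hp, hv⟩ := exists_isBas L z P
  obtain ⟨_, ⟨_, ⟨r, rfl⟩, rfl⟩, h₁, h₂⟩ :=
    (isBasis_basicOpen Z).exists_subset_of_mem_open (show P ∈ (V : Set Z) from hp) V.isOpen
  have h₂' : Z.basicOpen r ≤ V := h₂
  have hb := hv.res (Z.homOfLE h₂') (y := (Z.basicOpen r).ι ≫ z) (by rw [Scheme.homOfLE_ι_assoc])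
  rw [frame_one L (fun i => res _ _ _ (v i))] at hb
  obtain ⟨N, τ, hτ⟩ := fib_loc_surj L z r _ rfl
    (res L.toVecBundleData (Z.homOfLE h₂') (y := (Z.basicOpen r).ι ≫ z)
      (by rw [Scheme.homOfLE_ι_assoc]) (v 0))
  refine ⟨τ, ?_⟩
  obtain ⟨l, hl⟩ := lift_pt P (Z.basicOpen r) h₁
  have h3 := congrArg (res L.toVecBundleData l (y := Z.fromSpecResidueField P ≫ z)
    (by rw [← hl, Category.assoc])) hτ
  rw [WRN.res_res, WRN.res_congr2 hl _ rfl, WRN.res_smul] at h3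
  rw [vpt, h3]
  refine unit_smul_ne L ?_ ?_
  · rw [map_pow, map_pow]
    exact ((unit_basicOpen r _ rfl).map l.appTop.hom).pow N
  · exact bas_ne_zero L (hb.res l (y := Z.fromSpecResidueField P ≫ z) (by rw [← hl, Category.assoc]))

theorem exists_section_finset {Z : Scheme.{u}} [IsAffine Z] (z : Z ⟶ Y0) (F : Set Z)
    (hF : _root_.IsDiscrete F) (S : Finset Z) : (S : Set Z) ⊆ F →
    ∃ τ : L.toVecBundleData.Fiber z, ∀ P ∈ S, vpt L P τ ≠ 0 := by
  classical
  induction S using Finset.induction_on with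
  | empty => intro _; exact ⟨0, by simp⟩
  | insert P S hPS ih =>
    intro hS
    obtain ⟨σ, hσ⟩ := ih (fun q hq => hS (by simp [Finset.mem_coe.1 hq]))
    by_cases hP : vpt L P σ = 0
    · obtain ⟨τ, hτ⟩ := exists_section_pt L z P
      obtain ⟨U, hU, hUF⟩ := isDiscrete_iff_forall_mem_exists_isOpen.1 hF P (hS (by simp))
      have hPU : P ∈ U := by
        have : P ∈ U ∩ F := by rw [hUF]; rfl
        exact this.1
      obtain ⟨_, ⟨_, ⟨a, rfl⟩, rfl⟩, h₁, h₂⟩ :=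
        (isBasis_basicOpen Z).exists_subset_of_mem_open hPU hU
      refine ⟨σ + a • τ, fun Q hQ => ?_⟩
      rw [vpt, WRN.res_add, WRN.res_smul]
      rcases Finset.mem_insert.1 hQ with rfl | hQ'
      · change vpt L Q σ + _ ≠ 0
        rw [hP, zero_add]
        exact unit_smul_ne L (specField_unit (K := Z.residueField Q) _ ((res_residue_ne Q a).2 h₁)) hτ
      · have h4 : (Z.fromSpecResidueField Q).appTop a = 0 := by
          by_contra h5
          have h6 := h₂ ((res_residue_ne Q a).1 h5)
          have h7 : Q ∈ U ∩ F := ⟨h6, hS hQ⟩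
          rw [hUF] at h7
          exact hPS (by rw [← show Q = P from h7]; exact hQ')
        rw [h4, zero_smul, add_zero]
        exact hσ Q hQ'
    · refine ⟨σ, fun Q hQ => ?_⟩
      rcases Finset.mem_insert.1 hQ with rfl | hQ'
      · exact hP
      · exact hσ Q hQ'

theorem bas_of_vpt {Z : Scheme.{u}} {z : Z ⟶ Y0} (σ : L.toVecBundleData.Fiber z) (P : Z)
    (hP : vpt L P σ ≠ 0) : ∃ V : Z.Opens, P ∈ V ∧
      IsBas (fun _ : Fin 1 => res L.toVecBundleData V.ι (y := V.ι ≫ z) rfl σ) := by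
  obtain ⟨V, v, hp, hv⟩ := exists_isBas L z P
  rw [frame_one L v] at hv
  obtain ⟨c, hc⟩ := hv.one_bij.2 (res L.toVecBundleData V.ι rfl σ)
  simp only at hc
  let D : V.toScheme.Opens := V.toScheme.basicOpen c
  obtain ⟨l, hl⟩ := lift_pt P V hp
  have hPD : (⟨P, hp⟩ : V) ∈ D := by
    have h3 := congrArg (res L.toVecBundleData l (y := Z.fromSpecResidueField P ≫ z)
      (by rw [← hl, Category.assoc])) hc
    rw [WRN.res_res, WRN.res_congr2 hl _ rfl, WRN.res_smul] at h3
    have h4 : l.appTop c ≠ 0 := by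
      intro h0
      rw [h0, zero_smul] at h3
      exact hP h3.symm
    have h5 := Scheme.basicOpen_of_isUnit _ (specField_unit (K := Z.residueField P) _ h4)
    rw [← Scheme.preimage_basicOpen_top] at h5
    obtain ⟨s⟩ : Nonempty (Spec (Z.residueField P)) := inferInstance
    have h6 : s ∈ l ⁻¹ᵁ D := by rw [h5]; trivial
    have h7 : l s = (⟨P, hp⟩ : V) := by
      apply Subtype.ext
      have : V.ι (l s) = P := by
        rw [← Scheme.Hom.comp_apply, hl, Z.fromSpecResidueField_apply]
      exact this
    have h8 : l s ∈ D := h6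
    rwa [h7] at h8
  refine ⟨V.ι ''ᵁ D, ⟨⟨P, hp⟩, hPD, rfl⟩, ?_⟩
  obtain ⟨m, hm⟩ : ∃ m : (V.ι ''ᵁ D).toScheme ⟶ D.toScheme, m ≫ D.ι ≫ V.ι = (V.ι ''ᵁ D).ι := by
    refine ⟨IsOpenImmersion.lift (D.ι ≫ V.ι) (V.ι ''ᵁ D).ι ?_, IsOpenImmersion.lift_fac _ _ _⟩
    rintro _ ⟨t, rfl⟩
    obtain ⟨q, hq, hq'⟩ := t.2
    exact ⟨⟨q, hq⟩, hq'⟩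
  have hb := ((hv.res D.ι (y := D.ι ≫ V.ι ≫ z) rfl).one_smul_unit (unit_basicOpen c D rfl)).res m
    (y := (V.ι ''ᵁ D).ι ≫ z) (by rw [← hm]; simp only [Category.assoc])
  simp only [← WRN.res_smul, hc] at hb
  simp only [WRN.res_res] at hb
  convert hb using 2
  rw [WRN.res_congr2 hm.symm]

theorem exists_frame_finite {Z T : Scheme.{u}} [IsAffine Z] (f : Z ⟶ T) [IsFinite f]
    (z : Z ⟶ Y0) (p : T) : ∃ (U : T.Opens) (σ : L.toVecBundleData.Fiber z), p ∈ U ∧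
      ∀ P : Z, f P ∈ U → ∃ V : Z.Opens, P ∈ V ∧
        IsBas (fun _ : Fin 1 => res L.toVecBundleData V.ι (y := V.ι ≫ z) rfl σ) := by
  have hfin := f.finite_preimage_singleton p
  obtain ⟨σ, hσ⟩ := exists_section_finset L z (f ⁻¹' {p}) (f.isDiscrete_preimage_singleton p)
    hfin.toFinset (by simp)
  let O : Set Z := {P | ∃ V : Z.Opens, P ∈ V ∧
        IsBas (fun _ : Fin 1 => res L.toVecBundleData V.ι (y := V.ι ≫ z) rfl σ)}
  have hO : IsOpen O := by
    rw [isOpen_iff_forall_mem_open]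
    rintro P ⟨V, hP, hV⟩
    exact ⟨V, fun Q hQ => ⟨V, hQ, hV⟩, V.isOpen, hP⟩
  have hcl : IsClosed (f '' Oᶜ) := f.isClosedMap _ hO.isClosed_compl
  refine ⟨⟨(f '' Oᶜ)ᶜ, hcl.isOpen_compl⟩, σ, ?_, ?_⟩
  · rintro ⟨P, hP, hfP⟩
    exact hP (bas_of_vpt L σ P (hσ P (by simpa using hfP)))
  · intro P hP
    by_contra h
    exact hP ⟨P, h, rfl⟩

theorem exists_push_frame {X X1 : Scheme.{u}} (f : X1 ⟶ X) [IsFinite f] (c : X1 ⟶ Y0) (p : X) :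
    ∃ U : X.Opens, p ∈ U ∧ ∃ σ : Fin 1 → L.toVecBundleData.Fiber (pullback.snd U.ι f ≫ c),
      IsBas σ := by
  obtain ⟨U0, hU0, hp, -⟩ := exists_isAffineOpen_mem_and_subset (show p ∈ (⊤ : X.Opens) from trivial)
  have : IsAffine U0.toScheme := hU0
  have hfin : IsFinite (pullback.fst U0.ι f) := inferInstance
  have : IsAffine (pullback U0.ι f) := isAffine_of_isAffineHom (pullback.fst U0.ι f)
  obtain ⟨U, σ, hpU, hσ⟩ := exists_frame_finite L (pullback.fst U0.ι f)
    (pullback.snd U0.ι f ≫ c) (⟨p, hp⟩ : U0)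
  obtain ⟨m, hm⟩ : ∃ m : (U0.ι ''ᵁ U).toScheme ⟶ U0.toScheme, m ≫ U0.ι = (U0.ι ''ᵁ U).ι := by
    refine ⟨IsOpenImmersion.lift U0.ι (U0.ι ''ᵁ U).ι ?_, IsOpenImmersion.lift_fac _ _ _⟩
    rintro _ ⟨t, rfl⟩
    obtain ⟨q, hq, hq'⟩ := t.2
    exact ⟨q, hq'⟩
  have hmU : ∀ t, m t ∈ U := by
    intro t
    obtain ⟨q, hq, hq'⟩ := t.2
    have : m t = q := by
      apply U0.ι.isOpenEmbedding.injective
      rw [← Scheme.Hom.comp_apply, hm]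
      exact hq'.symm
    rw [this]; exact hq
  let M : pullback (U0.ι ''ᵁ U).ι f ⟶ pullback U0.ι f :=
    pullback.lift (pullback.fst _ _ ≫ m) (pullback.snd _ _) (by
      rw [Category.assoc, hm, pullback.condition])
  have hM1 : M ≫ pullback.fst _ _ = pullback.fst _ _ ≫ m := pullback.lift_fst _ _ _
  have hM2 : M ≫ pullback.snd _ _ = pullback.snd _ _ := pullback.lift_snd _ _ _
  refine ⟨U0.ι ''ᵁ U, ⟨⟨p, hp⟩, hpU, rfl⟩,
    fun _ => res L.toVecBundleData M (by rw [← Category.assoc, hM2]) σ, ?_⟩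
  refine isBas_of_local _ fun Q => ?_
  obtain ⟨V, hV, hb⟩ := hσ (M Q) (by
    rw [← Scheme.Hom.comp_apply, hM1, Scheme.Hom.comp_apply]; exact hmU _)
  refine ⟨M ⁻¹ᵁ V, hV, ?_⟩
  have e : (M ⁻¹ᵁ V).ι ≫ M = (M ∣_ V) ≫ V.ι := (morphismRestrict_ι _ _).symm
  have hb' := hb.res (M ∣_ V) (y := (M ⁻¹ᵁ V).ι ≫ pullback.snd (U0.ι ''ᵁ U).ι f ≫ c) (by
    rw [← Category.assoc, ← e, Category.assoc, ← hM2, Category.assoc])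
  simp only [WRN.res_res] at hb' ⊢
  convert hb' using 2
  exact WRN.res_congr2 e _ _ _

end ext2

end WRN

namespace WRN

theorem sec_ext {T : Scheme.{u}} (c d : Γ(T, ⊤))
    (h : ∀ p : T, ∃ V : T.Opens, p ∈ V ∧ V.ι.appTop c = V.ι.appTop d) : c = d := by
  have := vec_ext (n := 1) (fun _ => c) (fun _ => d) (fun p => by
    obtain ⟨V, hp, hV⟩ := h p
    exact ⟨V, hp, fun _ => hV⟩)
  exact congrFun this 0

section

variable {X : Scheme.{u}} {n : ℕ} (E : VecBundle n X)

/-- Determinant of a family in a universal basis. -/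
def cdet {T : Scheme.{u}} {x : T ⟶ X} {v : Fin n → E.toVecBundleData.Fiber x} (hv : IsBas v) :
    AlternatingMap Γ(T, ⊤) (E.toVecBundleData.Fiber x) Γ(T, ⊤) (Fin n) :=
  Matrix.detRowAlternating.compLinearMap hv.equiv.symm.toLinearMap

theorem cdet_self {T : Scheme.{u}} {x : T ⟶ X} {v : Fin n → E.toVecBundleData.Fiber x}
    (hv : IsBas v) : cdet E hv v = 1 := by
  have : (fun i => hv.equiv.symm (v i)) = (1 : Matrix (Fin n) (Fin n) Γ(T, ⊤)) := by
    funext i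
    rw [LinearEquiv.symm_apply_eq, hv.equiv_apply]
    simp [comb, Matrix.one_apply]
  show Matrix.det (fun i => hv.equiv.symm (v i)) = 1
  rw [this, Matrix.det_one]

theorem cdet_alt {T : Scheme.{u}} {x : T ⟶ X} {v : Fin n → E.toVecBundleData.Fiber x}
    (hv : IsBas v) {N : Type*} [AddCommMonoid N] [Module Γ(T, ⊤) N]
    (δ : AlternatingMap Γ(T, ⊤) (E.toVecBundleData.Fiber x) N (Fin n))
    (w : Fin n → E.toVecBundleData.Fiber x) : δ w = cdet E hv w • δ v := by
  have h := alt_comb δ v (fun i => hv.equiv.symm (w i))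
  have e : (fun i => ∑ j, hv.equiv.symm (w i) j • v j) = w := funext fun i => hv.comb_symm (w i)
  rw [e] at h
  exact h

theorem cdet_res {T' T : Scheme.{u}} (g : T' ⟶ T) {x : T ⟶ X} {y : T' ⟶ X} (h : g ≫ x = y)
    {v : Fin n → E.toVecBundleData.Fiber x} (hv : IsBas v)
    {v' : Fin n → E.toVecBundleData.Fiber y} (hv' : IsBas v')
    (e : v' = fun i => res E.toVecBundleData g h (v i)) (w : Fin n → E.toVecBundleData.Fiber x) :
    g.appTop (cdet E hv w) = cdet E hv' (fun i => res E.toVecBundleData g h (w i)) := by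
  subst e
  refine (RingHom.map_det g.appTop.hom (Matrix.of fun i => hv.equiv.symm (w i))).trans ?_
  refine congrArg Matrix.det (?_ : _ = Matrix.of fun i => hv'.equiv.symm
    (res E.toVecBundleData g h (w i)))
  funext i
  show _ = hv'.equiv.symm _
  rw [eq_comm, LinearEquiv.symm_apply_eq, hv'.equiv_apply]
  conv_lhs => rw [← hv.comb_symm (w i)]
  rw [res_comb]
  rfl

/-- Families of functions on bases transforming through the determinant. -/
@[ext]
structure DF {T : Scheme.{u}} (x : T ⟶ X) where
  val : ∀ (S : Scheme.{u}) (g : S ⟶ T) (y : S ⟶ X) (_ : g ≫ x = y)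
    (v : Fin n → E.toVecBundleData.Fiber y) (_ : IsBas v), Γ(S, ⊤)
  nat : ∀ {S' S : Scheme.{u}} (t : S' ⟶ S) (g : S ⟶ T) (g' : S' ⟶ T) (_ : t ≫ g = g')
    (y : S ⟶ X) (y' : S' ⟶ X) (h : g ≫ x = y) (h' : g' ≫ x = y') (ht : t ≫ y = y')
    (v : Fin n → E.toVecBundleData.Fiber y) (hv : IsBas v),
    t.appTop (val S g y h v hv) = val S' g' y' h' (fun i => res E.toVecBundleData t ht (v i))
      (hv.res t ht)
  ch : ∀ {S : Scheme.{u}} (g : S ⟶ T) (y : S ⟶ X) (h : g ≫ x = y)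
    (v : Fin n → E.toVecBundleData.Fiber y) (hv : IsBas v)
    (w : Fin n → E.toVecBundleData.Fiber y) (hw : IsBas w),
    val S g y h v hv = cdet E hv w * val S g y h w hw

namespace DF

variable {E}

theorem val_congr {T : Scheme.{u}} {x : T ⟶ X} (φ : DF E x) {S : Scheme.{u}} {g g' : S ⟶ T}
    (hg : g = g') {y : S ⟶ X} (h : g ≫ x = y) (h' : g' ≫ x = y)
    {v v' : Fin n → E.toVecBundleData.Fiber y} (e : v = v') (hv : IsBas v) (hv' : IsBas v') :
    φ.val S g y h v hv = φ.val S g' y h' v' hv' := by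
  subst hg; subst e; rfl

instance {T : Scheme.{u}} (x : T ⟶ X) : Add (DF E x) :=
  ⟨fun a b => ⟨fun S g y h v hv => a.val S g y h v hv + b.val S g y h v hv,
    fun {_ _} t g g' e y y' h h' ht v hv => by
      rw [map_add, a.nat t g g' e y y' h h' ht v hv, b.nat t g g' e y y' h h' ht v hv],
    fun {_} g y h v hv w hw => by rw [a.ch g y h v hv w hw, b.ch g y h v hv w hw, mul_add]⟩⟩

instance {T : Scheme.{u}} (x : T ⟶ X) : Zero (DF E x) :=
  ⟨⟨fun S g y h v hv => 0,
    fun {_ _} t g g' e y y' h h' ht v hv => by rw [map_zero],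
    fun {_} g y h v hv w hw => by rw [mul_zero]⟩⟩

instance {T : Scheme.{u}} (x : T ⟶ X) : SMul Γ(T, ⊤) (DF E x) :=
  ⟨fun c a => ⟨fun S g y h v hv => g.appTop c * a.val S g y h v hv,
    fun {_ _} t g g' e y y' h h' ht v hv => by
      rw [map_mul, a.nat t g g' e y y' h h' ht v hv, ← appTop_comp_apply, e],
    fun {_} g y h v hv w hw => by rw [a.ch g y h v hv w hw]; ring⟩⟩

theorem add_val {T : Scheme.{u}} {x : T ⟶ X} (a b : DF E x) (S g y h v hv) :
    (a + b).val S g y h v hv = a.val S g y h v hv + b.val S g y h v hv := rfl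

theorem zero_val {T : Scheme.{u}} {x : T ⟶ X} (S g y h v hv) :
    (0 : DF E x).val S g y h v hv = 0 := rfl

theorem smul_val {T : Scheme.{u}} {x : T ⟶ X} (c : Γ(T, ⊤)) (a : DF E x) (S g y h v hv) :
    (c • a).val S g y h v hv = g.appTop c * a.val S g y h v hv := rfl

theorem ext_val {T : Scheme.{u}} {x : T ⟶ X} {a b : DF E x}
    (h : ∀ S g y h v hv, a.val S g y h v hv = b.val S g y h v hv) : a = b := by
  ext1
  funext S g y h' v hv
  exact h S g y h' v hv

instance {T : Scheme.{u}} (x : T ⟶ X) : AddCommMonoid (DF E x) where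
  add_assoc a b c := ext_val fun S g y h v hv => by simp only [add_val]; ring
  zero_add a := ext_val fun S g y h v hv => by simp only [add_val, zero_val]; ring
  add_zero a := ext_val fun S g y h v hv => by simp only [add_val, zero_val]; ring
  add_comm a b := ext_val fun S g y h v hv => by simp only [add_val]; ring
  nsmul := nsmulRec

instance {T : Scheme.{u}} (x : T ⟶ X) : Module Γ(T, ⊤) (DF E x) where
  one_smul a := ext_val fun S g y h v hv => by simp only [smul_val, map_one, one_mul]
  mul_smul c d a := ext_val fun S g y h v hv => by simp only [smul_val, map_mul, mul_assoc]
  smul_zero c := ext_val fun S g y h v hv => by simp only [smul_val, zero_val, mul_zero]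
  smul_add c a b := ext_val fun S g y h v hv => by simp only [smul_val, add_val, mul_add]
  add_smul c d a := ext_val fun S g y h v hv => by simp only [smul_val, add_val, map_add, add_mul]
  zero_smul a := ext_val fun S g y h v hv => by simp only [smul_val, zero_val, map_zero, zero_mul]

/-- Restriction. -/
def rs {T' T : Scheme.{u}} (g : T' ⟶ T) {x : T ⟶ X} {y : T' ⟶ X} (h : g ≫ x = y) (a : DF E x) :
    DF E y where
  val S t z h' v hv := a.val S (t ≫ g) z (by rw [Category.assoc, h, h']) v hv
  nat {_ _} t s s' e z z' h' h'' ht v hv := a.nat _ _ _ (by rw [← e, Category.assoc]) _ _ _ _ _ _ _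
  ch {_} t z h' v hv w hw := a.ch _ _ _ _ _ _ _

theorem rs_val {T' T : Scheme.{u}} (g : T' ⟶ T) {x : T ⟶ X} {y : T' ⟶ X} (h : g ≫ x = y)
    (a : DF E x) (S t z h' v hv) (h'') :
    (rs g h a).val S t z h' v hv = a.val S (t ≫ g) z h'' v hv := rfl

theorem sep {T : Scheme.{u}} {x : T ⟶ X} (a b : DF E x)
    (H : ∀ p : T, ∃ V : T.Opens, p ∈ V ∧ rs V.ι (y := V.ι ≫ x) rfl a = rs V.ι rfl b) : a = b := by
  apply ext_val
  intro S g y h v hv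
  apply sec_ext
  intro p
  obtain ⟨V, hp, hV⟩ := H (g p)
  refine ⟨g ⁻¹ᵁ V, hp, ?_⟩
  have e : (g ⁻¹ᵁ V).ι ≫ g = (g ∣_ V) ≫ V.ι := (morphismRestrict_ι _ _).symm
  have e2 : (g ∣_ V) ≫ V.ι ≫ x = (g ⁻¹ᵁ V).ι ≫ y := by
    rw [← Category.assoc, ← e, Category.assoc, h]
  have := congrArg (fun c => c.val _ (g ∣_ V) ((g ⁻¹ᵁ V).ι ≫ y) e2 _ (hv.res (g ⁻¹ᵁ V).ι rfl)) hV
  rw [a.nat _ _ _ e _ ((g ⁻¹ᵁ V).ι ≫ y) _ (by rw [Category.assoc, e2]) rfl,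
    b.nat _ _ _ e _ ((g ⁻¹ᵁ V).ι ≫ y) _ (by rw [Category.assoc, e2]) rfl]
  exact this

theorem glue {T : Scheme.{u}} (x : T ⟶ X) {ι : Type u} (V : ι → T.Opens)
    (hV : ∀ p : T, ∃ i, p ∈ V i) (a : ∀ i, DF E ((V i).ι ≫ x))
    (ha : ∀ (i j : ι) {S : Scheme.{u}} (s : S ⟶ (V i).toScheme) (t : S ⟶ (V j).toScheme)
      (y : S ⟶ X) (h : s ≫ (V i).ι ≫ x = y) (h' : t ≫ (V j).ι ≫ x = y),
      s ≫ (V i).ι = t ≫ (V j).ι → rs s h (a i) = rs t h' (a j)) :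
    ∃ b : DF E x, ∀ i, rs (V i).ι rfl b = a i := by
  have eg : ∀ {S : Scheme.{u}} (g : S ⟶ T) (i : ι),
      (g ∣_ V i) ≫ (V i).ι = (g ⁻¹ᵁ V i).ι ≫ g := fun g i => morphismRestrict_ι _ _
  have ey : ∀ {S : Scheme.{u}} (g : S ⟶ T) (y : S ⟶ X) (h : g ≫ x = y) (i : ι),
      (g ∣_ V i) ≫ (V i).ι ≫ x = (g ⁻¹ᵁ V i).ι ≫ y := fun g y h i => by
    rw [← Category.assoc, eg, Category.assoc, h]
  have ha' : ∀ (i j : ι) {S : Scheme.{u}} (s : S ⟶ (V i).toScheme) (t : S ⟶ (V j).toScheme)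
      (y : S ⟶ X) (h : s ≫ (V i).ι ≫ x = y) (h' : t ≫ (V j).ι ≫ x = y) (_ : s ≫ (V i).ι = t ≫ (V j).ι)
      (v) (hv : IsBas v), (a i).val S s y h v hv = (a j).val S t y h' v hv := by
    intro i j S s t y h h' e v hv
    have := congrArg (fun c => c.val S (𝟙 S) y (Category.id_comp _) v hv) (ha i j s t y h h' e)
    simp only [rs] at this
    rw [(a i).val_congr (Category.id_comp s).symm h (by rw [Category.id_comp, h]) rfl hv hv,
      (a j).val_congr (Category.id_comp t).symm h' (by rw [Category.id_comp, h']) rfl hv hv]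
    exact this
  have ex : ∀ (S : Scheme.{u}) (g : S ⟶ T) (y : S ⟶ X) (h : g ≫ x = y)
    (v : Fin n → E.toVecBundleData.Fiber y) (hv : IsBas v), ∃ c : Γ(S, ⊤), ∀ i,
      (g ⁻¹ᵁ V i).ι.appTop c = (a i).val _ (g ∣_ V i) ((g ⁻¹ᵁ V i).ι ≫ y) (ey g y h i) _
        (hv.res (g ⁻¹ᵁ V i).ι rfl) := by
    intro S g y h v hv
    obtain ⟨C, hC⟩ := glue_vec (n := 1) (fun i => g ⁻¹ᵁ V i) (fun p => hV (g p))
      (fun i _ => (a i).val _ (g ∣_ V i) ((g ⁻¹ᵁ V i).ι ≫ y) (ey g y h i) _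
        (hv.res (g ⁻¹ᵁ V i).ι rfl)) (by
        intro i j W s t e _
        have e1 : t ≫ (g ⁻¹ᵁ V j).ι ≫ y = s ≫ (g ⁻¹ᵁ V i).ι ≫ y := by
          rw [← Category.assoc, ← e, Category.assoc]
        rw [(a i).nat s _ _ rfl _ _ _ (by rw [Category.assoc, ey g y h]) rfl,
          (a j).nat t _ _ rfl _ (s ≫ (g ⁻¹ᵁ V i).ι ≫ y) _ (by rw [Category.assoc, ey g y h, e1]) e1]
        rw [ha' i j _ (t ≫ (g ∣_ V j)) _ _ (by rw [Category.assoc, ey g y h, e1]) (by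
          rw [Category.assoc, eg, Category.assoc, eg, ← Category.assoc, e, Category.assoc])]
        refine (a j).val_congr rfl _ _ ?_ _ _
        funext l
        rw [WRN.res_res, WRN.res_res]
        exact WRN.res_congr2 e _ _ _)
    exact ⟨C 0, fun i => hC i 0⟩
  choose c hc using ex
  have spec : ∀ {S' S : Scheme.{u}} (g : S ⟶ T) (y : S ⟶ X) (h : g ≫ x = y)
      (v : Fin n → E.toVecBundleData.Fiber y) (hv : IsBas v) (t : S' ⟶ S) (i : ι)
      (k : S' ⟶ (V i).toScheme) (hk : k ≫ (V i).ι = t ≫ g) (z : S' ⟶ X) (hz : t ≫ y = z)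
      (hkz : k ≫ (V i).ι ≫ x = z),
      t.appTop (c S g y h v hv) = (a i).val S' k z hkz _ (hv.res t hz) := by
    intro S' S g y h v hv t i k hk z hz hkz
    obtain ⟨l, hl⟩ : ∃ l : S' ⟶ (g ⁻¹ᵁ V i).toScheme, l ≫ (g ⁻¹ᵁ V i).ι = t := by
      refine ⟨IsOpenImmersion.lift (g ⁻¹ᵁ V i).ι t ?_, IsOpenImmersion.lift_fac _ _ _⟩
      rintro _ ⟨q, rfl⟩
      simp only [Scheme.Opens.range_ι]
      show g (t q) ∈ V i
      rw [← Scheme.Hom.comp_apply, ← hk, Scheme.Hom.comp_apply]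
      exact (k q).2
    have hlk : l ≫ (g ∣_ V i) = k := by
      rw [← cancel_mono (V i).ι, Category.assoc, eg, ← Category.assoc, hl, hk]
    have h3 := congrArg (fun r => l.appTop r) (hc S g y h v hv i)
    simp only at h3
    rw [← appTop_comp_apply, hl] at h3
    rw [h3, (a i).nat l _ _ hlk _ z _ hkz (by rw [← Category.assoc, hl, hz])]
    refine (a i).val_congr rfl _ _ ?_ _ _
    funext j
    rw [WRN.res_res]
    exact WRN.res_congr2 hl _ _ _
  refine ⟨⟨c, ?_, ?_⟩, ?_⟩
  · intro S' S t g g' e y y' h h' ht v hv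
    apply sec_ext
    intro p
    obtain ⟨i, hi⟩ := hV (g' p)
    refine ⟨g' ⁻¹ᵁ V i, hi, ?_⟩
    rw [← appTop_comp_apply, spec g y h v hv _ i (g' ∣_ V i) (by rw [eg, Category.assoc, e])
      ((g' ⁻¹ᵁ V i).ι ≫ y') (by rw [Category.assoc, ht]) (ey g' y' h' i),
      spec g' y' h' _ (hv.res t ht) _ i (g' ∣_ V i) (eg _ _) _ rfl (ey g' y' h' i)]
    refine (a i).val_congr rfl _ _ ?_ _ _
    funext j
    rw [WRN.res_res]
  · intro S g y h v hv w hw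
    apply sec_ext
    intro p
    obtain ⟨i, hi⟩ := hV (g p)
    refine ⟨g ⁻¹ᵁ V i, hi, ?_⟩
    rw [map_mul, spec g y h v hv _ i (g ∣_ V i) (eg _ _) _ rfl (ey g y h i),
      spec g y h w hw _ i (g ∣_ V i) (eg _ _) _ rfl (ey g y h i),
      cdet_res E _ rfl hv (hv.res _ rfl) rfl]
    exact (a i).ch _ _ _ _ _ _ _
  · intro i
    apply ext_val
    intro S g y h v hv
    have h3 := spec (g ≫ (V i).ι) y (by rw [Category.assoc, h]) v hv (𝟙 S) i g
      (by rw [Category.id_comp]) y (Category.id_comp _) h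
    have h4 : (𝟙 S : S ⟶ S).appTop (c S (g ≫ (V i).ι) y (by rw [Category.assoc, h]) v hv) =
      c S (g ≫ (V i).ι) y (by rw [Category.assoc, h]) v hv := by simp
    refine (h4.symm.trans h3).trans ?_
    refine (a i).val_congr rfl _ _ ?_ _ _
    funext j
    rw [WRN.res_id]

end DF

end

end WRN

namespace WRN

section

variable {X : Scheme.{u}} {n : ℕ} (E : VecBundle n X)

/-- The determinant functor. -/
def detMF : MF.{u, u + 1} X where
  F {_} x := DF E x
  res {_ _} g {_ _} h a := DF.rs g h a
  res_id {_ _} h a := DF.ext_val fun S g y h' v hv =>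
    DF.val_congr a (Category.comp_id g) _ _ rfl _ _
  res_res {_ _ _} t g {_ _ _} h h' h'' a := DF.ext_val fun S s y h3 v hv =>
    DF.val_congr a (Category.assoc _ _ _) _ _ rfl _ _
  sep {_ _} a b H := DF.sep a b H
  glue {_} x {_} V hV a ha := DF.glue x V hV a ha
  acm _ := inferInstance
  mod _ := inferInstance
  res_add {_ _} g {_ _} h a b := rfl
  res_smul {_ _} g {_ _} h c a := DF.ext_val fun S s y h3 v hv => by
    show (s ≫ g).appTop c * _ = s.appTop (g.appTop c) * _
    rw [appTop_comp_apply]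
    rfl

/-- The family attached to `n` vectors. -/
def dfam {T : Scheme.{u}} {x : T ⟶ X} (w : Fin n → E.toVecBundleData.Fiber x) : DF E x where
  val S g y h v hv := cdet E hv (fun i => res E.toVecBundleData g h (w i))
  nat {_ _} t g g' e y y' h h' ht v hv := by
    rw [cdet_res E t ht hv (hv.res t ht) rfl]
    congr 1
    funext i
    rw [WRN.res_res]
    exact WRN.res_congr2 e _ _ _
  ch {_} g y h v hv w' hw' := by
    rw [cdet_alt E hw' (cdet E hv), smul_eq_mul, mul_comm]

theorem res_update {T' T : Scheme.{u}} (g : T' ⟶ T) {x : T ⟶ X} {y : T' ⟶ X} (h : g ≫ x = y)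
    {ι : Type*} [DecidableEq ι] (w : ι → E.toVecBundleData.Fiber x) (i : ι) (a : E.toVecBundleData.Fiber x) :
    (fun j => res E.toVecBundleData g h (Function.update w i a j)) =
      Function.update (fun j => res E.toVecBundleData g h (w j)) i (res E.toVecBundleData g h a) := by
  funext j
  by_cases hj : j = i
  · subst hj; simp
  · simp [Function.update_of_ne hj]

/-- The universal alternating map. -/
def dfamAlt {T : Scheme.{u}} (x : T ⟶ X) :
    AlternatingMap Γ(T, ⊤) (E.toVecBundleData.Fiber x) (DF E x) (Fin n) where
  toFun w := dfam E w
  map_update_add' {_} w i a b := DF.ext_val fun S g y h v hv => by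
    show cdet E hv _ = cdet E hv _ + cdet E hv _
    rw [res_update, res_update, res_update, WRN.res_add]
    exact (cdet E hv).map_update_add _ _ _ _
  map_update_smul' {_} w i c a := DF.ext_val fun S g y h v hv => by
    show cdet E hv _ = _ * cdet E hv _
    rw [res_update, res_update, WRN.res_smul]
    exact (cdet E hv).map_update_smul _ _ _ _
  map_eq_zero_of_eq' w i j hij hne := DF.ext_val fun S g y h v hv => by
    show cdet E hv _ = 0
    exact (cdet E hv).map_eq_zero_of_eq _ (by rw [hij]) hne

theorem dfam_res {T' T : Scheme.{u}} (g : T' ⟶ T) {x : T ⟶ X} {y : T' ⟶ X} (h : g ≫ x = y)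
    (w : Fin n → E.toVecBundleData.Fiber x) :
    DF.rs g h (dfam E w) = dfam E (fun i => res E.toVecBundleData g h (w i)) :=
  DF.ext_val fun S s z h' v hv => by
    show cdet E hv _ = cdet E hv _
    simp only [WRN.res_res]

theorem dfam_bas {T : Scheme.{u}} {x : T ⟶ X} {v : Fin n → E.toVecBundleData.Fiber x}
    (hv : IsBas v) : (detMF E).Bas (x := x) (fun _ : Fin 1 => dfam E v) := by
  intro S g y h
  have hb := hv.res g h
  have e : ∀ f : Fin 1 → Γ(S, ⊤), (∑ i, f i • (detMF E).res g h (dfam E v)) =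
      f 0 • dfam E (fun i => res E.toVecBundleData g h (v i)) := by
    intro f
    rw [Fin.sum_univ_one]
    exact congrArg (fun t => f 0 • t) (dfam_res E g h v)
  have e2 : ∀ c : Γ(S, ⊤), (c • dfam E (fun i => res E.toVecBundleData g h (v i))).val S (𝟙 S) y
      (Category.id_comp _) _ hb = c := by
    intro c
    show (𝟙 S : S ⟶ S).appTop c * cdet E hb _ = c
    have : (fun i => res E.toVecBundleData (𝟙 S) (Category.id_comp y)
      (res E.toVecBundleData g h (v i))) = fun i => res E.toVecBundleData g h (v i) :=
      funext fun i => by rw [WRN.res_id]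
    rw [this, cdet_self]
    simp
  constructor
  · intro a b hab
    simp only [e] at hab
    funext i
    rw [Subsingleton.elim i 0, ← e2 (a 0), ← e2 (b 0)]
    exact congrArg (fun t : DF E y => t.val S (𝟙 S) y (Category.id_comp _) _ hb) hab
  · intro φ
    refine ⟨fun _ => DF.val φ S (𝟙 S) y (Category.id_comp _) _ hb, ?_⟩
    simp only [e]
    refine DF.ext_val fun S' s z h' w hw => ?_
    show s.appTop _ * cdet E hw _ = DF.val φ _ _ _ _ _ _
    rw [DF.ch φ s z h' w hw _ (hb.res s h'), mul_comm]
    congr 1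
    exact DF.nat φ _ _ _ (Category.comp_id s) _ _ _ _ _ _ _

theorem exists_det : ∃ D : LineBundle X, Nonempty (DetData E D) := by
  obtain ⟨D, Φ, hΦ⟩ : ∃ (D : LineBundle X) (Φ : ∀ {T : Scheme.{u}} (x : T ⟶ X),
        D.toVecBundleData.Fiber x ≃ₗ[Γ(T, ⊤)] DF E x),
      ∀ {T' T : Scheme.{u}} (g : T' ⟶ T) {x : T ⟶ X} {y : T' ⟶ X} (h : g ≫ x = y)
        (a : D.toVecBundleData.Fiber x),
        Φ y (WRN.res D.toVecBundleData g h a) = DF.rs g h (Φ x a) :=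
    (detMF E).exists_bundle (n := 1) (fun p => by
    obtain ⟨U, s, hp, hs⟩ := E.locTriv p
    obtain ⟨hs0, hb⟩ := (isFrame_iff _ _).1 hs
    exact ⟨U, hp, _, dfam_bas E hb⟩)
  have hΦ' : ∀ {T' T : Scheme.{u}} (g : T' ⟶ T) {x : T ⟶ X} {y : T' ⟶ X} (h : g ≫ x = y)
      (a : DF E x), res D.toVecBundleData g h ((Φ x).symm a) = (Φ y).symm (DF.rs g h a) := by
    intro T' T g x y h a
    rw [LinearEquiv.eq_symm_apply, hΦ, LinearEquiv.apply_symm_apply]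
  refine ⟨D, ⟨⟨fun {T} x => (Φ x).symm.toLinearMap.compAlternatingMap (dfamAlt E x), ?_, ?_⟩⟩⟩
  · intro T' T g x y h v
    show res _ g h ((Φ x).symm (dfam E v)) = (Φ y).symm (dfam E _)
    rw [hΦ', dfam_res]
  · intro T x v hv
    apply isBas_one
    intro S g
    have h2 := (dfam_bas E hv g (y := g ≫ x) rfl).comp (g := _)
      (f := fun (f : Γ(S, ⊤)) (_ : Fin 1) => f)
      ⟨fun a b h => congrFun h 0, fun f => ⟨f 0, funext fun i => by rw [Subsingleton.elim i 0]⟩⟩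
    have h3 : Function.Bijective (fun f : Γ(S, ⊤) => f • DF.rs g (y := g ≫ x) rfl (dfam E v)) := by
      have e : (fun f : Γ(S, ⊤) => f • DF.rs g (y := g ≫ x) rfl (dfam E v)) =
          (fun f : Γ(S, ⊤) => ∑ _i : Fin 1, f • DF.rs g (y := g ≫ x) rfl (dfam E v)) :=
        funext fun f => (Fin.sum_univ_one (M := DF E (g ≫ x))
          (fun _ => f • DF.rs g (y := g ≫ x) rfl (dfam E v))).symm
      rw [e]
      exact h2
    have h4 := (Φ (g ≫ x)).symm.bijective.comp h3
    show Function.Bijective (fun f : Γ(S, ⊤) => f • res D.toVecBundleData g (y := g ≫ x) rfl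
      ((Φ x).symm (dfam E v)))
    convert h4 using 1
    funext f
    show _ = (Φ (g ≫ x)).symm (f • _)
    rw [map_smul, hΦ']

end

end WRN

namespace WRN

/-- Existence of mutually inverse natural linear maps. -/
def FIso {X X' T : Scheme.{u}} (E : VecBundleData X) (E' : VecBundleData X')
    (x : T ⟶ X) (x' : T ⟶ X') : Prop :=
  ∃ (ψ : FibMap E E' x x') (φ : FibMap E' E x' x), ψ.Inv φ ∧ φ.Inv ψ

theorem FIso.symm {X X' T : Scheme.{u}} {E : VecBundleData X} {E' : VecBundleData X'}
    {x : T ⟶ X} {x' : T ⟶ X'} (h : FIso E E' x x') : FIso E' E x' x := by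
  obtain ⟨ψ, φ, h1, h2⟩ := h
  exact ⟨φ, ψ, h2, h1⟩

theorem FibMap.Inv.comp {X X' X'' T : Scheme.{u}} {E : VecBundleData X} {E' : VecBundleData X'}
    {E'' : VecBundleData X''} {x : T ⟶ X} {x' : T ⟶ X'} {x'' : T ⟶ X''}
    {ψ : FibMap E E' x x'} {φ : FibMap E' E x' x} {ψ' : FibMap E' E'' x' x''}
    {φ' : FibMap E'' E' x'' x'} (h : ψ.Inv φ) (h' : ψ'.Inv φ') : (ψ.comp ψ').Inv (φ'.comp φ) := by
  intro S g y y' k k' a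
  rw [FibMap.comp_app φ' φ g k' rfl k, FibMap.comp_app ψ ψ' g k rfl k', h', h]

theorem FIso.trans {X X' X'' T : Scheme.{u}} {E : VecBundleData X} {E' : VecBundleData X'}
    {E'' : VecBundleData X''} {x : T ⟶ X} {x' : T ⟶ X'} {x'' : T ⟶ X''}
    (h : FIso E E' x x') (h' : FIso E' E'' x' x'') : FIso E E'' x x'' := by
  obtain ⟨ψ, φ, h1, h2⟩ := h
  obtain ⟨ψ', φ', h1', h2'⟩ := h'
  exact ⟨ψ.comp ψ', φ'.comp φ, h1.comp h1', h2'.comp h2⟩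

theorem FIso.vbiso {X : Scheme.{u}} {n m : ℕ} {E : VecBundle n X} {F : VecBundle m X}
    (h : FIso E.toVecBundleData F.toVecBundleData (𝟙 X) (𝟙 X)) : VBIso E F := by
  obtain ⟨ψ, φ, h1, h2⟩ := h
  exact vbiso_of_fibMap E F ψ φ h1 h2

theorem FIso.det {X X' T : Scheme.{u}} {n : ℕ} {E : VecBundle n X} {D : LineBundle X}
    {E' : VecBundle n X'} {D' : LineBundle X'} (d : DetData E D) (d' : DetData E' D')
    {x : T ⟶ X} {x' : T ⟶ X'} (h : FIso E.toVecBundleData E'.toVecBundleData x x') :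
    FIso D.toVecBundleData D'.toVecBundleData x x' := by
  obtain ⟨ψ, φ, h1, h2⟩ := h
  exact ⟨detMap d d' ψ, detMap d' d φ, detMap_inv d d' ψ φ h1 h2, detMap_inv d' d φ ψ h2 h1⟩

/-- A natural linear map which is bijective. -/
theorem FIso.of_bij {X X' T : Scheme.{u}} {E : VecBundleData X} {E' : VecBundleData X'}
    {x : T ⟶ X} {x' : T ⟶ X'} (ψ : FibMap E E' x x')
    (hb : ∀ {S : Scheme.{u}} (g : S ⟶ T) {y : S ⟶ X} {y' : S ⟶ X'} (h : g ≫ x = y)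
      (h' : g ≫ x' = y'), Function.Bijective (ψ.app g h h')) : FIso E E' x x' := by
  refine ⟨ψ, ⟨fun {S} g {y y'} h h' => (LinearEquiv.ofBijective _ (hb g h' h)).symm.toLinearMap,
    ?_⟩, ?_, ?_⟩
  · intro S' S t g y y' z z' h h' k k' a
    refine (hb (t ≫ g) (y := z') (y' := z) (by rw [Category.assoc, h', k'])
      (by rw [Category.assoc, h, k])).1 ?_
    rw [← ψ.nat t g h' h k' k]
    have e1 := LinearEquiv.apply_symm_apply (LinearEquiv.ofBijective _ (hb g h' h)) a
    have e2 := LinearEquiv.apply_symm_apply (LinearEquiv.ofBijective _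
      (hb (t ≫ g) (y := z') (y' := z) (by rw [Category.assoc, h', k'])
      (by rw [Category.assoc, h, k]))) (res E' t k a)
    exact (congrArg (res E' t k) e1).trans e2.symm
  · intro S g y y' h h' a
    exact LinearEquiv.symm_apply_apply (LinearEquiv.ofBijective _ (hb g h h')) a
  · intro S g y y' h h' a
    exact LinearEquiv.apply_symm_apply (LinearEquiv.ofBijective _ (hb g h' h)) a

/-- A natural map which is bijective. -/
theorem FIso.of_nmap {X X' T : Scheme.{u}} {n m : ℕ} {E : VecBundle n X} {E' : VecBundle m X'}
    {x : T ⟶ X} {x' : T ⟶ X'} (ψ : NMap E.toVecBundleData E'.toVecBundleData x x')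
    (hb : ∀ {S : Scheme.{u}} (g : S ⟶ T) {y : S ⟶ X} {y' : S ⟶ X'} (h : g ≫ x = y)
      (h' : g ≫ x' = y'), Function.Bijective (ψ.app g h h')) :
    FIso E.toVecBundleData E'.toVecBundleData x x' := by
  refine exists_fibMap_of_nmap ψ ⟨fun {S} g {y y'} h h' => (Equiv.ofBijective _ (hb g h' h)).symm,
    ?_⟩ ?_ ?_
  · intro S' S t g y y' z z' h h' k k' a
    refine (hb (t ≫ g) (y := z') (y' := z) (by rw [Category.assoc, h', k'])
      (by rw [Category.assoc, h, k])).1 ?_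
    rw [← ψ.nat t g h' h k' k]
    have e1 := Equiv.apply_symm_apply (Equiv.ofBijective _ (hb g h' h)) a
    have e2 := Equiv.apply_symm_apply (Equiv.ofBijective _
      (hb (t ≫ g) (y := z') (y' := z) (by rw [Category.assoc, h', k'])
      (by rw [Category.assoc, h, k]))) (res E'.toVecBundleData t k a)
    exact (congrArg (res E'.toVecBundleData t k) e1).trans e2.symm
  · intro S g y y' h h' a
    exact Equiv.symm_apply_apply (Equiv.ofBijective _ (hb g h h')) a
  · intro S g y y' h h' a
    exact Equiv.apply_symm_apply (Equiv.ofBijective _ (hb g h' h)) a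

/-- Bijectivity of natural linear maps is local. -/
theorem FibMap.bij_of_local {X X' T : Scheme.{u}} {E : VecBundleData X} {E' : VecBundleData X'}
    {x : T ⟶ X} {x' : T ⟶ X'} (ψ : FibMap E E' x x')
    (hloc : ∀ {S : Scheme.{u}} (g : S ⟶ T) (p : S), ∃ V : S.Opens, p ∈ V ∧
      ∀ {y : V.toScheme ⟶ X} {y' : V.toScheme ⟶ X'} (h : (V.ι ≫ g) ≫ x = y)
        (h' : (V.ι ≫ g) ≫ x' = y'), Function.Bijective (ψ.app (V.ι ≫ g) h h'))
    {S : Scheme.{u}} (g : S ⟶ T) {y : S ⟶ X} {y' : S ⟶ X'} (h : g ≫ x = y)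
      (h' : g ≫ x' = y') : Function.Bijective (ψ.app g h h') := by
  have inj : ∀ {S : Scheme.{u}} (g : S ⟶ T) {y : S ⟶ X} {y' : S ⟶ X'} (h : g ≫ x = y)
      (h' : g ≫ x' = y'), Function.Injective (ψ.app g h h') := by
    intro S g y y' h h' a b hab
    apply fib_ext
    intro p
    obtain ⟨V, hp, hV⟩ := hloc g p
    refine ⟨V, hp, ?_⟩
    apply (hV (by rw [Category.assoc, h]) (by rw [Category.assoc, h'])).1
    rw [← ψ.nat V.ι g h h' rfl rfl, ← ψ.nat V.ι g h h' rfl rfl, hab]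
  refine ⟨inj g h h', ?_⟩
  intro b
  choose V hp hV using hloc g
  have hs := fun p => (hV p (y := (V p).ι ≫ y) (y' := (V p).ι ≫ y') (by rw [Category.assoc, h])
    (by rw [Category.assoc, h'])).2 (res E' (V p).ι rfl b)
  choose A hA using hs
  obtain ⟨B, hB⟩ := fib_glue (E := E) y V (fun p => ⟨p, hp p⟩) A (by
    intro p q S' s t hst
    refine inj ((s ≫ (V p).ι) ≫ g) (y' := (s ≫ (V p).ι) ≫ y')
      (by simp only [Category.assoc, h]) (by simp only [Category.assoc, h']) ?_
    have e1 := ψ.nat s ((V p).ι ≫ g) (y := (V p).ι ≫ y) (y' := (V p).ι ≫ y')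
      (by rw [Category.assoc, h]) (by rw [Category.assoc, h'])
      (z' := (s ≫ (V p).ι) ≫ y') rfl (by simp) (A p)
    have e2 := ψ.nat t ((V q).ι ≫ g) (y := (V q).ι ≫ y) (y' := (V q).ι ≫ y')
      (by rw [Category.assoc, h]) (by rw [Category.assoc, h']) (z := s ≫ (V p).ι ≫ y)
      (z' := (s ≫ (V p).ι) ≫ y') (by rw [← Category.assoc, ← hst, Category.assoc])
      (by rw [← Category.assoc, ← hst]) (A q)
    rw [hA, res_res] at e1 e2
    rw [ψ.app_congr (Category.assoc s (V p).ι g).symm] at e1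
    rw [ψ.app_congr (show t ≫ (V q).ι ≫ g = (s ≫ (V p).ι) ≫ g by rw [hst, Category.assoc])] at e2
    refine e1.symm.trans (Eq.trans ?_ e2)
    exact res_congr2 hst _ _ _)
  refine ⟨B, ?_⟩
  apply fib_ext
  intro p
  refine ⟨V p, hp p, ?_⟩
  rw [ψ.nat (V p).ι g h h' rfl rfl, hB p]
  exact hA p

theorem VBIso.fiso {X : Scheme.{u}} {n m : ℕ} {E : VecBundle n X} {F : VecBundle m X}
    (h : VBIso E F) {T : Scheme.{u}} (x : T ⟶ X) :
    FIso E.toVecBundleData F.toVecBundleData x x := by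
  obtain ⟨φ, hφ, hi⟩ := h
  refine FIso.of_bij (fibMapOfHom φ hφ x) ?_
  intro S g y y' h h'
  constructor
  · intro a b hab
    have : a.1 ≫ φ = b.1 ≫ φ := congrArg Subtype.val hab
    exact Subtype.ext ((cancel_mono φ).1 this)
  · intro b
    refine ⟨⟨b.1 ≫ inv φ, ?_⟩, Subtype.ext ?_⟩
    · rw [← hφ.1, Category.assoc, IsIso.inv_hom_id_assoc, b.2, ← h, ← h']
    · show (b.1 ≫ inv φ) ≫ φ = b.1
      simp

theorem IsPullbackBundle.fiso {Y X : Scheme.{u}} {j : Y ⟶ X} {n : ℕ} {E : VecBundle n X}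
    {F : VecBundle n Y} (h : IsPullbackBundle j E F) :
    FIso F.toVecBundleData E.toVecBundleData (𝟙 Y) j := by
  obtain ⟨τ, h1, h2, h3, h4⟩ := h
  refine FIso.of_bij ⟨fun {S} g {y y'} hy hy' =>
    { toFun := fun a => ⟨a.1 ≫ τ, by
        rw [Category.assoc, h1, ← Category.assoc, a.2, ← hy, ← hy', Category.comp_id]⟩
      map_add' := fun a b => Subtype.ext (h2 _ _ _ _)
      map_smul' := fun f a => Subtype.ext (h3 _ _) }, ?_⟩ ?_
  · intro S' S t g y y' z z' h h' k k' a
    exact Subtype.ext (by simp [res_val])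
  · intro S g y y' hy hy'
    have hyy : y' = y ≫ j := by rw [← hy, ← hy', Category.comp_id]
    constructor
    · intro a b hab
      have hab : a.1 ≫ τ = b.1 ≫ τ := congrArg Subtype.val hab
      obtain ⟨_, _, hu⟩ := h4 y (a.1 ≫ τ) (by rw [Category.assoc, h1, ← Category.assoc, a.2])
      exact Subtype.ext ((hu a.1 ⟨a.2, rfl⟩).trans (hu b.1 ⟨b.2, hab.symm⟩).symm)
    · intro b
      obtain ⟨a, ⟨ha, hb⟩, _⟩ := h4 y b.1 (by rw [b.2, hyy])
      exact ⟨⟨a, ha⟩, Subtype.ext hb⟩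

/-- Tensoring with a trivialized line bundle does nothing. -/
theorem IsTensor.fiso {X : Scheme.{u}} {L M N : LineBundle X} (h : IsTensor L M N)
    (d : M.toVecBundleData.Fiber (𝟙 X)) (hd : IsBas (fun _ : Fin 1 => d)) :
    FIso L.toVecBundleData N.toVecBundleData (𝟙 X) (𝟙 X) := by
  obtain ⟨β, b1, b2, b3, b4, b5, b6, b7⟩ := h
  have hdy : ∀ {S : Scheme.{u}} (y : S ⟶ X), (y ≫ d.1) ≫ M.π = y := by
    intro S y
    rw [Category.assoc, d.2, Category.comp_id]
  have bc : ∀ {S : Scheme.{u}} {a a' : S ⟶ L.tot} {b b' : S ⟶ M.tot} (_ : a = a') (_ : b = b')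
      (h : a ≫ L.π = b ≫ M.π) (h' : a' ≫ L.π = b' ≫ M.π), β a b h = β a' b' h' := by
    intro S a a' b b' e e' h h'
    subst e; subst e'; rfl
  let ψ : FibMap L.toVecBundleData N.toVecBundleData (𝟙 X) (𝟙 X) :=
    ⟨fun {S} g {y y'} hy hy' =>
      { toFun := fun a => ⟨β a.1 (y ≫ d.1) (a.2.trans (hdy y).symm), by
          rw [b1, a.2, ← hy, ← hy']⟩
        map_add' := fun a b => Subtype.ext (b3 _ _ _ _ _ _ _ _)
        map_smul' := fun f a => Subtype.ext (b5 _ _ _ _ _) }, by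
      intro S' S t g y y' z z' h h' k k' a
      refine Subtype.ext ((b2 t _ _ _ (by
        rw [Category.assoc, a.2, Category.assoc, hdy])).trans (bc rfl ?_ _ _))
      rw [← k, Category.assoc]⟩
  refine FIso.of_bij ψ (fun {_} g {_ _} h h1 => ψ.bij_of_local ?_ g h h1)
  intro S g p
  obtain ⟨U, s, hp, hs⟩ := L.locTriv (g p)
  have hM : M.toVecBundleData.IsFrame (n := 1) U (fun _ => U.ι ≫ d.1) := by
    rw [isFrame_iff]
    refine ⟨fun _ => hdy _, ?_⟩
    exact hd.res U.ι (Category.comp_id _)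
  obtain ⟨hs0, hb⟩ := (isFrame_iff _ _).1 hs
  obtain ⟨hN0, hN⟩ := (isFrame_iff _ _).1 (b7 U s _ hs hM (by rw [hs0, hdy]))
  refine ⟨g ⁻¹ᵁ U, hp, ?_⟩
  have e := morphismRestrict_ι g U
  intro y y' h h'
  have hy : (g ∣_ U) ≫ U.ι = y := by rw [e, ← h, Category.comp_id]
  have hy' : (g ∣_ U) ≫ U.ι = y' := by rw [e, ← h', Category.comp_id]
  have c1 := hb.bij (g ∣_ U) hy
  have c2 := hN.bij (g ∣_ U) hy'
  have key : (fun a => ψ.app ((g ⁻¹ᵁ U).ι ≫ g) h h' a) ∘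
      comb (fun i => res L.toVecBundleData (g ∣_ U) hy (⟨s i, hs0 i⟩ : L.toVecBundleData.Fiber U.ι)) =
      comb (fun i => res N.toVecBundleData (g ∣_ U) hy' (⟨_, hN0 i⟩ : N.toVecBundleData.Fiber U.ι)) := by
    funext c
    simp only [comb, Function.comp_apply, map_sum, map_smul]
    refine Finset.sum_congr rfl fun i _ => ?_
    congr 1
    refine Subtype.ext ?_
    show β _ _ _ = (g ∣_ U) ≫ β _ _ _
    rw [b2 _ _ _ _ (by rw [Category.assoc, hs0, Category.assoc, hdy])]
    refine bc ?_ ?_ _ _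
    · rw [Subsingleton.elim i 0]; rfl
    · rw [← hy, Category.assoc]
  have := key ▸ c2
  exact (Function.Bijective.of_comp_iff _ c1).1 this

end WRN

namespace WRN

/-- Pushforward data: a natural linear identification of the fibers with the sections. -/
structure PushData {Y Y0 X : Scheme.{u}} (f : Y ⟶ X) (c : Y ⟶ Y0) (L : VecBundleData Y0) {n : ℕ}
    (E : VecBundle n X) where
  Φ : ∀ {T : Scheme.{u}} (x : T ⟶ X), E.toVecBundleData.Fiber x ≃ₗ[Γ(T, ⊤)] PushF f c L x
  nat : ∀ {T' T : Scheme.{u}} (g : T' ⟶ T) {x : T ⟶ X} {y : T' ⟶ X} (h : g ≫ x = y)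
    (a : E.toVecBundleData.Fiber x),
    Φ y (WRN.res E.toVecBundleData g h a) = PushF.rs g h (Φ x a)

theorem PushData.nat_symm {Y Y0 X : Scheme.{u}} {f : Y ⟶ X} {c : Y ⟶ Y0} {L : VecBundleData Y0}
    {n : ℕ} {E : VecBundle n X} (P : PushData f c L E) {T' T : Scheme.{u}} (g : T' ⟶ T)
    {x : T ⟶ X} {y : T' ⟶ X} (h : g ≫ x = y) (a : PushF f c L x) :
    WRN.res E.toVecBundleData g h ((P.Φ x).symm a) = (P.Φ y).symm (PushF.rs g h a) := by
  rw [LinearEquiv.eq_symm_apply, P.nat, LinearEquiv.apply_symm_apply]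

theorem PushData.bas {Y Y0 X : Scheme.{u}} {f : Y ⟶ X} {c : Y ⟶ Y0} {L : VecBundleData Y0}
    {n : ℕ} {E : VecBundle n X} (P : PushData f c L E) {m : ℕ} {T : Scheme.{u}} {x : T ⟶ X}
    {v : Fin m → PushF f c L x} (hv : (pushMF f c L).Bas (x := x) v) :
    IsBas (fun i => (P.Φ x).symm (v i)) := by
  intro S g
  have h1 := (P.Φ (g ≫ x)).symm.bijective.comp (hv g (y := g ≫ x) rfl)
  have e : comb (fun i => res E.toVecBundleData g (y := g ≫ x) rfl ((P.Φ x).symm (v i))) =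
      fun d : Fin m → Γ(S, ⊤) => (P.Φ (g ≫ x)).symm (∑ i, d i • PushF.rs g rfl (v i)) := by
    funext d
    rw [map_sum]
    exact Finset.sum_congr rfl fun i _ => by
      rw [map_smul, ← P.nat_symm]
  rw [e]
  exact h1

theorem isFinite_of_pb {k k' : Type u} [Field k] [Field k'] [Algebra k k'] [FiniteDimensional k k']
    {Y X : Scheme.{u}} {f : Y ⟶ X} {q : Y ⟶ Spk k'} {s : X ⟶ Spk k}
    (hf : IsPullback f q s (Spec.map (CommRingCat.ofHom (algebraMap k k')))) : IsFinite f := by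
  have : IsFinite (Spec.map (CommRingCat.ofHom (algebraMap k k'))) := by
    rw [IsFinite.SpecMap_iff]
    exact RingHom.finite_algebraMap.2 inferInstance
  exact MorphismProperty.of_isPullback hf.flip this

theorem exists_push {k k' : Type u} [Field k] [Field k'] [Algebra k k'] [FiniteDimensional k k']
    {Y Y0 X : Scheme.{u}} (f : Y ⟶ X) (q : Y ⟶ Spk k') (s : X ⟶ Spk k)
    (hf : IsPullback f q s (Spec.map (CommRingCat.ofHom (algebraMap k k'))))
    (c : Y ⟶ Y0) (L : LineBundle Y0) :
    ∃ E : VecBundle (Module.finrank k k') X, Nonempty (PushData f c L.toVecBundleData E) := by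
  have := isFinite_of_pb hf
  obtain ⟨E, Φ, hΦ⟩ : ∃ (E : VecBundle (Module.finrank k k') X) (Φ : ∀ {T : Scheme.{u}} (x : T ⟶ X),
        E.toVecBundleData.Fiber x ≃ₗ[Γ(T, ⊤)] PushF f c L.toVecBundleData x),
      ∀ {T' T : Scheme.{u}} (g : T' ⟶ T) {x : T ⟶ X} {y : T' ⟶ X} (h : g ≫ x = y)
        (a : E.toVecBundleData.Fiber x),
        Φ y (WRN.res E.toVecBundleData g h a) = PushF.rs g h (Φ x a) :=
    (pushMF f c L.toVecBundleData).exists_bundle (fun p => by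
      obtain ⟨U, hp, σ, hσ⟩ := exists_push_frame L f c p
      exact ⟨U, hp, _, pushMF_bas f q s hf c L.toVecBundleData U.ι σ hσ⟩)
  exact ⟨E, ⟨⟨Φ, hΦ⟩⟩⟩

/-- Pushforward bundles have pushforward data. -/
theorem IsPushforwardBundle.exists_pushData {Y X : Scheme.{u}} {f : Y ⟶ X} {n : ℕ}
    {L : LineBundle Y} {E : VecBundle n X} (h : IsPushforwardBundle f L E) :
    Nonempty (PushData f (𝟙 Y) L.toVecBundleData E) := by
  obtain ⟨lam, hover, h1, h2, h3, h4⟩ := h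
  have lc : ∀ {T : Scheme.{u}} {e e' : T ⟶ E.tot} {y y' : T ⟶ Y} (_ : e = e') (_ : y = y')
      (h : e ≫ E.π = y ≫ f) (h' : e' ≫ E.π = y' ≫ f), lam e y h = lam e' y' h' := by
    intro T e e' y y' he hy h h'
    subst he; subst hy; rfl
  let m : ∀ {T : Scheme.{u}} (x : T ⟶ X),
      E.toVecBundleData.Fiber x →ₗ[Γ(T, ⊤)] PushF f (𝟙 Y) L.toVecBundleData x := fun {T} x =>
    { toFun := fun e => (⟨lam (pullback.fst x f ≫ e.1) (pullback.snd x f)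
            (by rw [Category.assoc, e.2]; exact pullback.condition), by
              rw [hover, Category.comp_id]⟩ :
              L.toVecBundleData.Fiber (pullback.snd x f ≫ 𝟙 Y))
      map_add' := fun a b => by
        refine Subtype.ext ?_
        refine (lc (E.add_natural _ _ _ _ (by
          simp only [Category.assoc, a.2, b.2])) rfl _ ?_).trans (h2 _ _ _ _ _ _ _)
        rw [E.add_π, Category.assoc, a.2, pullback.condition]
      map_smul' := fun r a => by
        refine Subtype.ext ?_
        refine (lc (E.smul_natural _ _ _) rfl _ ?_).trans (h3 _ _ _ _ _)
        rw [E.smul_π, Category.assoc, a.2, pullback.condition] }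
  have hm : ∀ {T : Scheme.{u}} (x : T ⟶ X), Function.Bijective (m x) := by
    intro T x
    have hc : Function.Bijective (fun a : L.toVecBundleData.Fiber (pullback.snd x f) =>
        (⟨a.1, by rw [a.2, Category.comp_id]⟩ :
          L.toVecBundleData.Fiber (pullback.snd x f ≫ 𝟙 Y))) :=
      ⟨fun a b hab => Subtype.ext (congrArg Subtype.val hab),
        fun b => ⟨⟨b.1, by rw [b.2, Category.comp_id]⟩, rfl⟩⟩
    exact hc.comp (h4 x)
  refine ⟨⟨fun {T} x => LinearEquiv.ofBijective (m x) (hm x), ?_⟩⟩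
  intro T' T g x y h a
  refine Subtype.ext ?_
  show lam _ _ _ = _ ≫ lam _ _ _
  rw [h1 _ _ _ _ (by
    rw [Category.assoc, Category.assoc, a.2, pullback.condition, Category.assoc])]
  refine lc ?_ ?_ _ _
  · rw [pullback.lift_fst_assoc, Category.assoc]; rfl
  · rw [pullback.lift_snd]

theorem PushData.isPushforwardBundle {Y X : Scheme.{u}} {f : Y ⟶ X} {n : ℕ}
    {L : LineBundle Y} {E : VecBundle n X} (P : PushData f (𝟙 Y) L.toVecBundleData E) :
    IsPushforwardBundle f L E := by
  obtain ⟨lam, hlam⟩ : ∃ lam : ∀ {T : Scheme.{u}} (e : T ⟶ E.tot) (y : T ⟶ Y),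
      e ≫ E.π = y ≫ f → (T ⟶ L.tot), ∀ {T : Scheme.{u}} (e : T ⟶ E.tot) (y : T ⟶ Y)
      (h : e ≫ E.π = y ≫ f), lam e y h =
      ((P.Φ (e ≫ E.π) ⟨e, rfl⟩).ev (𝟙 T) y (by rw [Category.id_comp, h]) rfl).1 :=
    ⟨fun {T} e y h => ((P.Φ (e ≫ E.π) ⟨e, rfl⟩).ev (𝟙 T) y (by rw [Category.id_comp, h]) rfl).1,
      fun {_} _ _ _ => rfl⟩
  have hl : ∀ {T : Scheme.{u}} {x : T ⟶ X} (e : E.toVecBundleData.Fiber x) (y : T ⟶ Y)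
      (h : e.1 ≫ E.π = y ≫ f) (h' : 𝟙 T ≫ x = y ≫ f),
      lam e.1 y h = ((P.Φ x e).ev (𝟙 T) y h' rfl).1 := by
    intro T x e y h h'
    obtain ⟨e, rfl⟩ := e
    exact hlam e y h
  have hl2 : ∀ {T' T : Scheme.{u}} (g : T' ⟶ T) {x : T ⟶ X} (e : E.toVecBundleData.Fiber x)
      (y : T' ⟶ Y) (h : (g ≫ e.1) ≫ E.π = y ≫ f) (h' : g ≫ x = y ≫ f),
      lam (g ≫ e.1) y h = ((P.Φ x e).ev g y h' rfl).1 := by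
    intro T' T g x e y h h'
    have e1 := hl (WRN.res E.toVecBundleData g (y := g ≫ x) rfl e) y h
      (by rw [Category.id_comp, h'])
    refine e1.trans ?_
    rw [P.nat]
    rw [PushF.ev_rs _ _ _ _ _ _ _ (by rw [Category.id_comp, h'])]
    exact congrArg Subtype.val (PushF.ev_congr _ (Category.id_comp _) rfl _ _ _ _)
  refine ⟨@lam, fun {T} e y h => by
    rw [hlam]
    exact ((P.Φ (e ≫ E.π) ⟨e, rfl⟩).ev (𝟙 T) y
      (by rw [Category.id_comp, h]) rfl).2.trans (Category.comp_id _), ?_, ?_, ?_, ?_⟩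
  · intro T' T g e y h h'
    refine Eq.trans ?_ (hl2 g (⟨e, rfl⟩ : E.toVecBundleData.Fiber (e ≫ E.π)) (g ≫ y) h'
      (by rw [← Category.assoc, h'])).symm
    rw [hlam]
    refine (congrArg Subtype.val (PushF.res_ev (P.Φ (e ≫ E.π) ⟨e, rfl⟩) g (𝟙 T) y
      (by rw [Category.id_comp, h]) rfl rfl
      (by rw [Category.comp_id, Category.assoc, h]))).trans ?_
    exact congrArg Subtype.val (PushF.ev_congr _ (Category.comp_id _) rfl _ _ _ _)
  · intro T e e' y h₁ h₂ h₃ h₄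
    refine (hl (⟨e, h₃⟩ + ⟨e', h₄⟩ : E.toVecBundleData.Fiber (y ≫ f)) y h₂
      (Category.id_comp _)).trans ?_
    rw [map_add, PushF.ev_add]
    refine L.add_congr ?_ ?_ _ _
    · exact (hl (⟨e, h₃⟩ : E.toVecBundleData.Fiber (y ≫ f)) y h₃ _).symm
    · exact (hl (⟨e', h₄⟩ : E.toVecBundleData.Fiber (y ≫ f)) y h₄ _).symm
  · intro T r e y h₁ h₂
    refine (hl (r • ⟨e, h₂⟩ : E.toVecBundleData.Fiber (y ≫ f)) y h₁
      (Category.id_comp _)).trans ?_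
    rw [map_smul, PushF.ev_smul]
    have : (𝟙 T : T ⟶ T).appTop r = r := by simp
    rw [this]
    exact congrArg (L.smul r) (hl (⟨e, h₂⟩ : E.toVecBundleData.Fiber (y ≫ f)) y h₂ _).symm
  · intro T x
    have hc : Function.Bijective (fun a : L.toVecBundleData.Fiber (pullback.snd x f ≫ 𝟙 Y) =>
        (⟨a.1, by rw [a.2, Category.comp_id]⟩ :
          L.toVecBundleData.Fiber (pullback.snd x f))) :=
      ⟨fun a b hab => Subtype.ext (congrArg Subtype.val hab),
        fun b => ⟨⟨b.1, by rw [b.2, Category.comp_id]⟩, rfl⟩⟩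
    have h1 := hc.comp (P.Φ x).bijective
    convert h1 using 1
    funext e
    refine Subtype.ext ?_
    refine (hl2 _ _ _ _ pullback.condition).trans ?_
    exact congrArg (fun a : PushF f (𝟙 Y) L.toVecBundleData x =>
      (show L.toVecBundleData.Fiber (pullback.snd x f ≫ 𝟙 Y) from a).1) (PushF.ev_univ _)

end WRN

namespace WRN

section Weil

variable {k : Type u} [Field k] {k' : Type u} [Field k'] [Algebra k k'] [FiniteDimensional k k']
  {X' : SchemeOver k'} {L' : LineBundle X'.carrier}
  {RX : WeilRestrictionData k k' X'}
  {RL : WeilRestrictionData k k' ⟨L'.tot, L'.π ≫ X'.str⟩}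
  {ρ : RL.W.carrier ⟶ RX.W.carrier} {ρK : RL.WK ⟶ RX.WK}

theorem weil_aux (hρstr : ρ ≫ RX.W.str = RL.W.str)
    {T S : Scheme.{u}} {z : T ⟶ RX.W.carrier} (v : T ⟶ RL.W.carrier) (hv : v ≫ ρ = z)
    (t : S ⟶ T) (y : S ⟶ RX.WK) (h : t ≫ z = y ≫ RX.q1) :
    (t ≫ v) ≫ RL.W.str = (y ≫ RX.q2) ≫ Spec.map (CommRingCat.ofHom (algebraMap k k')) := by
  rw [← hρstr, Category.assoc, ← Category.assoc v, hv, ← Category.assoc, h, Category.assoc,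
    Category.assoc, RX.is_pb.w]

theorem weil_aux2 (hρstr : ρ ≫ RX.W.str = RL.W.str) (hρK1 : ρK ≫ RX.q1 = RL.q1 ≫ ρ)
    (hρK2 : ρK ≫ RX.q2 = RL.q2)
    {T S : Scheme.{u}} {z : T ⟶ RX.W.carrier} (v : T ⟶ RL.W.carrier) (hv : v ≫ ρ = z)
    (t : S ⟶ T) (y : S ⟶ RX.WK) (h : t ≫ z = y ≫ RX.q1) :
    RL.is_pb.lift (t ≫ v) (y ≫ RX.q2) (weil_aux hρstr v hv t y h) ≫ ρK = y := by
  apply RX.is_pb.hom_ext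
  · rw [Category.assoc, hρK1, RL.is_pb.lift_fst_assoc, Category.assoc, hv, h]
  · rw [Category.assoc, hρK2, RL.is_pb.lift_snd]

/-- The map from points of the Weil restriction to sections. -/
def weilMap (hρstr : ρ ≫ RX.W.str = RL.W.str) (hρK1 : ρK ≫ RX.q1 = RL.q1 ≫ ρ)
    (hρK2 : ρK ≫ RX.q2 = RL.q2) (hρKcounit : ρK ≫ RX.counit = RL.counit ≫ L'.π)
    {T : Scheme.{u}} {z : T ⟶ RX.W.carrier} (v : {v : T ⟶ RL.W.carrier // v ≫ ρ = z}) :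
    PushF RX.q1 RX.counit L'.toVecBundleData z :=
  (⟨RL.is_pb.lift (pullback.fst z RX.q1 ≫ v.1) (pullback.snd z RX.q1 ≫ RX.q2)
    (weil_aux hρstr v.1 v.2 _ _ pullback.condition) ≫ RL.counit, by
      rw [Category.assoc, ← hρKcounit, ← Category.assoc,
        weil_aux2 hρstr hρK1 hρK2 v.1 v.2 _ _ pullback.condition]⟩ :
    L'.toVecBundleData.Fiber (pullback.snd z RX.q1 ≫ RX.counit))

theorem weilMap_nat (hρstr : ρ ≫ RX.W.str = RL.W.str) (hρK1 : ρK ≫ RX.q1 = RL.q1 ≫ ρ)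
    (hρK2 : ρK ≫ RX.q2 = RL.q2) (hρKcounit : ρK ≫ RX.counit = RL.counit ≫ L'.π)
    {T' T : Scheme.{u}} (g : T' ⟶ T) {z : T ⟶ RX.W.carrier} {z' : T' ⟶ RX.W.carrier}
    (h : g ≫ z = z') (v : {v : T ⟶ RL.W.carrier // v ≫ ρ = z}) :
    PushF.rs g h (weilMap hρstr hρK1 hρK2 hρKcounit v) =
      weilMap hρstr hρK1 hρK2 hρKcounit ⟨g ≫ v.1, by rw [Category.assoc, v.2, h]⟩ := by
  refine Subtype.ext ?_
  show _ ≫ _ ≫ RL.counit = _ ≫ RL.counit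
  rw [← Category.assoc]
  congr 1
  apply RL.is_pb.hom_ext
  · rw [Category.assoc, RL.is_pb.lift_fst, RL.is_pb.lift_fst, pullback.lift_fst_assoc,
      Category.assoc]
  · rw [Category.assoc, RL.is_pb.lift_snd, RL.is_pb.lift_snd, pullback.lift_snd_assoc]

theorem weilMap_bij (hρstr : ρ ≫ RX.W.str = RL.W.str) (hρK1 : ρK ≫ RX.q1 = RL.q1 ≫ ρ)
    (hρK2 : ρK ≫ RX.q2 = RL.q2) (hρKcounit : ρK ≫ RX.counit = RL.counit ≫ L'.π)
    {T : Scheme.{u}} (z : T ⟶ RX.W.carrier) :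
    Function.Bijective (weilMap hρstr hρK1 hρK2 hρKcounit (z := z)) := by
  have hpb : IsPullback (pullback.fst z RX.q1) (pullback.snd z RX.q1 ≫ RX.q2) (z ≫ RX.W.str)
      (Spec.map (CommRingCat.ofHom (algebraMap k k'))) :=
    ((IsPullback.of_hasPullback z RX.q1).flip.paste_horiz RX.is_pb.flip).flip
  constructor
  · intro v v' hvv
    have hvv : _ ≫ RL.counit = _ ≫ RL.counit := congrArg Subtype.val hvv
    obtain ⟨_, _, hu⟩ := RL.universal T (z ≫ RX.W.str) _ _ _ hpb
      (weilMap hρstr hρK1 hρK2 hρKcounit v).1 (by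
        show _ ≫ L'.π ≫ X'.str = _
        rw [← Category.assoc, (weilMap hρstr hρK1 hρK2 hρKcounit v).2, Category.assoc,
          RX.counit_str])
    refine Subtype.ext ((hu v.1 ⟨?_, RL.is_pb.lift _ _
        (weil_aux hρstr v.1 v.2 _ _ pullback.condition), RL.is_pb.lift_fst _ _ _,
        RL.is_pb.lift_snd _ _ _, rfl⟩).trans
      (hu v'.1 ⟨?_, RL.is_pb.lift _ _ (weil_aux hρstr v'.1 v'.2 _ _ pullback.condition),
        RL.is_pb.lift_fst _ _ _, RL.is_pb.lift_snd _ _ _, hvv.symm⟩).symm)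
    · rw [← hρstr, ← Category.assoc, v.2]
    · rw [← hρstr, ← Category.assoc, v'.2]
  · intro a
    obtain ⟨a, ha⟩ := a
    have hstr : a ≫ L'.π ≫ X'.str = pullback.snd z RX.q1 ≫ RX.q2 := by
      rw [← Category.assoc, ha, Category.assoc, RX.counit_str]
    obtain ⟨v, ⟨hv, w, h1, h2, h3⟩, _⟩ := RL.universal T (z ≫ RX.W.str) _ _ _ hpb a hstr
    obtain ⟨_, _, hu⟩ := RX.universal T (z ≫ RX.W.str) _ _ _ hpb (a ≫ L'.π)
      (by rw [Category.assoc, hstr])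
    have hvz : v ≫ ρ = z := by
      refine (hu (v ≫ ρ) ⟨?_, w ≫ ρK, ?_, ?_, ?_⟩).trans
        (hu z ⟨rfl, pullback.snd z RX.q1, pullback.condition.symm, rfl, ha.symm⟩).symm
      · rw [Category.assoc, hρstr, hv]
      · rw [Category.assoc, hρK1, ← Category.assoc, h1, Category.assoc]
      · rw [Category.assoc, hρK2, h2]
      · rw [Category.assoc, hρKcounit, ← Category.assoc, h3]
    refine ⟨⟨v, hvz⟩, Subtype.ext ?_⟩
    show _ ≫ RL.counit = a
    rw [← h3]
    congr 1
    apply RL.is_pb.hom_ext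
    · rw [RL.is_pb.lift_fst, h1]
    · rw [RL.is_pb.lift_snd, h2]

/-- The Weil restriction is a vector bundle. -/
theorem part_one (hρstr : ρ ≫ RX.W.str = RL.W.str) (hρK1 : ρK ≫ RX.q1 = RL.q1 ≫ ρ)
    (hρK2 : ρK ≫ RX.q2 = RL.q2) (hρKcounit : ρK ≫ RX.counit = RL.counit ≫ L'.π)
    : ∃ (E : VecBundle (Module.finrank k k') RX.W.carrier) (φ : E.tot ⟶ RL.W.carrier),
      IsIso φ ∧ φ ≫ ρ = E.π := by
  obtain ⟨E, ⟨P⟩⟩ := exists_push RX.q1 RX.q2 RX.W.str RX.is_pb RX.counit L'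
  let e : ∀ {T : Scheme.{u}} (z : T ⟶ RX.W.carrier), {v : T ⟶ RL.W.carrier // v ≫ ρ = z} ≃
      PushF RX.q1 RX.counit L'.toVecBundleData z := fun {T} z =>
    Equiv.ofBijective _ (weilMap_bij hρstr hρK1 hρK2 hρKcounit z)
  have he : ∀ {T' T : Scheme.{u}} (g : T' ⟶ T) {z : T ⟶ RX.W.carrier} {z' : T' ⟶ RX.W.carrier}
    (h : g ≫ z = z') (v : {v : T ⟶ RL.W.carrier // v ≫ ρ = z}),
    PushF.rs g h (e z v) = e z' ⟨g ≫ v.1, by rw [Category.assoc, v.2, h]⟩ := fun {_ _} g {_ _} h v =>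
      weilMap_nat hρstr hρK1 hρK2 hρKcounit g h v
  let φ := (e E.π).symm (P.Φ E.π ⟨𝟙 _, Category.id_comp _⟩)
  let χ := (P.Φ ρ).symm (e ρ ⟨𝟙 _, Category.id_comp _⟩)
  have h1 : ∀ {T : Scheme.{u}} {z : T ⟶ RX.W.carrier} (a : E.toVecBundleData.Fiber z)
      (h : (a.1 ≫ φ.1) ≫ ρ = z), e z ⟨a.1 ≫ φ.1, h⟩ = P.Φ z a := by
    intro T z a h
    rw [← he a.1 a.2 φ, Equiv.apply_symm_apply, ← P.nat]
    congr 1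
  have h2 : ∀ {T : Scheme.{u}} {z : T ⟶ RX.W.carrier} (v : {v : T ⟶ RL.W.carrier // v ≫ ρ = z})
      (h : (v.1 ≫ χ.1) ≫ E.π = z), P.Φ z ⟨v.1 ≫ χ.1, h⟩ = e z v := by
    intro T z v h
    have := P.nat v.1 v.2 χ
    rw [LinearEquiv.apply_symm_apply, he] at this
    refine this.trans ?_
    congr 1
  refine ⟨E, φ.1, ⟨χ.1, ?_, ?_⟩, φ.2⟩
  · have e1 := h2 φ (by rw [Category.assoc, χ.2, φ.2])
    rw [Equiv.apply_symm_apply] at e1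
    exact congrArg Subtype.val ((P.Φ E.π).injective e1)
  · have e1 := h1 χ (by rw [Category.assoc, φ.2, χ.2])
    rw [LinearEquiv.apply_symm_apply] at e1
    exact congrArg Subtype.val ((e ρ).injective e1)

end Weil

section Tr

variable {Y Y1 Y0 X X1 : Scheme.{u}} {f : Y ⟶ X} {f1 : Y1 ⟶ X1} {w : Y ⟶ Y1} {j : X ⟶ X1}
  {c : Y ⟶ Y0} {c1 : Y1 ⟶ Y0} {L : VecBundleData Y0}

/-- Transport of sections along a cartesian square. -/
theorem exists_tr (hpb : IsPullback f w j f1) (hc : w ≫ c1 = c) : ∃ tr : ∀ {T : Scheme.{u}} {x : T ⟶ X} {x1 : T ⟶ X1} (_ : x ≫ j = x1),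
    PushF f1 c1 L x1 → PushF f c L x,
    (∀ {T : Scheme.{u}} {x : T ⟶ X} {x1 : T ⟶ X1} (h : x ≫ j = x1),
      Function.Bijective (tr h)) ∧
    (∀ {T' T : Scheme.{u}} (g : T' ⟶ T) {x : T ⟶ X} {x1 : T ⟶ X1} (h : x ≫ j = x1) {y : T' ⟶ X}
      {y1 : T' ⟶ X1} (hy : g ≫ x = y) (hy1 : g ≫ x1 = y1) (h' : y ≫ j = y1) (a : PushF f1 c1 L x1),
      PushF.rs g hy (tr h a) = tr h' (PushF.rs g hy1 a)) := by
  let tr : ∀ {T : Scheme.{u}} {x : T ⟶ X} {x1 : T ⟶ X1} (_ : x ≫ j = x1),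
    PushF f1 c1 L x1 → PushF f c L x := fun {T x x1} h a =>
    a.ev (pullback.fst x f) (pullback.snd x f ≫ w) (by
      rw [← h, ← Category.assoc, pullback.condition, Category.assoc, hpb.w, Category.assoc])
      (by rw [Category.assoc, hc])
  have tr_ev : ∀ {T : Scheme.{u}} {x : T ⟶ X} {x1 : T ⟶ X1} (h : x ≫ j = x1) (a : PushF f1 c1 L x1)
      {S : Scheme.{u}} (t : S ⟶ T) (y : S ⟶ Y) (h1 : t ≫ x = y ≫ f)
      (h2 : t ≫ x1 = (y ≫ w) ≫ f1) {z : S ⟶ Y0} (hz : y ≫ c = z),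
      (tr h a).ev t y h1 hz = a.ev t (y ≫ w) h2 (by rw [Category.assoc, hc, hz]) := by
    intro T x x1 h a S t y h1 h2 z hz
    refine (PushF.res_ev a _ _ _ _ _ _ ?_).trans (PushF.ev_congr a ?_ ?_ _ _ _ _)
    · rw [pullback.lift_fst, pullback.lift_snd_assoc, h2]
    · rw [pullback.lift_fst]
    · rw [pullback.lift_snd_assoc]
  refine ⟨@tr, ?_, ?_⟩
  · intro T x x1 h
    constructor
    · intro a b hab
      refine PushF.ext fun {S} t y1 hty => ?_
      have hl : (t ≫ x) ≫ j = y1 ≫ f1 := by rw [Category.assoc, h, hty]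
      have hs : hpb.lift (t ≫ x) y1 hl ≫ w = y1 := hpb.lift_snd _ _ _
      have h2 : t ≫ x1 = (hpb.lift (t ≫ x) y1 hl ≫ w) ≫ f1 := by rw [hs, hty]
      have hz : hpb.lift (t ≫ x) y1 hl ≫ c = y1 ≫ c1 := by rw [← hc, ← Category.assoc, hs]
      have e := congrArg (fun z : PushF f c L x => z.ev t (hpb.lift (t ≫ x) y1 hl)
        (hpb.lift_fst _ _ _).symm (z := y1 ≫ c1) hz) hab
      have e := (tr_ev h a _ _ _ h2 hz).symm.trans (e.trans (tr_ev h b _ _ _ h2 hz))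
      exact (PushF.ev_congr a rfl hs.symm _ _ _ _).trans (e.trans (PushF.ev_congr b rfl hs _ _ _ _))
    · intro b
      have hl : (pullback.fst x1 f1 ≫ x) ≫ j = pullback.snd x1 f1 ≫ f1 := by
        rw [Category.assoc, h, pullback.condition]
      have hs : hpb.lift _ _ hl ≫ w = pullback.snd x1 f1 := hpb.lift_snd _ _ _
      have hf : hpb.lift _ _ hl ≫ f = pullback.fst x1 f1 ≫ x := hpb.lift_fst _ _ _
      let a : PushF f1 c1 L x1 := b.ev (pullback.fst x1 f1) (hpb.lift _ _ hl) hf.symm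
        (by rw [← hc, ← Category.assoc, hs])
      refine ⟨a, PushF.ext fun {S} t y hty => ?_⟩
      have h2 : t ≫ x1 = (y ≫ w) ≫ f1 := by
        rw [← h, ← Category.assoc, hty, Category.assoc, hpb.w, Category.assoc]
      have e1 : pullback.lift t (y ≫ w) h2 ≫ hpb.lift _ _ hl = y := by
        apply hpb.hom_ext
        · rw [Category.assoc, hf, pullback.lift_fst_assoc, hty]
        · rw [Category.assoc, hs, pullback.lift_snd]
      refine (tr_ev h a t y hty h2 rfl).trans ?_
      refine (PushF.res_ev b _ _ _ _ _ _ ?_).trans (PushF.ev_congr b ?_ e1 _ _ _ _)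
      · rw [e1, pullback.lift_fst, hty]
      · rw [pullback.lift_fst]
  · intro T' T g x x1 h y y1 hy hy1 h' a
    refine PushF.ext fun {S} t s hts => ?_
    have h2 : t ≫ y1 = (s ≫ w) ≫ f1 := by
      rw [← h', ← Category.assoc, hts, Category.assoc, hpb.w, Category.assoc]
    have h3 : (t ≫ g) ≫ x1 = (s ≫ w) ≫ f1 := by rw [Category.assoc, hy1, h2]
    have h4 : (t ≫ g) ≫ x = s ≫ f := by rw [Category.assoc, hy, hts]
    exact (PushF.ev_rs g hy (tr h a) t s hts rfl h4).trans ((tr_ev h a _ _ _ h3 rfl).trans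
      ((tr_ev h' _ t s hts h2 rfl).trans (PushF.ev_rs g hy1 a t _ h2 _ h3)).symm)

end Tr

end WRN

namespace WRN

theorem triv_basis {Y : Scheme.{u}} {triv : LineBundle Y} (h : IsTrivialBundle triv) :
    ∃ σ : Fin 1 → triv.toVecBundleData.Fiber (𝟙 Y), IsBas σ := by
  obtain ⟨s, hs, hb⟩ := h
  refine ⟨fun i => ⟨s i, hs i⟩, ?_⟩
  intro S g
  have hx := hb (g ≫ 𝟙 Y)
  refine Eq.mp (congrArg Function.Bijective ?_) hx
  funext d
  refine Finset.sum_congr rfl fun i _ => congrArg _ (Subtype.ext ?_)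
  show (g ≫ 𝟙 Y) ≫ s i = g ≫ s i
  rw [Category.comp_id]

theorem push_triv_basis {k k' : Type u} [Field k] [Field k'] [Algebra k k'] [FiniteDimensional k k']
    {Y X : Scheme.{u}} {f : Y ⟶ X} {q : Y ⟶ Spk k'} {s : X ⟶ Spk k}
    (hf : IsPullback f q s (Spec.map (CommRingCat.ofHom (algebraMap k k'))))
    {triv : LineBundle Y} (h : IsTrivialBundle triv) {E0 : VecBundle (Module.finrank k k') X}
    (P : PushData f (𝟙 Y) triv.toVecBundleData E0) :
    ∃ v : Fin (Module.finrank k k') → E0.toVecBundleData.Fiber (𝟙 X), IsBas v := by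
  obtain ⟨σ, hσ⟩ := triv_basis h
  have := pushMF_bas f q s hf (𝟙 Y) triv.toVecBundleData (𝟙 X)
    (fun i => res triv.toVecBundleData (pullback.snd (𝟙 X) f) rfl (σ i)) (hσ.res _ _)
  exact ⟨_, P.bas this⟩

theorem norm_fiso {k k' : Type u} [Field k] [Field k'] [Algebra k k'] [FiniteDimensional k k']
    {Y X : Scheme.{u}} {f : Y ⟶ X} {q : Y ⟶ Spk k'} {s : X ⟶ Spk k}
    (hf : IsPullback f q s (Spec.map (CommRingCat.ofHom (algebraMap k k'))))
    {L' : LineBundle Y} {N : LineBundle X} (h : IsNormBundle f (Module.finrank k k') L' N) :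
    ∃ (E1 : VecBundle (Module.finrank k k') X) (D1 : LineBundle X)
      (_ : PushData f (𝟙 Y) L'.toVecBundleData E1) (_ : DetData E1 D1),
      FIso N.toVecBundleData D1.toVecBundleData (𝟙 X) (𝟙 X) := by
  obtain ⟨triv, ht, E1, E0, h1, h0, D1, D0, hd1, hd0, Tn, hT, hi⟩ := h
  obtain ⟨P1⟩ := IsPushforwardBundle.exists_pushData h1
  obtain ⟨P0⟩ := IsPushforwardBundle.exists_pushData h0
  obtain ⟨d1⟩ := IsDetBundle.exists_detData hd1
  obtain ⟨d0⟩ := IsDetBundle.exists_detData hd0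
  obtain ⟨v, hv⟩ := push_triv_basis hf ht P0
  exact ⟨E1, D1, P1, d1, (IsTensor.fiso hT _ (d0.bas hv)).trans (VBIso.fiso hi _)⟩

theorem part_two {k : Type u} [Field k] {k' : Type u} [Field k'] [Algebra k k'] [FiniteDimensional k k']
    {X : SchemeOver k}
    {X' : SchemeOver k'} {prX : X'.carrier ⟶ X.carrier}
    (hXpb : IsPullback prX X'.str X.str (Spec.map (CommRingCat.ofHom (algebraMap k k'))))
    {L' : LineBundle X'.carrier}
    {RX : WeilRestrictionData k k' X'}
    {RL : WeilRestrictionData k k' ⟨L'.tot, L'.π ≫ X'.str⟩}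
    {ρ : RL.W.carrier ⟶ RX.W.carrier} (hρstr : ρ ≫ RX.W.str = RL.W.str)
    {ρK : RL.WK ⟶ RX.WK} (hρK1 : ρK ≫ RX.q1 = RL.q1 ≫ ρ) (hρK2 : ρK ≫ RX.q2 = RL.q2)
    (hρKcounit : ρK ≫ RX.counit = RL.counit ≫ L'.π)
    {jX : X.carrier ⟶ RX.W.carrier} (hjXstr : jX ≫ RX.W.str = X.str)
    (hjX : ∃ w : X'.carrier ⟶ RX.WK,
      w ≫ RX.q1 = prX ≫ jX ∧ w ≫ RX.q2 = X'.str ∧ w ≫ RX.counit = 𝟙 X'.carrier)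
    (E : VecBundle (Module.finrank k k') RX.W.carrier) (φ : E.tot ⟶ RL.W.carrier)
    (hφ : IsIso φ) (hφρ : φ ≫ ρ = E.π)
    (D : LineBundle RX.W.carrier) (hD : IsDetBundle E D)
    (PD : LineBundle X.carrier) (hPD : IsPullbackBundle jX D PD)
    (N : LineBundle X.carrier) (hN : IsNormBundle prX (Module.finrank k k') L' N) :
    VBIso N PD := by
  obtain ⟨w, hw1, hw2, hwc⟩ := hjX
  obtain ⟨E1, D1, P1, d1, h1⟩ := norm_fiso hXpb hN
  obtain ⟨d⟩ := IsDetBundle.exists_detData hD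
  have hpb : IsPullback prX w jX RX.q1 := by
    refine IsPullback.of_bot (t := RX.is_pb) ?_ hw1.symm
    rw [hw2, hjXstr]; exact hXpb
  obtain ⟨tr, tr_bij, tr_nat⟩ := exists_tr (L := L'.toVecBundleData) hpb hwc
  have h2 : FIso E.toVecBundleData E1.toVecBundleData jX (𝟙 X.carrier) := by
    refine FIso.of_nmap ⟨fun {S} g {y y'} h h' a => (P1.Φ y').symm (tr (x := y') (x1 := y)
      (by rw [← h', ← h, Category.comp_id]) (weilMap hρstr hρK1 hρK2 hρKcounit
        ⟨a.1 ≫ φ, by rw [Category.assoc, hφρ, a.2]⟩)), ?_⟩ ?_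
    · intro S' S t g y y' z z' h h' k k' a
      rw [P1.nat_symm]
      congr 1
      rw [tr_nat (hy1 := k) (h' := by rw [← k', ← k, ← h, ← h', Category.comp_id, Category.assoc])]
      congr 1
      rw [weilMap_nat]
      congr 1
    · intro S g y y' h h'
      refine (P1.Φ y').symm.bijective.comp ((tr_bij _).comp ((weilMap_bij _ _ _ _ _).comp ⟨?_, ?_⟩))
      · intro a b hab
        have hab : a.1 ≫ φ = b.1 ≫ φ := congrArg Subtype.val hab
        exact Subtype.ext ((cancel_mono φ).1 hab)
      · intro v
        refine ⟨⟨v.1 ≫ inv φ, ?_⟩, Subtype.ext ?_⟩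
        · rw [← hφρ, Category.assoc, IsIso.inv_hom_id_assoc, v.2]
        · show (v.1 ≫ inv φ) ≫ φ = v.1
          rw [Category.assoc, IsIso.inv_hom_id, Category.comp_id]
  exact (h1.trans ((FIso.det d d1 h2).symm.trans (IsPullbackBundle.fiso hPD).symm)).vbiso

end WRN

namespace WRN

theorem freeMF_bas {X T : Scheme.{u}} (x : T ⟶ X) :
    (freeMF 1 X).Bas (x := x) (n := 1) (fun _ => (fun _ => 1 : Fin 1 → Γ(T, ⊤))) := by
  intro S g y h
  have e : ∀ f : Fin 1 → Γ(S, ⊤), (∑ i, f i • (freeMF 1 X).res g h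
      ((fun _ => 1 : Fin 1 → Γ(T, ⊤)) : (freeMF 1 X).F x)) = f := by
    intro f
    rw [Fin.sum_univ_one]
    funext j
    have hj : j = 0 := Subsingleton.elim _ _
    subst hj
    show f 0 * g.appTop 1 = f 0
    rw [map_one, mul_one]
  constructor
  · intro f f' hf
    exact (e f).symm.trans (hf.trans (e f'))
  · intro f
    exact ⟨f, e f⟩

theorem exists_triv (Y : Scheme.{u}) : ∃ L : LineBundle Y, IsTrivialBundle L := by
  obtain ⟨E, Φ, hΦ⟩ := (freeMF 1 Y).exists_bundle (n := 1) (fun p => ⟨⊤, trivial, _, freeMF_bas _⟩)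
  let σ : Fin 1 → E.toVecBundleData.Fiber (𝟙 Y) := fun _ =>
    (Φ (𝟙 Y)).symm ((fun _ => 1 : Fin 1 → Γ(Y, ⊤)) : (freeMF 1 Y).F (𝟙 Y))
  refine ⟨E, fun i => (σ i).1, fun i => (σ i).2, ?_⟩
  intro T x
  have hb := freeMF_bas (𝟙 Y) x (Category.comp_id x)
  refine (Function.Bijective.of_comp_iff' (Φ x).bijective _).1 ?_
  refine Eq.mp (congrArg Function.Bijective ?_) hb
  funext d
  show _ = Φ x (∑ i, _)
  rw [map_sum]
  refine Finset.sum_congr rfl fun i _ => ?_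
  rw [map_smul]
  congr 1
  have := hΦ x (Category.comp_id x) (σ i)
  have e2 : Φ (𝟙 Y) (σ i) = _ := LinearEquiv.apply_symm_apply _ _
  rw [e2] at this
  exact this.symm

theorem isTensor_triv {X : Scheme.{u}} (L M : LineBundle X) (d : M.toVecBundleData.Fiber (𝟙 X))
    (hd : IsBas (fun _ : Fin 1 => d)) : IsTensor L M L := by
  have hdy : ∀ {S : Scheme.{u}} (y : S ⟶ X), (y ≫ d.1) ≫ M.π = y := by
    intro S y
    rw [Category.assoc, d.2, Category.comp_id]
  have hbij : ∀ {S : Scheme.{u}} (y : S ⟶ X), Function.Bijective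
      (fun f : Γ(S, ⊤) => f • (⟨y ≫ d.1, hdy y⟩ : M.toVecBundleData.Fiber y)) := fun {S} y =>
    (hd.res y (Category.comp_id y)).one_bij
  have hex : ∀ {S : Scheme.{u}} (b : S ⟶ M.tot), ∃ c : Γ(S, ⊤),
      M.smul c ((b ≫ M.π) ≫ d.1) = b := by
    intro S b
    obtain ⟨c, hc⟩ := (hbij (b ≫ M.π)).2 ⟨b, rfl⟩
    exact ⟨c, congrArg Subtype.val hc⟩
  obtain ⟨cf, hcf⟩ : ∃ cf : ∀ {S : Scheme.{u}} (_ : S ⟶ M.tot), Γ(S, ⊤),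
      ∀ {S : Scheme.{u}} (b : S ⟶ M.tot), M.smul (cf b) ((b ≫ M.π) ≫ d.1) = b :=
    ⟨fun {S} b => (hex b).choose, fun {S} b => (hex b).choose_spec⟩
  have hu : ∀ {S : Scheme.{u}} (b : S ⟶ M.tot) (y : S ⟶ X) (c : Γ(S, ⊤)), b ≫ M.π = y →
      M.smul c (y ≫ d.1) = b → cf b = c := by
    intro S b y c hy hc
    subst hy
    exact (hbij (b ≫ M.π)).1 (Subtype.ext ((hcf b).trans hc.symm))
  refine ⟨fun {T} a b _ => L.smul (cf b) a, ?_, ?_, ?_, ?_, ?_, ?_, ?_⟩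
  · intro T a b h
    exact L.smul_π _ _
  · intro T' T g a b h h'
    dsimp only
    rw [L.smul_natural]
    congr 1
    refine (hu _ (g ≫ b ≫ M.π) _ (Category.assoc _ _ _) ?_).symm
    conv_rhs => rw [← hcf b]
    rw [M.smul_natural, Category.assoc]
  · intro T a a' b h1 h2 h3 h4 h5
    exact L.smul_add _ _ _ _ _
  · intro T a b b' h1 h2 h3 h4 h5
    dsimp only at h5 ⊢
    have : cf (M.add b b' h1) = cf b + cf b' := by
      refine hu _ (b ≫ M.π) _ (M.add_π _ _ _) ?_
      rw [M.add_smul _ _ _ (by rw [M.smul_π, M.smul_π])]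
      refine M.add_congr (hcf b) ?_ _ _
      rw [h1, hcf b']
    rw [this, L.add_smul]
  · intro T f a b h1 h2
    dsimp only
    rw [← L.mul_smul, ← L.mul_smul, mul_comm]
  · intro T f a b h1 h2
    dsimp only
    have : cf (M.smul f b) = f * cf b := by
      refine hu _ (b ≫ M.π) _ (M.smul_π _ _) ?_
      rw [M.mul_smul, hcf b]
    rw [this, L.mul_smul]
  · intro U sL sM hL hM h
    obtain ⟨hs, hL⟩ := (isFrame_iff _ _).1 hL
    obtain ⟨ht, hM⟩ := (isFrame_iff _ _).1 hM
    rw [isFrame_iff]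
    have hL' : IsBas (fun _ : Fin 1 => (⟨sL 0, hs 0⟩ : L.toVecBundleData.Fiber U.ι)) := by
      refine Eq.mp (congrArg IsBas ?_) hL
      funext i
      have hi : i = 0 := Subsingleton.elim _ _
      rw [hi]
    have hM' : IsBas (fun _ : Fin 1 => (⟨sM 0, ht 0⟩ : M.toVecBundleData.Fiber U.ι)) := by
      refine Eq.mp (congrArg IsBas ?_) hM
      funext i
      have hi : i = 0 := Subsingleton.elim _ _
      rw [hi]
    refine ⟨fun _ => (L.smul_π _ _).trans (hs 0), hL'.one_smul_unit (d := cf (sM 0)) ?_⟩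
    obtain ⟨e, he⟩ := hM'.one_bij.2 ⟨U.ι ≫ d.1, hdy _⟩
    have he : M.smul e (sM 0) = U.ι ≫ d.1 := congrArg Subtype.val he
    refine IsUnit.of_mul_eq_one e (hM'.one_bij.1 (Subtype.ext ?_))
    show M.smul (cf (sM 0) * e) (sM 0) = M.smul 1 (sM 0)
    rw [M.mul_smul, he, M.one_smul]
    have := hcf (sM 0)
    rwa [ht 0] at this

theorem exists_norm {k k' : Type u} [Field k] [Field k'] [Algebra k k'] [FiniteDimensional k k']
    {Y X : Scheme.{u}} {f : Y ⟶ X} {q : Y ⟶ Spk k'} {s : X ⟶ Spk k}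
    (hf : IsPullback f q s (Spec.map (CommRingCat.ofHom (algebraMap k k'))))
    (L' : LineBundle Y) :
    ∃ N : LineBundle X, IsNormBundle f (Module.finrank k k') L' N := by
  obtain ⟨triv, ht⟩ := exists_triv Y
  obtain ⟨E1, ⟨P1⟩⟩ := exists_push f q s hf (𝟙 Y) L'
  obtain ⟨E0, ⟨P0⟩⟩ := exists_push f q s hf (𝟙 Y) triv
  obtain ⟨D1, ⟨d1⟩⟩ := exists_det E1
  obtain ⟨D0, ⟨d0⟩⟩ := exists_det E0
  obtain ⟨v, hv⟩ := push_triv_basis hf ht P0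
  refine ⟨D1, triv, ht, E1, E0, P1.isPushforwardBundle, P0.isPushforwardBundle, D1, D0,
    d1.isDetBundle, d0.isDetBundle, D1, isTensor_triv D1 D0 _ (d0.bas hv), 𝟙 _, ⟨?_, ?_, ?_⟩,
    inferInstance⟩
  · exact Category.id_comp _
  · intro T a b h h'
    exact (Category.comp_id _).trans
      (D1.add_congr (Category.comp_id _).symm (Category.comp_id _).symm _ _)
  · intro T c a
    rw [Category.comp_id, Category.comp_id]

end WRN

namespace WRN

/-- A linearization, expressed on the fibers. -/
structure FLin {k : Type u} [Field k] {G : GroupSchemeOver k} {X : SchemeOver k}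
    (α : ActionOver G X) (E : VecBundleData X.carrier) where
  m : ∀ {T : Scheme.{u}} (g : T ⟶ G.carrier) {x x' : T ⟶ X.carrier} (h : g ≫ G.str = x ≫ X.str)
    (_ : α.act g x h = x'), E.Fiber x →ₗ[Γ(T, ⊤)] E.Fiber x'
  nat : ∀ {T' T : Scheme.{u}} (f : T' ⟶ T) (g : T ⟶ G.carrier) {x x' : T ⟶ X.carrier}
    {y y' : T' ⟶ X.carrier} (h : g ≫ G.str = x ≫ X.str) (h' : α.act g x h = x')
    (l : f ≫ x = y) (l' : f ≫ x' = y') (hh : (f ≫ g) ≫ G.str = y ≫ X.str)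
    (hh' : α.act (f ≫ g) y hh = y') (a : E.Fiber x),
    res E f l' (m g h h' a) = m (f ≫ g) hh hh' (res E f l a)
  one : ∀ {T : Scheme.{u}} (g : T ⟶ G.carrier) {x : T ⟶ X.carrier} (h : g ≫ G.str = x ≫ X.str)
    (h' : α.act g x h = x) (_ : g = (x ≫ X.str) ≫ G.one) (a : E.Fiber x), m g h h' a = a
  mul : ∀ {T : Scheme.{u}} (g g' : T ⟶ G.carrier) {x x' x'' : T ⟶ X.carrier} (h₁ h₂ h₃ h₄)
    (h₂' : α.act (G.mul g g' h₁) x h₂ = x'') (h₃' : α.act g' x h₃ = x') (h₄' : α.act g x' h₄ = x'')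
    (a : E.Fiber x), m (G.mul g g' h₁) h₂ h₂' a = m g h₄ h₄' (m g' h₃ h₃' a)

namespace FLin

variable {k : Type u} [Field k] {G : GroupSchemeOver k} {X : SchemeOver k}
    {α : ActionOver G X}

theorem m_congr {E : VecBundleData X.carrier} (Λ : FLin α E) {T : Scheme.{u}}
    {g g' : T ⟶ G.carrier} {x y x' : T ⟶ X.carrier} (h : g ≫ G.str = x ≫ X.str)
    (h' : α.act g x h = x') (hh : g' ≫ G.str = y ≫ X.str) (hh' : α.act g' y hh = x')
    (hg : g = g') (a : E.Fiber x) (b : E.Fiber y) (hab : a.1 = b.1) :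
    Λ.m g h h' a = Λ.m g' hh hh' b := by
  obtain ⟨a, rfl⟩ := a
  obtain ⟨b, rfl⟩ := b
  subst hg
  have hab : a = b := hab
  subst hab
  rfl

/-- From linearizations to fiberwise linearizations. -/
def ofData {n : ℕ} {E : VecBundle n X.carrier} (Λ : LinearizationData α E) :
    FLin α E.toVecBundleData where
  m {_} g {_ _} h h' :=
    { toFun := fun a => ⟨Λ.lact g a.1 (by rw [a.2, h]), by
        rw [Λ.lact_π _ _ _ (by rw [a.2, h]), ← h']; exact α.act_congr rfl a.2 _ _⟩
      map_add' := fun a b => Subtype.ext (Λ.lact_add _ _ _ _ _ _ _ _)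
      map_smul' := fun c a => Subtype.ext (Λ.lact_smul _ _ _ _ _) }
  nat {_ _} f g {_ _ _ _} h h' l l' hh hh' a := Subtype.ext (Λ.lact_natural _ _ _ _ _)
  one {_} g {_} h h' hg a := Subtype.ext (by
    obtain ⟨a, rfl⟩ := a
    subst hg
    exact Λ.one_lact a _)
  mul {_} g g' {_ _ _} h₁ h₂ h₃ h₄ h₂' h₃' h₄' a := Subtype.ext (Λ.mul_lact _ _ _ _ _ _ _)

/-- From fiberwise linearizations to linearizations. -/
theorem isLinearized {n : ℕ} {E : VecBundle n X.carrier} (Λ : FLin α E.toVecBundleData) :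
    α.IsLinearized E := by
  obtain ⟨lact, hl⟩ : ∃ lact : ∀ {T : Scheme.{u}} (g : T ⟶ G.carrier) (e : T ⟶ E.tot),
      g ≫ G.str = (e ≫ E.π) ≫ X.str → (T ⟶ E.tot),
      ∀ {T : Scheme.{u}} (g : T ⟶ G.carrier) {x x' : T ⟶ X.carrier} (a : E.toVecBundleData.Fiber x)
        (h0 : g ≫ G.str = (a.1 ≫ E.π) ≫ X.str) (h : g ≫ G.str = x ≫ X.str)
        (h' : α.act g x h = x'), lact g a.1 h0 = (Λ.m g h h' a).1 := by
    refine ⟨fun {T} g e h => (Λ.m g (x := e ≫ E.π) h rfl ⟨e, rfl⟩).1, ?_⟩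
    intro T g x x' a h0 h h'
    obtain ⟨a, rfl⟩ := a
    subst h'
    rfl
  refine ⟨⟨@lact, ?_, ?_, ?_, ?_, ?_, ?_⟩⟩
  · intro T g e h h'
    have := hl g (⟨e, rfl⟩ : E.toVecBundleData.Fiber (e ≫ E.π)) h h' rfl
    rw [show lact g e h = _ from this]
    exact (Λ.m g h' rfl _).2
  · intro T' T f g e h h'
    have h1 := hl g (⟨e, rfl⟩ : E.toVecBundleData.Fiber (e ≫ E.π)) h h rfl
    have hh : (f ≫ g) ≫ G.str = (f ≫ e ≫ E.π) ≫ X.str := by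
      rw [h']; simp only [Category.assoc]
    have hh' : α.act (f ≫ g) (f ≫ e ≫ E.π) hh = f ≫ α.act g (e ≫ E.π) h :=
      (α.act_natural _ _ _ _ _).symm
    have h2 := hl (f ≫ g) (res E.toVecBundleData f (y := f ≫ e ≫ E.π) rfl
      (⟨e, rfl⟩ : E.toVecBundleData.Fiber (e ≫ E.π))) h' hh hh'
    have h3 := Λ.nat f g (y := f ≫ e ≫ E.π) (y' := f ≫ α.act g (e ≫ E.π) h) h rfl rfl rfl hh hh'
      (⟨e, rfl⟩ : E.toVecBundleData.Fiber (e ≫ E.π))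
    rw [show lact g e h = _ from h1, show lact (f ≫ g) (f ≫ e) h' = _ from h2, ← h3]
    rfl
  · intro T e h
    have ho : α.act (((e ≫ E.π) ≫ X.str) ≫ G.one) (e ≫ E.π) h = e ≫ E.π :=
      (α.act_congr (Category.assoc _ _ _) rfl _ (by rw [← Category.assoc, h])).trans (α.one_act _ _)
    refine (hl _ (⟨e, rfl⟩ : E.toVecBundleData.Fiber (e ≫ E.π)) h h ho).trans ?_
    rw [Λ.one _ _ _ rfl]
  · intro T g g' e h₁ h₂ h₃ h₄
    have h5 : g ≫ G.str = α.act g' (e ≫ E.π) h₃ ≫ X.str := by rw [α.act_str, h₁, h₃]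
    have ho := α.mul_act g g' (e ≫ E.π) h₁ h₂ h₃ h5
    have e1 := hl g' (⟨e, rfl⟩ : E.toVecBundleData.Fiber (e ≫ E.π)) h₃ h₃ rfl
    have e2 := hl (G.mul g g' h₁) (⟨e, rfl⟩ : E.toVecBundleData.Fiber (e ≫ E.π)) h₂ h₂ ho
    refine e2.trans ?_
    rw [Λ.mul g g' h₁ h₂ h₃ h5 ho rfl rfl]
    refine (hl g _ ?_ h5 rfl).symm.trans ?_
    · rw [← e1]; exact h₄
    · congr 1
      exact e1.symm
  · intro T g a b h₁ h₂ h₃ h₄ h₅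
    have ea := hl g (⟨a, rfl⟩ : E.toVecBundleData.Fiber (a ≫ E.π)) h₃ h₃ rfl
    have eb := hl g (⟨b, h₁.symm⟩ : E.toVecBundleData.Fiber (a ≫ E.π)) h₄ h₃ rfl
    have ec := hl g ((⟨a, rfl⟩ : E.toVecBundleData.Fiber (a ≫ E.π)) +
      (⟨b, h₁.symm⟩ : E.toVecBundleData.Fiber (a ≫ E.π))) h₂ h₃ rfl
    have ed := congrArg Subtype.val ((Λ.m g h₃ rfl).map_add
      (⟨a, rfl⟩ : E.toVecBundleData.Fiber (a ≫ E.π))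
      (⟨b, h₁.symm⟩ : E.toVecBundleData.Fiber (a ≫ E.π)))
    exact (ec.trans ed).trans (E.add_congr ea.symm eb.symm _ _)
  · intro T g f a h₁ h₂
    have ea := hl g (⟨a, rfl⟩ : E.toVecBundleData.Fiber (a ≫ E.π)) h₂ h₂ rfl
    have ec := hl g (f • (⟨a, rfl⟩ : E.toVecBundleData.Fiber (a ≫ E.π))) h₁ h₂ rfl
    have ed := congrArg Subtype.val ((Λ.m g h₂ rfl).map_smul f
      (⟨a, rfl⟩ : E.toVecBundleData.Fiber (a ≫ E.π)))
    exact (ec.trans ed).trans (congrArg (E.smul f) ea.symm)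

/-- Transfer of linearizations along isomorphisms. -/
theorem transfer {N D : VecBundleData X.carrier} (Λ : FLin α D)
    (h : FIso N D (𝟙 X.carrier) (𝟙 X.carrier)) : Nonempty (FLin α N) := by
  obtain ⟨ψ, φ, h1, h2⟩ := h
  refine ⟨⟨fun {T} g {x x'} h h' => (φ.app x' (Category.comp_id x') (Category.comp_id x')).comp
    ((Λ.m g h h').comp (ψ.app x (Category.comp_id x) (Category.comp_id x))), ?_, ?_, ?_⟩⟩
  · intro T' T f g x x' y y' h h' l l' hh hh' a
    subst l l'
    refine (φ.nat f x' _ _ rfl rfl _).trans ?_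
    refine congrArg (φ.app (f ≫ x') _ _) ((Λ.nat f g h h' rfl rfl hh hh' _).trans ?_)
    exact congrArg (Λ.m (f ≫ g) _ _) (ψ.nat f x _ _ rfl rfl _)
  · intro T g x h h' hg a
    show φ.app x _ _ (Λ.m g h h' (ψ.app x _ _ a)) = a
    rw [Λ.one g h h' hg]
    exact h1 x _ _ a
  · intro T g g' x x' x'' a1 a2 a3 a4 a2' a3' a4' a
    refine congrArg (φ.app x'' _ _) ((Λ.mul g g' a1 a2 a3 a4 a2' a3' a4' _).trans ?_)
    exact congrArg (Λ.m g _ _) (h2 x' _ _ _).symm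

end FLin

end WRN

namespace WRN

/-- The determinant of a natural linear map on arbitrary families. -/
theorem detMap_all {X X' T : Scheme.{u}} {n : ℕ} {E : VecBundle n X} {D : LineBundle X}
    {E' : VecBundle n X'} {D' : LineBundle X'} (d : DetData E D) (d' : DetData E' D')
    {x : T ⟶ X} {x' : T ⟶ X'} (ψ : FibMap E.toVecBundleData E'.toVecBundleData x x')
    {S : Scheme.{u}} (g : S ⟶ T) {y : S ⟶ X} {y' : S ⟶ X'} (h : g ≫ x = y)
    (h' : g ≫ x' = y') (w : Fin n → E.toVecBundleData.Fiber y) :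
    (detMap d d' ψ).app g h h' (d.δ y w) = d'.δ y' (fun i => ψ.app g h h' (w i)) := by
  apply fib_ext
  intro p
  obtain ⟨V, v, hp, hv⟩ := exists_isBas E y p
  refine ⟨V, hp, ?_⟩
  obtain ⟨A, hA⟩ : ∃ A : Matrix (Fin n) (Fin n) Γ(V.toScheme, ⊤),
      (fun i => res E.toVecBundleData V.ι (y := V.ι ≫ y) rfl (w i)) = fun i => ∑ j, A i j • v j :=
    ⟨Matrix.of fun i => hv.equiv.symm (res E.toVecBundleData V.ι (y := V.ι ≫ y) rfl (w i)),
      funext fun i => (hv.comb_symm _).symm⟩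
  rw [(detMap d d' ψ).nat V.ι g h h' rfl rfl, d.nat, d'.nat, hA]
  rw [alt_comb, map_smul, detMap_bas _ _ _ _ _ _ _ hv, ← alt_comb]
  congr 1
  funext i
  have hAi : res E.toVecBundleData V.ι (y := V.ι ≫ y) rfl (w i) = ∑ j, A i j • v j := congrFun hA i
  rw [ψ.nat V.ι g h h' rfl rfl, hAi, map_sum]
  exact Finset.sum_congr rfl fun j _ => by rw [map_smul]

/-- Pulling back a natural linear map. -/
def FibMap.pull {X X' T T' : Scheme.{u}} {E : VecBundleData X} {E' : VecBundleData X'} {x : T ⟶ X}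
    {x' : T ⟶ X'} (ψ : FibMap E E' x x') (f : T' ⟶ T) {y : T' ⟶ X} {y' : T' ⟶ X'}
    (l : f ≫ x = y) (l' : f ≫ x' = y') : FibMap E E' y y' where
  app {_} t {_ _} h h' := ψ.app (t ≫ f) (by rw [Category.assoc, l, h])
    (by rw [Category.assoc, l', h'])
  nat {_ _} t g {_ _ _ _} h h' k k' a := (ψ.nat t (g ≫ f) _ _ k k' a).trans
    (ψ.app_congr (Category.assoc _ _ _).symm _ _ _)

/-- The identity. -/
def FibMap.idm {X T : Scheme.{u}} (E : VecBundleData X) (x : T ⟶ X) : FibMap E E x x where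
  app {_} _ {_ _} h h' :=
    { toFun := fun a => ⟨a.1, a.2.trans (h.symm.trans h')⟩
      map_add' := fun _ _ => rfl
      map_smul' := fun _ _ => rfl }
  nat {_ _} _ _ {_ _ _ _} _ _ _ _ _ := rfl

namespace FLin

variable {k : Type u} [Field k] {G : GroupSchemeOver k} {X : SchemeOver k}
    {α : ActionOver G X}

/-- The natural linear map attached to a group element. -/
def fm {E : VecBundleData X.carrier} (Λ : FLin α E) {T : Scheme.{u}} (g : T ⟶ G.carrier)
    {x x' : T ⟶ X.carrier} (h : g ≫ G.str = x ≫ X.str) (h' : α.act g x h = x') :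
    FibMap E E x x' where
  app {_} t {y y'} l l' := Λ.m (t ≫ g) (x := y) (x' := y')
    (by rw [Category.assoc, h, ← l, Category.assoc])
    (by subst l l' h'; exact (α.act_natural _ _ _ _ _).symm)
  nat {S' S} t s {y y' z z'} l l' n n' a := by
    refine (Λ.nat t (s ≫ g) _ _ n n' ?_ ?_ a).trans ?_
    · rw [Category.assoc, Category.assoc, h, ← n, ← l, Category.assoc, Category.assoc]
    · subst n n' l l' h'
      rw [α.act_natural _ _ _ _ (by rw [Category.assoc, h, Category.assoc]),
        α.act_natural _ _ _ _ (by rw [Category.assoc, Category.assoc, h, Category.assoc,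
          Category.assoc])]
    · exact Λ.m_congr _ _ _ _ (Category.assoc _ _ _).symm _ _ rfl

theorem fm_app {E : VecBundleData X.carrier} (Λ : FLin α E) {T : Scheme.{u}} (g : T ⟶ G.carrier)
    {x x' : T ⟶ X.carrier} (h : g ≫ G.str = x ≫ X.str) (h' : α.act g x h = x')
    {S : Scheme.{u}} (t : S ⟶ T) {y y' : S ⟶ X.carrier} (l : t ≫ x = y) (l' : t ≫ x' = y')
    (g' : S ⟶ G.carrier) (hg : t ≫ g = g') (e : g' ≫ G.str = y ≫ X.str) (e' : α.act g' y e = y')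
    (a : E.Fiber y) : (Λ.fm g h h').app t l l' a = Λ.m g' e e' a :=
  Λ.m_congr _ _ _ _ hg _ _ rfl

/-- The linearization of the determinant. -/
theorem det {n : ℕ} {E : VecBundle n X.carrier} {D : LineBundle X.carrier}
    (Λ : FLin α E.toVecBundleData) (d : DetData E D) : Nonempty (FLin α D.toVecBundleData) := by
  refine ⟨⟨fun {T} g {x x'} h h' => (detMap d d (Λ.fm g h h')).app (𝟙 T) (Category.id_comp x)
    (Category.id_comp x'), ?_, ?_, ?_⟩⟩
  · intro T' T f g x x' y y' h h' l l' hh hh' a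
    refine ((detMap d d (Λ.fm g h h')).nat f (𝟙 T) _ _ l l' a).trans ?_
    refine ((detMap d d (Λ.fm g h h')).app_congr
      ((Category.comp_id f).trans (Category.id_comp f).symm) _ _ _).trans ?_
    refine detMap_ext d ((detMap d d (Λ.fm g h h')).pull f l l') (detMap d d (Λ.fm (f ≫ g) hh hh'))
      ?_ (𝟙 T') (Category.id_comp y) (Category.id_comp y') _
    intro S t z z' e e' v hv
    refine (detMap_bas d d (Λ.fm g h h') (t ≫ f) _ _ v hv).trans ?_
    refine Eq.trans ?_ (detMap_bas d d (Λ.fm (f ≫ g) hh hh') t _ _ v hv).symm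
    congr 1
  · intro T g x h h' hg a
    refine (detMap_ext d (detMap d d (Λ.fm g h h')) (FibMap.idm _ x)
      ?_ (𝟙 T) (Category.id_comp x) (Category.id_comp x) a).trans rfl
    intro S t z z' e e' v hv
    have ez : z = z' := e.symm.trans e'
    subst ez
    refine (detMap_bas d d (Λ.fm g h h') t _ _ v hv).trans ?_
    refine Eq.trans (b := d.δ z v) ?_ rfl
    congr 1
    funext i
    refine Λ.one _ _ _ ?_ (v i)
    rw [hg, ← e]; simp only [Category.assoc]
  · intro T g g' x x' x'' a1 a2 a3 a4 a2' a3' a4' a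
    refine (detMap_ext d (detMap d d (Λ.fm (G.mul g g' a1) a2 a2'))
      ((detMap d d (Λ.fm g' a3 a3')).comp (detMap d d (Λ.fm g a4 a4')))
      ?_ (𝟙 T) (Category.id_comp x) (Category.id_comp x'') a).trans
      (FibMap.comp_app _ _ _ _ _ _ _)
    intro S t z z' e e' v hv
    refine (detMap_bas d d (Λ.fm (G.mul g g' a1) a2 a2') t _ _ v hv).trans ?_
    refine Eq.trans ?_ (FibMap.comp_app _ _ t _ (y' := t ≫ x') rfl _ _).symm
    rw [detMap_bas d d (Λ.fm g' a3 a3') t _ _ v hv, detMap_all d d (Λ.fm g a4 a4')]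
    congr 1
    funext i
    have b1 : (t ≫ g) ≫ G.str = (t ≫ g') ≫ G.str := by rw [Category.assoc, a1, Category.assoc]
    have b3 : (t ≫ g') ≫ G.str = z ≫ X.str := by rw [Category.assoc, a3, ← e, Category.assoc]
    have b2 : G.mul (t ≫ g) (t ≫ g') b1 ≫ G.str = z ≫ X.str := by rw [G.mul_str, b1, b3]
    have b4 : (t ≫ g) ≫ G.str = (t ≫ x') ≫ X.str := by rw [Category.assoc, a4, Category.assoc]
    have b3' : α.act (t ≫ g') z b3 = t ≫ x' := by
      subst e a3'; exact (α.act_natural _ _ _ _ _).symm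
    have b4' : α.act (t ≫ g) (t ≫ x') b4 = z' := by
      subst e' a4'; exact (α.act_natural _ _ _ _ _).symm
    have b2' : α.act (G.mul (t ≫ g) (t ≫ g') b1) z b2 = z' := by
      rw [α.mul_act (t ≫ g) (t ≫ g') z b1 b2 b3 (by rw [α.act_str, b1, b3]), ← b4']
      exact α.act_congr rfl b3' _ _
    rw [Λ.fm_app _ _ _ t _ _ _ (G.mul_natural t g g' a1 b1) b2 b2',
      Λ.fm_app _ _ _ t _ _ _ rfl b3 b3', Λ.fm_app _ _ _ t _ _ _ rfl b4 b4']
    exact Λ.mul _ _ b1 b2 b3 b4 b2' b3' b4' (v i)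

end FLin

end WRN

namespace WRN

section PushLin

variable {k : Type u} [Field k] {k' : Type u} [Field k'] [Algebra k k']
    {X : SchemeOver k} {X' : SchemeOver k'} {prX : X'.carrier ⟶ X.carrier}
    {G : GroupSchemeOver k} {α : ActionOver G X}
    {G' : GroupSchemeOver k'} {prG : G'.carrier ⟶ G.carrier} {α' : ActionOver G' X'}

theorem lin_lift
    (hXpb : IsPullback prX X'.str X.str (Spec.map (CommRingCat.ofHom (algebraMap k k'))))
    (hGpb : IsPullback prG G'.str G.str (Spec.map (CommRingCat.ofHom (algebraMap k k'))))
    (hαcompat : ∀ {T : Scheme.{u}} (g : T ⟶ G'.carrier) (x : T ⟶ X'.carrier) (h h'),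
      α'.act g x h ≫ prX = α.act (g ≫ prG) (x ≫ prX) h')
    {S : Scheme.{u}} (g : S ⟶ G.carrier) {x x' : S ⟶ X.carrier} (h : g ≫ G.str = x ≫ X.str)
    (h' : α.act g x h = x') (y : S ⟶ X'.carrier) (e : x' = y ≫ prX) :
    ∃ (g' : S ⟶ G'.carrier) (x0 : S ⟶ X'.carrier) (_ : g' ≫ prG = g) (_ : x = x0 ≫ prX)
      (h1 : g' ≫ G'.str = x0 ≫ X'.str), α'.act g' x0 h1 = y := by
  have ex : x ≫ X.str = (y ≫ X'.str) ≫ Spec.map (CommRingCat.ofHom (algebraMap k k')) := by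
    rw [← α.act_str g x h, h', e, Category.assoc, Category.assoc, hXpb.w]
  have h1 : hGpb.lift g (y ≫ X'.str) (h.trans ex) ≫ G'.str =
      hXpb.lift x (y ≫ X'.str) ex ≫ X'.str := by
    rw [hGpb.lift_snd, hXpb.lift_snd]
  refine ⟨hGpb.lift g (y ≫ X'.str) (h.trans ex), hXpb.lift x (y ≫ X'.str) ex, hGpb.lift_fst _ _ _,
    (hXpb.lift_fst _ _ _).symm, h1, ?_⟩
  apply hXpb.hom_ext
  · rw [hαcompat _ _ _ (by rw [hGpb.lift_fst, hXpb.lift_fst, h]), ← e, ← h']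
    exact α.act_congr (hGpb.lift_fst _ _ _) (hXpb.lift_fst _ _ _) _ _
  · rw [α'.act_str, hXpb.lift_snd]

theorem lin_ev_congr {L : VecBundleData X'.carrier} (Λ : FLin α' L) {T S : Scheme.{u}}
    {x : T ⟶ X.carrier} (a : PushF prX (𝟙 X'.carrier) L x) {t t' : S ⟶ T}
    {g g' : S ⟶ G'.carrier} {y y' : S ⟶ X'.carrier} {z : S ⟶ X'.carrier} (ht : t = t') (hg : g = g')
    (hy : y = y') (e : t ≫ x = y ≫ prX) (e' : t' ≫ x = y' ≫ prX) {w w' : S ⟶ X'.carrier}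
    (q : y ≫ 𝟙 _ = w) (q' : y' ≫ 𝟙 _ = w') (h h1 h' h1') :
    Λ.m g (x := w) (x' := z) h h1 (a.ev t y e q) = Λ.m g' (x := w') h' h1' (a.ev t' y' e' q') := by
  subst ht hg hy q q'
  rfl

theorem exists_pushLin
    (hXpb : IsPullback prX X'.str X.str (Spec.map (CommRingCat.ofHom (algebraMap k k'))))
    (hGpb : IsPullback prG G'.str G.str (Spec.map (CommRingCat.ofHom (algebraMap k k'))))
    (hαcompat : ∀ {T : Scheme.{u}} (g : T ⟶ G'.carrier) (x : T ⟶ X'.carrier) (h h'),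
      α'.act g x h ≫ prX = α.act (g ≫ prG) (x ≫ prX) h')
    {L : VecBundleData X'.carrier} (Λ : FLin α' L) {T : Scheme.{u}} (g : T ⟶ G.carrier)
    {x x' : T ⟶ X.carrier} (h : g ≫ G.str = x ≫ X.str) (h' : α.act g x h = x') :
    ∃ M : PushF prX (𝟙 X'.carrier) L x →ₗ[Γ(T, ⊤)] PushF prX (𝟙 X'.carrier) L x',
      ∀ (a : PushF prX (𝟙 X'.carrier) L x) {S : Scheme.{u}} (t : S ⟶ T) (y : S ⟶ X'.carrier)
        (e : t ≫ x' = y ≫ prX) {z : S ⟶ X'.carrier} (hz : y ≫ 𝟙 _ = z) (g' : S ⟶ G'.carrier)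
        (x0 : S ⟶ X'.carrier) {x1 : S ⟶ X'.carrier} (h0 : x0 ≫ 𝟙 _ = x1)
        (_ : g' ≫ prG = t ≫ g) (hx : t ≫ x = x0 ≫ prX)
        (h1 : g' ≫ G'.str = x1 ≫ X'.str) (h2 : α'.act g' x1 h1 = z),
        (M a).ev t y e hz = Λ.m g' h1 h2 (a.ev t x0 hx h0) := by
  obtain ⟨gu, xu, hgu, hxu, hu, hact⟩ := lin_lift hXpb hGpb hαcompat (S := pullback x' prX)
    (pullback.fst x' prX ≫ g) (x := pullback.fst x' prX ≫ x) (x' := pullback.fst x' prX ≫ x')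
    (by rw [Category.assoc, h, Category.assoc])
    (by rw [← h']; exact (α.act_natural _ _ _ _ _).symm)
    (pullback.snd x' prX) pullback.condition
  have hact' : α'.act gu xu hu = pullback.snd x' prX ≫ 𝟙 _ := hact.trans (Category.comp_id _).symm
  refine ⟨{ toFun := fun a => (Λ.m gu hu hact' (a.ev (pullback.fst x' prX) xu hxu
              (Category.comp_id _)) : L.Fiber (pullback.snd x' prX ≫ 𝟙 X'.carrier))
            map_add' := ?_
            map_smul' := ?_ }, ?_⟩
  · intro a b
    exact (congrArg (Λ.m gu hu hact') (PushF.ev_add a b _ _ _ _)).trans (map_add _ _ _)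
  · intro r a
    exact (congrArg (Λ.m gu hu hact') (PushF.ev_smul r a _ _ _ _)).trans (map_smul _ _ _)
  · intro a S t y e z hz g' x0 x1 h0 hg' hx h1 h2
    subst hz h0
    have q1 : pullback.lift t y e ≫ gu = g' := by
      apply hGpb.hom_ext
      · rw [Category.assoc, hgu, pullback.lift_fst_assoc, hg']
      · rw [Category.assoc, hu, ← α'.act_str gu xu hu, hact, pullback.lift_snd_assoc, h1,
          ← α'.act_str g' _ h1, h2, Category.assoc, Category.id_comp]
    have q2 : pullback.lift t y e ≫ xu = x0 := by
      apply hXpb.hom_ext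
      · rw [Category.assoc, ← hxu, pullback.lift_fst_assoc, hx]
      · rw [Category.assoc, ← α'.act_str gu xu hu, hact, pullback.lift_snd_assoc]
        have := α'.act_str g' _ h1
        rw [h2] at this
        simpa using this
    have b1 : (pullback.lift t y e ≫ gu) ≫ G'.str = (pullback.lift t y e ≫ xu) ≫ X'.str := by
      rw [Category.assoc, hu, Category.assoc]
    have b2 : α'.act (pullback.lift t y e ≫ gu) (pullback.lift t y e ≫ xu) b1 = y ≫ 𝟙 _ := by
      rw [← α'.act_natural _ _ _ hu, hact, pullback.lift_snd, Category.comp_id]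
    refine (Λ.nat (pullback.lift t y e) gu hu hact' (y := pullback.lift t y e ≫ xu)
      (y' := y ≫ 𝟙 _) rfl (by rw [pullback.lift_snd_assoc]) b1 b2 _).trans ?_
    rw [PushF.res_ev a (pullback.lift t y e) _ _ _ _ _
      (by rw [Category.assoc, Category.assoc, hxu])]
    exact lin_ev_congr Λ a (pullback.lift_fst _ _ _) q1 q2 _ _ _ _ _ _ _ _

theorem one_compat
    (hGpb : IsPullback prG G'.str G.str (Spec.map (CommRingCat.ofHom (algebraMap k k'))))
    (hGmul : ∀ {T : Scheme.{u}} (a b : T ⟶ G'.carrier) (h h'),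
      G'.mul a b h ≫ prG = G.mul (a ≫ prG) (b ≫ prG) h') :
    G'.one ≫ prG = Spec.map (CommRingCat.ofHom (algebraMap k k')) ≫ G.one := by
  have hs : (G'.one ≫ prG) ≫ G.str = Spec.map (CommRingCat.ofHom (algebraMap k k')) := by
    rw [Category.assoc, hGpb.w, ← Category.assoc, G'.one_str, Category.id_comp]
  have h1 : G'.mul G'.one G'.one rfl = G'.one := by
    refine (G'.mul_congr ?_ rfl _ ?_).trans (G'.one_mul G'.one ?_)
    · rw [← Category.assoc, G'.one_str, Category.id_comp]
    · rw [← Category.assoc, G'.one_str, Category.id_comp, G'.one_str]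
    · rw [← Category.assoc, G'.one_str, Category.id_comp, G'.one_str]
  have h2 := hGmul G'.one G'.one rfl rfl
  rw [h1] at h2
  rw [← hs, Category.assoc]
  generalize G'.one ≫ prG = e at h2 ⊢
  have i1 : G.inv e ≫ G.str = e ≫ G.str := G.inv_str e
  have h3 := G.inv_mul e i1
  have i2 : (e ≫ G.str ≫ G.one) ≫ G.str = e ≫ G.str := by
    rw [Category.assoc, Category.assoc, G.one_str, Category.comp_id]
  have h4 := G.mul_assoc (G.inv e) e e i1 (by rw [G.mul_str, i1]) rfl (by rw [G.mul_str, i1])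
  have h5 : G.mul (G.mul (G.inv e) e i1) e (by rw [G.mul_str, i1]) = e :=
    (G.mul_congr h3 rfl _ i2).trans (G.one_mul e i2)
  have h6 : G.mul (G.inv e) (G.mul e e rfl) (by rw [G.mul_str, i1]) = e ≫ G.str ≫ G.one :=
    (G.mul_congr rfl h2.symm _ i1).trans h3
  exact h5.symm.trans (h4.trans h6)

end PushLin

end WRN

namespace WRN

theorem FLin.push {k : Type u} [Field k] {k' : Type u} [Field k'] [Algebra k k']
    {X : SchemeOver k} {X' : SchemeOver k'} {prX : X'.carrier ⟶ X.carrier}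
    {G : GroupSchemeOver k} {α : ActionOver G X}
    {G' : GroupSchemeOver k'} {prG : G'.carrier ⟶ G.carrier} {α' : ActionOver G' X'}
    (hXpb : IsPullback prX X'.str X.str (Spec.map (CommRingCat.ofHom (algebraMap k k'))))
    (hGpb : IsPullback prG G'.str G.str (Spec.map (CommRingCat.ofHom (algebraMap k k'))))
    (hGmul : ∀ {T : Scheme.{u}} (a b : T ⟶ G'.carrier) (h h'),
      G'.mul a b h ≫ prG = G.mul (a ≫ prG) (b ≫ prG) h')
    (hαcompat : ∀ {T : Scheme.{u}} (g : T ⟶ G'.carrier) (x : T ⟶ X'.carrier) (h h'),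
      α'.act g x h ≫ prX = α.act (g ≫ prG) (x ≫ prX) h')
    {L : VecBundleData X'.carrier} (Λ : FLin α' L) {n : ℕ} {E : VecBundle n X.carrier}
    (P : PushData prX (𝟙 X'.carrier) L E) : Nonempty (FLin α E.toVecBundleData) := by
  obtain ⟨M, hM⟩ : ∃ M : ∀ {T : Scheme.{u}} (g : T ⟶ G.carrier)
      {x x' : T ⟶ X.carrier} (h : g ≫ G.str = x ≫ X.str) (_ : α.act g x h = x'),
      PushF prX (𝟙 X'.carrier) L x →ₗ[Γ(T, ⊤)] PushF prX (𝟙 X'.carrier) L x',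
      ∀ {T : Scheme.{u}} (g : T ⟶ G.carrier)
      {x x' : T ⟶ X.carrier} (h : g ≫ G.str = x ≫ X.str) (h' : α.act g x h = x')
      (a : PushF prX (𝟙 X'.carrier) L x) {S : Scheme.{u}} (t : S ⟶ T) (y : S ⟶ X'.carrier)
        (e : t ≫ x' = y ≫ prX) {z : S ⟶ X'.carrier} (hz : y ≫ 𝟙 _ = z) (g' : S ⟶ G'.carrier)
        (x0 : S ⟶ X'.carrier) {x1 : S ⟶ X'.carrier} (h0 : x0 ≫ 𝟙 _ = x1)
        (_ : g' ≫ prG = t ≫ g) (hx : t ≫ x = x0 ≫ prX)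
        (h1 : g' ≫ G'.str = x1 ≫ X'.str) (h2 : α'.act g' x1 h1 = z),
        (M g h h' a).ev t y e hz = Λ.m g' h1 h2 (a.ev t x0 hx h0) :=
    ⟨fun {T} g {x x'} h h' => Classical.choose (exists_pushLin hXpb hGpb hαcompat Λ g h h'),
      fun {T} g {x x'} h h' => Classical.choose_spec
        (exists_pushLin hXpb hGpb hαcompat Λ g h h')⟩
  have hlift : ∀ {T : Scheme.{u}} (g : T ⟶ G.carrier) {x x' : T ⟶ X.carrier}
      (h : g ≫ G.str = x ≫ X.str) (_ : α.act g x h = x') {S : Scheme.{u}} (t : S ⟶ T)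
      (y : S ⟶ X'.carrier) (_ : t ≫ x' = y ≫ prX),
      ∃ (g' : S ⟶ G'.carrier) (x0 : S ⟶ X'.carrier) (_ : g' ≫ prG = t ≫ g)
        (_ : t ≫ x = x0 ≫ prX) (h1 : g' ≫ G'.str = x0 ≫ X'.str), α'.act g' x0 h1 = y := by
    intro T g x x' h h' S t y e
    exact lin_lift hXpb hGpb hαcompat (t ≫ g) (x := t ≫ x) (x' := t ≫ x')
      (by rw [Category.assoc, h, Category.assoc])
      (by rw [← h']; exact (α.act_natural _ _ _ _ _).symm) y e
  refine ⟨⟨fun {T} g {x x'} h h' => (P.Φ x').symm.toLinearMap.comp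
    ((M g h h').comp (P.Φ x).toLinearMap), ?_, ?_, ?_⟩⟩
  · intro T' T f g x x' y y' h h' l l' hh hh' a
    refine (P.nat_symm f l' _).trans (congrArg (P.Φ y').symm ?_)
    refine Eq.trans ?_ (congrArg (M (f ≫ g) hh hh') (P.nat f l a)).symm
    show PushF.rs f l' (M g h h' (P.Φ x a)) = M (f ≫ g) hh hh' (PushF.rs f l (P.Φ x a))
    generalize P.Φ x a = b
    apply PushF.ext
    intro S t s e
    obtain ⟨g', x0, q1, q2, h1, h2⟩ := hlift (f ≫ g) hh hh' t s e
    have h2' : α'.act g' x0 h1 = s ≫ 𝟙 _ := h2.trans (Category.comp_id _).symm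
    have q3 : (t ≫ f) ≫ x = x0 ≫ prX := by rw [Category.assoc, l, q2]
    rw [PushF.ev_rs f l' _ t s e rfl (by rw [Category.assoc, l', e]),
      hM (f ≫ g) hh hh' _ t s e rfl g' x0 (Category.comp_id _) q1 q2 h1 h2',
      hM g h h' b (t ≫ f) s _ rfl g' x0 (Category.comp_id _) (by rw [q1, Category.assoc]) q3 h1 h2',
      PushF.ev_rs f l b t x0 q2 _ q3]
  · intro T g x h h' hg a
    show (P.Φ x).symm (M g h h' (P.Φ x a)) = a
    rw [LinearEquiv.symm_apply_eq]
    generalize P.Φ x a = b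
    apply PushF.ext
    intro S t s e
    have q1 : ((s ≫ X'.str) ≫ G'.one) ≫ prG = t ≫ g := by
      rw [hg, Category.assoc, one_compat hGpb hGmul, ← Category.assoc, Category.assoc s, ← hXpb.w,
        ← Category.assoc s, ← e]
      simp only [Category.assoc]
    have h1 : ((s ≫ X'.str) ≫ G'.one) ≫ G'.str = (s ≫ 𝟙 _) ≫ X'.str := by
      rw [Category.comp_id s, Category.assoc, G'.one_str]; exact Category.comp_id _
    have hE : (s ≫ X'.str) ≫ G'.one = ((s ≫ 𝟙 X'.carrier) ≫ X'.str) ≫ G'.one := by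
      rw [Category.comp_id]
    have h2 : α'.act ((s ≫ X'.str) ≫ G'.one) (s ≫ 𝟙 _) h1 = s ≫ 𝟙 _ := by
      have h3 : ((s ≫ 𝟙 X'.carrier) ≫ X'.str ≫ G'.one) ≫ G'.str = (s ≫ 𝟙 _) ≫ X'.str := by
        rw [← Category.assoc, ← hE]; exact h1
      exact (α'.act_congr (hE.trans (Category.assoc _ _ _)) rfl h1 h3).trans (α'.one_act _ h3)
    rw [hM g h h' b t s e rfl ((s ≫ X'.str) ≫ G'.one) s rfl q1 e h1 h2]
    exact Λ.one _ _ _ hE _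
  · intro T g g' x x' x'' a1 a2 a3 a4 a2' a3' a4' a
    refine congrArg (P.Φ x'').symm ?_
    show M (G.mul g g' a1) a2 a2' (P.Φ x a) =
      M g a4 a4' (P.Φ x' ((P.Φ x').symm (M g' a3 a3' (P.Φ x a))))
    rw [LinearEquiv.apply_symm_apply]
    generalize P.Φ x a = b
    apply PushF.ext
    intro S t s e
    obtain ⟨γ, x1, q1, q2, h1, h2⟩ := hlift g a4 a4' t s e
    obtain ⟨γ', x0, q1', q2', h1', h2'⟩ := hlift g' a3 a3' t x1 q2
    have h2s : α'.act γ x1 h1 = s ≫ 𝟙 _ := h2.trans (Category.comp_id _).symm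
    have b1 : γ ≫ G'.str = γ' ≫ G'.str := by rw [h1, h1', ← h2', α'.act_str]
    have b2 : G'.mul γ γ' b1 ≫ G'.str = x0 ≫ X'.str := by rw [G'.mul_str, b1, h1']
    have b3 : α'.act (G'.mul γ γ' b1) x0 b2 = s ≫ 𝟙 _ := by
      rw [α'.mul_act γ γ' x0 b1 b2 h1' (by rw [α'.act_str, b1, h1']), ← h2s]
      exact α'.act_congr rfl h2' _ _
    have b4 : G'.mul γ γ' b1 ≫ prG = t ≫ G.mul g g' a1 := by
      have c1 : (t ≫ g) ≫ G.str = (t ≫ g') ≫ G.str := by rw [Category.assoc, a1, Category.assoc]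
      rw [hGmul γ γ' b1 (by rw [q1, q1', c1]), G.mul_natural t g g' a1 c1]
      exact G.mul_congr q1 q1' _ _
    rw [hM _ a2 a2' b t s e rfl (G'.mul γ γ' b1) x0 (Category.comp_id _) b4 q2' b2 b3,
      hM g a4 a4' _ t s e rfl γ x1 (Category.comp_id _) q1 q2 h1 h2s,
      hM g' a3 a3' b t x1 q2 (Category.comp_id _) γ' x0 (Category.comp_id _) q1' q2' h1' h2']
    exact Λ.mul _ _ _ _ _ _ _ _ _ _

theorem part_three {k : Type u} [Field k] {k' : Type u} [Field k'] [Algebra k k']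
    [FiniteDimensional k k']
    {X : SchemeOver k} {X' : SchemeOver k'} {prX : X'.carrier ⟶ X.carrier}
    {G : GroupSchemeOver k} {α : ActionOver G X}
    {G' : GroupSchemeOver k'} {prG : G'.carrier ⟶ G.carrier} {α' : ActionOver G' X'}
    (hXpb : IsPullback prX X'.str X.str (Spec.map (CommRingCat.ofHom (algebraMap k k'))))
    (hGpb : IsPullback prG G'.str G.str (Spec.map (CommRingCat.ofHom (algebraMap k k'))))
    (hGmul : ∀ {T : Scheme.{u}} (a b : T ⟶ G'.carrier) (h h'),
      G'.mul a b h ≫ prG = G.mul (a ≫ prG) (b ≫ prG) h')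
    (hαcompat : ∀ {T : Scheme.{u}} (g : T ⟶ G'.carrier) (x : T ⟶ X'.carrier) (h h'),
      α'.act g x h ≫ prX = α.act (g ≫ prG) (x ≫ prX) h')
    {L' : LineBundle X'.carrier} (hL : α'.IsLinearized L') (N : LineBundle X.carrier)
    (hN : IsNormBundle prX (Module.finrank k k') L' N) : α.IsLinearized N := by
  obtain ⟨E1, D1, P1, d1, hiso⟩ := norm_fiso hXpb hN
  obtain ⟨Λ⟩ := hL
  obtain ⟨Λ1⟩ := (FLin.ofData Λ).push hXpb hGpb hGmul hαcompat P1
  obtain ⟨Λ2⟩ := Λ1.det d1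
  obtain ⟨Λ3⟩ := Λ2.transfer hiso
  exact Λ3.isLinearized

end WRN

/-- Let `k'/k` be a finite extension of fields of degree `n`, `X` a
quasi-projective scheme over `k`, and `π : L' ⟶ X_{k'}` a line bundle on the base change
`X_{k'}`. Then: (i) the Weil restriction `R_{k'/k}(π) : R_{k'/k}(L') ⟶ R_{k'/k}(X_{k'})` is
a vector bundle of rank `n`; (ii) the norm `N(L')` is isomorphic to
`j_X^*(det R_{k'/k}(L'))` where `j_X` is the adjunction closed immersion; and (iii) if `X`
carries an action of an algebraic group `G` over `k` and `L'` is `G_{k'}`-linearized, then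
`N(L')` is `G`-linearized. -/
theorem weil_restriction_norm_theorem
    {k : Type u} [Field k] (k' : Type u) [Field k'] [Algebra k k'] [FiniteDimensional k k']
    (X : SchemeOver k) (hXqp : X.IsQuasiProjective)
    -- the base change `X_{k'}`:
    (X' : SchemeOver k') (prX : X'.carrier ⟶ X.carrier)
    (hXpb : IsPullback prX X'.str X.str (Spec.map (CommRingCat.ofHom (algebraMap k k'))))
    -- a line bundle on `X_{k'}`:
    (L' : LineBundle X'.carrier)
    -- the Weil restrictions of `X_{k'}` and of the total space of `L'`:
    (RX : WeilRestrictionData k k' X')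
    (RL : WeilRestrictionData k k' ⟨L'.tot, L'.π ≫ X'.str⟩)
    -- the Weil restriction `ρ = R_{k'/k}(π)` of the projection `π : L' ⟶ X_{k'}`:
    (ρ : RL.W.carrier ⟶ RX.W.carrier) (hρstr : ρ ≫ RX.W.str = RL.W.str)
    (ρK : RL.WK ⟶ RX.WK) (hρK1 : ρK ≫ RX.q1 = RL.q1 ≫ ρ) (hρK2 : ρK ≫ RX.q2 = RL.q2)
    (hρKcounit : ρK ≫ RX.counit = RL.counit ≫ L'.π)
    -- the adjunction closed immersion `j_X : X ⟶ R_{k'/k}(X_{k'})`: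
    (jX : X.carrier ⟶ RX.W.carrier) (hjXstr : jX ≫ RX.W.str = X.str)
    (hjX : ∃ w : X'.carrier ⟶ RX.WK,
      w ≫ RX.q1 = prX ≫ jX ∧ w ≫ RX.q2 = X'.str ∧ w ≫ RX.counit = 𝟙 X'.carrier)
    -- an algebraic group `G` over `k` acting on `X`, with base change `G_{k'}` acting on
    -- `X_{k'}`, such that `L'` is `G_{k'}`-linearized:
    (G : GroupSchemeOver k) (hGalg : G.IsAlgebraic) (α : ActionOver G X)
    (G' : GroupSchemeOver k') (prG : G'.carrier ⟶ G.carrier)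
    (hGpb : IsPullback prG G'.str G.str (Spec.map (CommRingCat.ofHom (algebraMap k k'))))
    (hGmul : ∀ {T : Scheme.{u}} (a b : T ⟶ G'.carrier) (h h'),
      G'.mul a b h ≫ prG = G.mul (a ≫ prG) (b ≫ prG) h')
    (α' : ActionOver G' X')
    (hαcompat : ∀ {T : Scheme.{u}} (g : T ⟶ G'.carrier) (x : T ⟶ X'.carrier) (h h'),
      α'.act g x h ≫ prX = α.act (g ≫ prG) (x ≫ prX) h')
    (hL'lin : α'.IsLinearized L') :
    -- (i) `R_{k'/k}(π)` is a vector bundle of rank `n = [k' : k]`: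
    (∃ (E : VecBundle (Module.finrank k k') RX.W.carrier) (φ : E.tot ⟶ RL.W.carrier),
      IsIso φ ∧ φ ≫ ρ = E.π) ∧
    -- (ii) the norm `N(L')` is `j_X^*(det R_{k'/k}(L'))`:
    (∀ (E : VecBundle (Module.finrank k k') RX.W.carrier) (φ : E.tot ⟶ RL.W.carrier),
      IsIso φ → φ ≫ ρ = E.π →
      ∀ D : LineBundle RX.W.carrier, IsDetBundle E D →
      ∀ PD : LineBundle X.carrier, IsPullbackBundle jX D PD →
      ∀ N : LineBundle X.carrier, IsNormBundle prX (Module.finrank k k') L' N →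
        VBIso N PD) ∧
    -- (iii) the norm `N(L')` is `G`-linearized:
    ((∃ N : LineBundle X.carrier, IsNormBundle prX (Module.finrank k k') L' N) ∧
      ∀ N : LineBundle X.carrier, IsNormBundle prX (Module.finrank k k') L' N →
        α.IsLinearized N) := by
  refine ⟨WRN.part_one hρstr hρK1 hρK2 hρKcounit, ?_, WRN.exists_norm hXpb L', ?_⟩
  · intro E φ hφ hφρ D hD PD hPD N hN
    exact WRN.part_two hXpb hρstr hρK1 hρK2 hρKcounit hjXstr hjX E φ hφ hφρ D hD PD hPD N hN
  · intro N hN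
    exact WRN.part_three hXpb hGpb hGmul hαcompat hL'lin N hN
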